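/- Let 0<α<1/2 and β>2α. Suppose γ_i : 𝕋×[0,T] → ℝ² (i = 1,2) are C^{1,β} flows of two C^{1,β} patch solutions (Ω_{i,t}) of α-SQG, with unit tangents T_i and arc-length metrics g_i. Then there exists a constant C > 0 such that for all t ∈ [0,T], |T_1(·,t)−T_2(·,t)|²_{L²} ≤ |T_1(·,0)−T_2(·,0)|²_{L²} + C ∫_0^t ( |T_1(·,τ)−T_2(·,τ)|²_{L²} + |g_1(·,τ)−g_2(·,τ)|²_{L²} ) dτ. -/

import Mathlib

open MeasureTheory Real Set Function Filter Bornology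
open scoped RealInnerProductSpace Topology

noncomputable section

/-- The plane `ℝ²`. -/
abbrev R2 := EuclideanSpace ℝ (Fin 2)

/-- The counterclockwise rotation by 90°: `(a,b)^⊥ = (-b,a)`. -/
def perp (v : R2) : R2 := (WithLp.equiv 2 (Fin 2 → ℝ)).symm ![-(v 1), v 0]

/-- The α-SQG velocity generated by a bounded set `U`:
`v_U(x) = ∫_U (x-y)^⊥ / ‖x-y‖^{2+2α} dy`. -/
def sqgVelocity (α : ℝ) (U : Set R2) (x : R2) : R2 :=
  ∫ y in U, (‖x - y‖ ^ (2 + 2 * α))⁻¹ • perp (x - y)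

/-- Eulerian (weak) patch solution of the α-SQG equation on `[0,T]`: a time-dependent
bounded domain such that `χ_{Ω_t}` is a weak solution of the transport equation by the
α-SQG velocity of `Ω_t`, tested against smooth compactly supported functions on
`ℝ² × [0,T)`. -/
def IsPatchSol (α T : ℝ) (Ω : ℝ → Set R2) : Prop :=
  (∀ t ∈ Icc (0:ℝ) T, IsOpen (Ω t) ∧ IsBounded (Ω t) ∧ IsConnected (Ω t)) ∧
  ∀ φ : R2 × ℝ → ℝ, ContDiff ℝ (⊤ : ℕ∞) φ → HasCompactSupport φ →
    (∀ p : R2 × ℝ, T ≤ p.2 → φ p = 0) →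
    ∫ x in Ω 0, φ (x, 0) =
      - ∫ t in Ioc (0:ℝ) T, ∫ x in Ω t,
          (deriv (fun s => φ (x, s)) t +
            ⟪sqgVelocity α (Ω t) x, gradient (fun y => φ (y, t)) x⟫)

/-- `γ` is an `L`-periodic arc-length (unit-speed) parametrization of the set `S`:
`L`-periodic, injective on `[0,L)`, `C¹` with `‖γ'‖ ≡ 1`, and with image `S`. -/
def IsArcLengthParam (L : ℝ) (γ : ℝ → R2) (S : Set R2) : Prop :=
  0 < L ∧ Periodic γ L ∧ InjOn γ (Ico 0 L) ∧ ContDiff ℝ 1 γ ∧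
    (∀ s, ‖deriv γ s‖ = 1) ∧ range γ = S

/-- `C^{1,β}` patch solution: a patch solution whose boundaries admit arc-length
parametrizations with a `β`-Hölder bound on the derivative, uniform in time. -/
def IsC1BetaPatchSol (α T β : ℝ) (Ω : ℝ → Set R2) : Prop :=
  IsPatchSol α T Ω ∧ ∃ M : ℝ, ∀ t ∈ Icc (0:ℝ) T, ∃ L γ,
    IsArcLengthParam L γ (frontier (Ω t)) ∧
    ∀ s s' : ℝ, ‖deriv γ s - deriv γ s'‖ ≤ M * |s - s'| ^ β

/-- Spatial derivative `∂ₓγ` of a time-dependent parametrization. -/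
def pderiv (γ : ℝ → ℝ → R2) (x t : ℝ) : R2 := deriv (fun x' => γ x' t) x

/-- Arc-length metric `g = ‖∂ₓγ‖` of a time-dependent parametrization. -/
def metricOf (γ : ℝ → ℝ → R2) (x t : ℝ) : ℝ := ‖pderiv γ x t‖

/-- Unit tangent `T = ∂ₓγ / ‖∂ₓγ‖` of a time-dependent parametrization. -/
def tangentOf (γ : ℝ → ℝ → R2) (x t : ℝ) : R2 := (metricOf γ x t)⁻¹ • pderiv γ x t

/-- Squared `L²`-norm over one period `[0,2π]` of the torus `𝕋 = ℝ/2πℤ`. -/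
def L2sq {E : Type*} [NormedAddCommGroup E] (f : ℝ → E) : ℝ :=
  ∫ x in Ioc (0:ℝ) (2 * π), ‖f x‖ ^ 2

/-- `γ` is a (Lagrangian) flow of the patch solution `Ω` on `[0,T]`: for each `t` it is
a `2π`-periodic `C¹` parametrization of `∂Ω_t` with nonvanishing derivative, and the
trajectories solve `∂ₜγ(x,t) = v(γ(x,t),t)` with `v(·,t)` the α-SQG velocity of `Ω_t`. -/
def IsFlowOf (α T : ℝ) (Ω : ℝ → Set R2) (γ : ℝ → ℝ → R2) : Prop :=
  (∀ t ∈ Icc (0:ℝ) T,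
     Periodic (fun x => γ x t) (2 * π) ∧
     ContDiff ℝ 1 (fun x => γ x t) ∧
     InjOn (fun x => γ x t) (Ico 0 (2 * π)) ∧
     (∀ x, pderiv γ x t ≠ 0) ∧
     range (fun x => γ x t) = frontier (Ω t)) ∧
  (∀ x : ℝ, ∀ t ∈ Icc (0:ℝ) T,
     HasDerivWithinAt (fun s => γ x s) (sqgVelocity α (Ω t) (γ x t)) (Icc (0:ℝ) T) t)

/-- A `C^{1,β}` flow: a flow bounded in `C^{1,β}(𝕋)` uniformly in time. -/
def IsC1BetaFlow (α β T : ℝ) (Ω : ℝ → Set R2) (γ : ℝ → ℝ → R2) : Prop :=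
  IsFlowOf α T Ω γ ∧ ∃ M : ℝ, ∀ t ∈ Icc (0:ℝ) T, ∀ x y : ℝ,
    ‖γ x t‖ ≤ M ∧ ‖pderiv γ x t‖ ≤ M ∧
    ‖pderiv γ x t - pderiv γ y t‖ ≤ M * |x - y| ^ β

/-- The planar cross product `a × b = a₀ b₁ - a₁ b₀`. -/
def cross (a b : R2) : ℝ := a 0 * b 1 - a 1 * b 0

lemma continuous_cross : Continuous fun p : R2 × R2 => cross p.1 p.2 := by
  unfold cross; fun_prop

lemma Continuous.cross {X : Type*} [TopologicalSpace X] {f g : X → R2}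
    (hf : Continuous f) (hg : Continuous g) : Continuous fun x => cross (f x) (g x) :=
  continuous_cross.comp (hf.prodMk hg)

/-- Cramer's rule in the plane. -/
lemma cross_smul_eq (p e v : R2) : cross p e • v = cross v e • p + cross p v • e := by
  ext i
  fin_cases i <;> simp [cross] <;> ring

/-- The chart `(s, z) ↦ γ(s) + z e`. -/
def stripChart (γ : ℝ → R2) (e : R2) (q : R2) : R2 := γ (q 0) + q 1 • e

/-- The differential of `stripChart` when `γ` has derivative `p`. -/
def stripDeriv (p e : R2) : R2 →L[ℝ] R2 :=
  (EuclideanSpace.proj (0 : Fin 2)).smulRight p + (EuclideanSpace.proj (1 : Fin 2)).smulRight e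

lemma stripDeriv_det (p e : R2) : (stripDeriv p e).det = cross p e := by
  rw [ContinuousLinearMap.det,
    ← LinearMap.det_toMatrix (EuclideanSpace.basisFun (Fin 2) ℝ).toBasis, Matrix.det_fin_two]
  simp [LinearMap.toMatrix_apply, stripDeriv, cross]
  ring

lemma hasStrictFDerivAt_stripChart {γ : ℝ → R2} (hγ : ContDiff ℝ 1 γ) (e q : R2) :
    HasStrictFDerivAt (stripChart γ e) (stripDeriv (deriv γ (q 0)) e) q := by
  have h0 : HasStrictFDerivAt (fun q : R2 => q 0) (EuclideanSpace.proj (0 : Fin 2) : R2 →L[ℝ] ℝ) q :=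
    (EuclideanSpace.proj (0 : Fin 2) : R2 →L[ℝ] ℝ).hasStrictFDerivAt
  have h1 : HasStrictFDerivAt (fun q : R2 => q 1) (EuclideanSpace.proj (1 : Fin 2) : R2 →L[ℝ] ℝ) q :=
    (EuclideanSpace.proj (1 : Fin 2) : R2 →L[ℝ] ℝ).hasStrictFDerivAt
  have hg : HasStrictDerivAt γ (deriv γ (q 0)) (q 0) :=
    hγ.contDiffAt.hasStrictDerivAt one_ne_zero
  have h2 := hg.hasStrictFDerivAt.comp q h0
  have h3 := h2.add (h1.smul_const e)
  have e1 : stripDeriv (deriv γ (q 0)) e =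
      (ContinuousLinearMap.toSpanSingleton ℝ (deriv γ (q 0))).comp (EuclideanSpace.proj 0) +
        (EuclideanSpace.proj (1 : Fin 2) : R2 →L[ℝ] ℝ).smulRight e := by
    ext v i
    simp [stripDeriv]
  rw [e1]
  exact h3

lemma setIntegral_R2_box {E : Type*} [NormedAddCommGroup E] [NormedSpace ℝ E]
    (s t : Set ℝ) (G : ℝ × ℝ → E) :
    ∫ q in {q : R2 | q 0 ∈ s ∧ q 1 ∈ t}, G (q 0, q 1) = ∫ q in s ×ˢ t, G q := by
  have h := ((volume_preserving_finTwoArrow ℝ).comp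
    (EuclideanSpace.volume_preserving_symm_measurableEquiv_toLp (Fin 2)))
  have he : MeasurableEmbedding ((MeasurableEquiv.finTwoArrow (α := ℝ)) ∘
      (MeasurableEquiv.toLp 2 (Fin 2 → ℝ)).symm) :=
    (MeasurableEquiv.finTwoArrow (α := ℝ)).measurableEmbedding.comp
      (MeasurableEquiv.toLp 2 (Fin 2 → ℝ)).symm.measurableEmbedding
  have := h.setIntegral_preimage_emb he G (s ×ˢ t)
  rw [← this]
  rfl

/-- Green's formula on the image of a coordinate box of `stripChart`, for functions vanishing on
the two lateral sides. -/
lemma green_box {E : Type*} [NormedAddCommGroup E] [NormedSpace ℝ E] [CompleteSpace E]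
    {γ : ℝ → R2} (hγ : ContDiff ℝ 1 γ) {e : R2} {a b c d : ℝ} (hab : a ≤ b) (hcd : c ≤ d)
    (hinj : ∀ s ∈ Icc a b, ∀ s' ∈ Icc a b, ∀ z z' : ℝ,
      γ s + z • e = γ s' + z' • e → s = s' ∧ z = z')
    (hdet : ∀ s ∈ Icc a b, 0 < cross (deriv γ s) e)
    {f : R2 → E} (hf : ContDiff ℝ 1 f) (v : R2)
    (ha : ∀ z ∈ Icc c d, f (γ a + z • e) = 0) (hb : ∀ z ∈ Icc c d, f (γ b + z • e) = 0) :
    ∫ y in stripChart γ e '' {q | q 0 ∈ Ioo a b ∧ q 1 ∈ Ioo c d}, fderiv ℝ f y v =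
      ∫ s in a..b, cross (deriv γ s) v • (f (γ s + d • e) - f (γ s + c • e)) := by
  have hγ' : Continuous (deriv γ) := hγ.continuous_deriv le_rfl
  have hf' : Continuous (fderiv ℝ f) := hf.continuous_fderiv one_ne_zero
  have hγc := hγ.continuous
  set B : Set R2 := {q | q 0 ∈ Ioo a b ∧ q 1 ∈ Ioo c d} with hB
  have hBo : IsOpen B := by
    have h1 : IsOpen ((fun q : R2 => q 0) ⁻¹' Ioo a b) := isOpen_Ioo.preimage (by fun_prop)
    have h2 : IsOpen ((fun q : R2 => q 1) ⁻¹' Ioo c d) := isOpen_Ioo.preimage (by fun_prop)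
    exact h1.inter h2
  have hBm : MeasurableSet B := hBo.measurableSet
  have hinjB : InjOn (stripChart γ e) B := by
    intro q hq q' hq' h
    obtain ⟨h0, h1⟩ := hinj _ (Ioo_subset_Icc_self hq.1) _ (Ioo_subset_Icc_self hq'.1) _ _ h
    ext i
    fin_cases i
    · exact h0
    · exact h1
  rw [integral_image_eq_integral_abs_det_fderiv_smul volume hBm
    (fun q _ => (hasStrictFDerivAt_stripChart hγ e q).hasFDerivAt.hasFDerivWithinAt) hinjB]
  set G₁ : ℝ → ℝ → E := fun s z => cross v e • fderiv ℝ f (γ s + z • e) (deriv γ s) with hG₁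
  set G₂ : ℝ → ℝ → E := fun s z => cross (deriv γ s) v • fderiv ℝ f (γ s + z • e) e with hG₂
  have hc : Continuous fun q : ℝ × ℝ => fderiv ℝ f (γ q.1 + q.2 • e) :=
    hf'.comp ((hγc.comp continuous_fst).add (continuous_snd.smul continuous_const))
  have hG₁c : Continuous (uncurry G₁) :=
    continuous_const.smul (hc.clm_apply (hγ'.comp continuous_fst))
  have hG₂c : Continuous (uncurry G₂) :=
    ((hγ'.comp continuous_fst).cross continuous_const).smul (hc.clm_apply continuous_const)
  have hint : ∀ G : ℝ × ℝ → E, Continuous G → IntegrableOn G (Ioo a b ×ˢ Ioo c d) := by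
    intro G hG
    exact (hG.continuousOn.integrableOn_compact (isCompact_Icc.prod isCompact_Icc)).mono_set
      (prod_mono Ioo_subset_Icc_self Ioo_subset_Icc_self)
  have e1 : ∫ q in B, |(stripDeriv (deriv γ (q 0)) e).det| • fderiv ℝ f (stripChart γ e q) v
      = ∫ q in B, (uncurry G₁ + uncurry G₂) (q 0, q 1) := by
    refine setIntegral_congr_fun hBm fun q hq => ?_
    have hpos := hdet _ (Ioo_subset_Icc_self hq.1)
    simp only [stripDeriv_det, abs_of_pos hpos]
    rw [← map_smul, cross_smul_eq]
    simp [hG₁, hG₂, stripChart]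
  rw [e1, setIntegral_R2_box]
  simp only [Pi.add_apply]
  rw [integral_add (hint _ hG₁c) (hint _ hG₂c)]
  have hD1 : ∀ s z : ℝ, HasDerivAt (fun s => f (γ s + z • e))
      (fderiv ℝ f (γ s + z • e) (deriv γ s)) s := by
    intro s z
    have h1 : HasDerivAt (fun s => γ s + z • e) (deriv γ s) s :=
      ((hγ.differentiable one_ne_zero) s).hasDerivAt.add_const _
    exact ((hf.differentiable one_ne_zero _).hasFDerivAt).comp_hasDerivAt s h1
  have hD2 : ∀ s z : ℝ, HasDerivAt (fun z : ℝ => f (γ s + z • e))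
      (fderiv ℝ f (γ s + z • e) e) z := by
    intro s z
    have h1 : HasDerivAt (fun z : ℝ => γ s + z • e) e z := by
      simpa using ((hasDerivAt_id z).smul_const e).const_add (γ s)
    exact ((hf.differentiable one_ne_zero _).hasFDerivAt).comp_hasDerivAt z h1
  have t1 : ∫ q in Ioo a b ×ˢ Ioo c d, uncurry G₁ q = 0 := by
    rw [Measure.volume_eq_prod, ← setIntegral_prod_swap,
      setIntegral_prod (fun z : ℝ × ℝ => uncurry G₁ z.swap) ((hint _ hG₁c).swap)]
    refine setIntegral_eq_zero_of_forall_eq_zero fun z hz => ?_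
    have hz' := Ioo_subset_Icc_self hz
    rw [← integral_Ioc_eq_integral_Ioo, ← intervalIntegral.integral_of_le hab]
    simp only [Prod.swap_prod_mk, uncurry_apply_pair, hG₁]
    rw [intervalIntegral.integral_smul,
      intervalIntegral.integral_eq_sub_of_hasDerivAt (fun s _ => hD1 s z)]
    · simp [ha z hz', hb z hz']
    · exact ((hc.comp (Continuous.prodMk_left z)).clm_apply hγ').intervalIntegrable _ _
  have t2 : ∫ q in Ioo a b ×ˢ Ioo c d, uncurry G₂ q =
      ∫ s in a..b, cross (deriv γ s) v • (f (γ s + d • e) - f (γ s + c • e)) := by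
    rw [Measure.volume_eq_prod, setIntegral_prod _ (hint _ hG₂c),
      intervalIntegral.integral_of_le hab, integral_Ioc_eq_integral_Ioo]
    refine setIntegral_congr_fun measurableSet_Ioo fun s hs => ?_
    rw [← integral_Ioc_eq_integral_Ioo, ← intervalIntegral.integral_of_le hcd]
    simp only [uncurry_apply_pair, hG₂]
    rw [intervalIntegral.integral_smul,
      intervalIntegral.integral_eq_sub_of_hasDerivAt (fun z _ => hD2 s z)]
    exact ((hc.comp (Continuous.prodMk_right s)).clm_apply continuous_const).intervalIntegrable _ _
  rw [t1, t2, zero_add]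

@[simp] lemma perp_zero_coord (v : R2) : perp v 0 = -(v 1) := rfl
@[simp] lemma perp_one_coord (v : R2) : perp v 1 = v 0 := rfl

lemma continuous_perp : Continuous perp := by
  refine (PiLp.continuous_toLp 2 _).comp ?_
  refine continuous_pi fun i => ?_
  fin_cases i
  · exact ((EuclideanSpace.proj (1 : Fin 2) : R2 →L[ℝ] ℝ).continuous).neg
  · exact (EuclideanSpace.proj (0 : Fin 2) : R2 →L[ℝ] ℝ).continuous

lemma perp_eq_zero {v : R2} (h : perp v = 0) : v = 0 := by
  have e0 := congrArg (fun v : R2 => v 0) h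
  have e1 := congrArg (fun v : R2 => v 1) h
  simp at e0 e1
  ext i
  fin_cases i
  · simpa using e1
  · simpa using e0

lemma inner_R2 (a b : R2) : ⟪a, b⟫ = a 0 * b 0 + a 1 * b 1 := by
  simp [PiLp.inner_apply, Fin.sum_univ_two]; ring

lemma cross_perp (a b : R2) : cross a (perp b) = ⟪a, b⟫ := by
  simp [cross, inner_R2]

lemma inner_perp_self (a : R2) : ⟪perp a, a⟫ = 0 := by
  simp [inner_R2]; ring

/-- A regular simple closed `C¹` curve of period `2π`. -/
structure IsSimpleLoop (γ : ℝ → R2) : Prop where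
  contDiff : ContDiff ℝ 1 γ
  periodic : Periodic γ (2 * π)
  injOn : InjOn γ (Ico 0 (2 * π))
  deriv_ne : ∀ x, deriv γ x ≠ 0

namespace IsSimpleLoop

variable {γ : ℝ → R2}

lemma continuous_deriv (h : IsSimpleLoop γ) : Continuous (deriv γ) :=
  h.contDiff.continuous_deriv le_rfl

lemma hasDerivAt (h : IsSimpleLoop γ) (x : ℝ) : HasDerivAt γ (deriv γ x) x :=
  (h.contDiff.differentiable one_ne_zero x).hasDerivAt

lemma periodic_deriv (h : IsSimpleLoop γ) : Periodic (deriv γ) (2 * π) := by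
  intro x
  have := deriv_comp_add_const (f := γ) (2 * π) x
  rw [← this]
  congr 1
  exact funext h.periodic

lemma exists_int_of_eq (h : IsSimpleLoop γ) {x y : ℝ} (hxy : γ x = γ y) :
    ∃ n : ℤ, x = y + n * (2 * π) := by
  have hp : (0 : ℝ) < 2 * π := by positivity
  have hx : γ (toIcoMod hp 0 x) = γ x := by
    rw [toIcoMod, h.periodic.sub_zsmul_eq]
  have hy : γ (toIcoMod hp 0 y) = γ y := by
    rw [toIcoMod, h.periodic.sub_zsmul_eq]
  have mx := toIcoMod_mem_Ico hp 0 x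
  have my := toIcoMod_mem_Ico hp 0 y
  rw [zero_add] at mx my
  have := h.injOn mx my (by rw [hx, hy, hxy])
  refine ⟨toIcoDiv hp 0 x - toIcoDiv hp 0 y, ?_⟩
  have ex := toIcoMod_add_toIcoDiv_zsmul hp 0 x
  have ey := toIcoMod_add_toIcoDiv_zsmul hp 0 y
  simp only [zsmul_eq_mul] at ex ey
  push_cast
  linarith

lemma eq_of_abs_lt (h : IsSimpleLoop γ) {x y : ℝ} (hxy : γ x = γ y) (hlt : |x - y| < 2 * π) :
    x = y := by
  obtain ⟨n, hn⟩ := h.exists_int_of_eq hxy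
  have hp : (0 : ℝ) < 2 * π := by positivity
  have h1 : |(n : ℝ)| * (2 * π) < 1 * (2 * π) := by
    have : x - y = n * (2 * π) := by linarith
    rw [this, abs_mul, abs_of_pos hp] at hlt
    linarith
  have h2 : |(n : ℝ)| < 1 := lt_of_mul_lt_mul_right h1 hp.le
  have h3 : n = 0 := by
    rw [← Int.abs_lt_one_iff]
    exact_mod_cast h2
  simp [hn, h3]

/-- Points of the loop close to `γ s₀` have parameter close to `s₀` modulo the period. -/
lemma exists_ball_param (h : IsSimpleLoop γ) (s₀ : ℝ) {δ : ℝ} (hδ : 0 < δ) :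
    ∃ d > 0, ∀ s, γ s ∈ Metric.ball (γ s₀) d → ∃ n : ℤ, |s + n * (2 * π) - s₀| < δ := by
  have hp : (0 : ℝ) < 2 * π := by positivity
  have hK : IsClosed (γ '' Icc (s₀ + δ) (s₀ - δ + 2 * π)) :=
    (isCompact_Icc.image h.contDiff.continuous).isClosed
  have hn : γ s₀ ∉ γ '' Icc (s₀ + δ) (s₀ - δ + 2 * π) := by
    rintro ⟨s, hs, hse⟩
    have := h.eq_of_abs_lt hse (by rw [abs_lt]; constructor <;> linarith [hs.1, hs.2])
    linarith [hs.1]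
  obtain ⟨d, hd, hdd⟩ := Metric.isOpen_iff.1 hK.isOpen_compl _ hn
  refine ⟨d, hd, fun s hs => ?_⟩
  have hx : γ (toIocMod hp (s₀ - δ) s) = γ s := by
    rw [toIocMod, h.periodic.sub_zsmul_eq]
  have mx := toIocMod_mem_Ioc hp (s₀ - δ) s
  have ex := toIocMod_add_toIocDiv_zsmul hp (s₀ - δ) s
  simp only [zsmul_eq_mul] at ex
  have hlt : toIocMod hp (s₀ - δ) s < s₀ + δ := by
    by_contra hcon
    exact hdd hs ⟨_, ⟨not_lt.1 hcon, mx.2⟩, hx⟩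
  refine ⟨-toIocDiv hp (s₀ - δ) s, ?_⟩
  push_cast
  rw [abs_lt]
  constructor <;> linarith [mx.1]

/-- On a short parameter interval all tangents have positive inner products. -/
lemma exists_inner_pos (h : IsSimpleLoop γ) (s₀ : ℝ) :
    ∃ δ > 0, δ < π ∧ ∀ s ∈ Icc (s₀ - δ) (s₀ + δ), ∀ s' ∈ Icc (s₀ - δ) (s₀ + δ),
      0 < ⟪deriv γ s, deriv γ s'⟫ := by
  have hc : Continuous fun q : ℝ × ℝ => ⟪deriv γ q.1, deriv γ q.2⟫ :=
    (h.continuous_deriv.comp continuous_fst).inner (h.continuous_deriv.comp continuous_snd)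
  have hpos : 0 < ⟪deriv γ s₀, deriv γ s₀⟫ := real_inner_self_pos.2 (h.deriv_ne s₀)
  have hmem : {q : ℝ × ℝ | 0 < ⟪deriv γ q.1, deriv γ q.2⟫} ∈ 𝓝 (s₀, s₀) :=
    (isOpen_lt continuous_const hc).mem_nhds hpos
  obtain ⟨r, hr, hrr⟩ := Metric.mem_nhds_iff.1 hmem
  refine ⟨min (r / 2) 1, by positivity, (min_le_right _ _).trans_lt (by linarith [pi_gt_three]),
    fun s hs s' hs' => ?_⟩
  have hb : ∀ u ∈ Icc (s₀ - min (r / 2) 1) (s₀ + min (r / 2) 1), dist u s₀ < r := by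
    intro u hu
    have := min_le_left (r / 2) 1
    rw [Real.dist_eq, abs_lt]
    constructor <;> linarith [hu.1, hu.2]
  have : ((s, s') : ℝ × ℝ) ∈ Metric.ball (s₀, s₀) r := by
    rw [Metric.mem_ball, Prod.dist_eq]
    exact max_lt (hb s hs) (hb s' hs')
  exact hrr this

lemma eq_of_inner_eq (h : IsSimpleLoop γ) {s₀ δ : ℝ} {u : R2}
    (hpos : ∀ s ∈ Icc (s₀ - δ) (s₀ + δ), 0 < ⟪deriv γ s, u⟫) {s s' : ℝ}
    (hs : s ∈ Icc (s₀ - δ) (s₀ + δ)) (hs' : s' ∈ Icc (s₀ - δ) (s₀ + δ))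
    (he : ⟪γ s, u⟫ = ⟪γ s', u⟫) : s = s' := by
  have hd : ∀ x, HasDerivAt (fun x => ⟪γ x, u⟫) ⟪deriv γ x, u⟫ x := by
    intro x
    simpa using (h.hasDerivAt x).inner ℝ (hasDerivAt_const x u)
  have hm : StrictMonoOn (fun x => ⟪γ x, u⟫) (Icc (s₀ - δ) (s₀ + δ)) := by
    refine strictMonoOn_of_deriv_pos (convex_Icc _ _)
      (fun x _ => (hd x).continuousAt.continuousWithinAt) fun x hx => ?_
    rw [(hd x).deriv]
    exact hpos x (interior_subset hx)
  exact hm.injOn hs hs' he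

/-- Normal segments near the loop meet the loop only at their foot. -/
lemma exists_normal_notMem (h : IsSimpleLoop γ) (s₀ : ℝ) :
    ∃ r > 0, ∀ s ∈ Ioo (s₀ - r) (s₀ + r), ∀ z : ℝ, z ≠ 0 → |z| < r →
      γ s + z • perp (deriv γ s) ∉ range γ := by
  obtain ⟨δ, hδ, hδπ, hpos⟩ := h.exists_inner_pos s₀
  obtain ⟨d, hd, hdd⟩ := h.exists_ball_param s₀ hδ
  have hc : Continuous fun q : ℝ × ℝ => γ q.1 + q.2 • perp (deriv γ q.1) :=
    (h.contDiff.continuous.comp continuous_fst).add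
      (continuous_snd.smul (continuous_perp.comp (h.continuous_deriv.comp continuous_fst)))
  have hmem : (fun q : ℝ × ℝ => γ q.1 + q.2 • perp (deriv γ q.1)) ⁻¹' Metric.ball (γ s₀) d
      ∈ 𝓝 ((s₀, 0) : ℝ × ℝ) := by
    refine (Metric.isOpen_ball.preimage hc).mem_nhds ?_
    simpa using hd
  obtain ⟨r, hr, hrr⟩ := Metric.mem_nhds_iff.1 hmem
  have hrr' : ∀ q ∈ Metric.ball ((s₀, 0) : ℝ × ℝ) r,
      γ q.1 + q.2 • perp (deriv γ q.1) ∈ Metric.ball (γ s₀) d := fun q hq => hrr hq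
  clear hrr hmem hc
  refine ⟨min r δ, lt_min hr hδ, fun s hs z hz hzr => ?_⟩
  rintro ⟨s', hs'⟩
  have hsr : dist s s₀ < r := by
    rw [Real.dist_eq, abs_lt]
    constructor <;> linarith [hs.1, hs.2, min_le_left r δ]
  have hball : γ s + z • perp (deriv γ s) ∈ Metric.ball (γ s₀) d := by
    have : ((s, z) : ℝ × ℝ) ∈ Metric.ball ((s₀, 0) : ℝ × ℝ) r := by
      rw [Metric.mem_ball, Prod.dist_eq]
      refine max_lt hsr ?_
      rw [Real.dist_0_eq_abs]
      exact hzr.trans_le (min_le_left _ _)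
    have h2 := hrr' (s, z) this
    exact h2
  rw [← hs'] at hball
  obtain ⟨n, hn⟩ := hdd s' hball
  have hper : γ (s' + n * (2 * π)) = γ s' := by
    have := h.periodic.int_mul n s'
    simpa using this
  have hsI : s ∈ Icc (s₀ - δ) (s₀ + δ) :=
    ⟨by linarith [hs.1, min_le_right r δ], by linarith [hs.2, min_le_right r δ]⟩
  have hsI' : s' + n * (2 * π) ∈ Icc (s₀ - δ) (s₀ + δ) := by
    rw [abs_lt] at hn
    constructor <;> linarith [hn.1, hn.2]
  have heq : s' + n * (2 * π) = s := by
    refine h.eq_of_inner_eq (u := deriv γ s) (fun x hx => hpos x hx s hsI) hsI' hsI ?_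
    rw [hper, hs', inner_add_left, inner_smul_left, inner_perp_self]
    simp
  rw [heq] at hper
  rw [← hper] at hs'
  have hz0 : z • perp (deriv γ s) = 0 := by
    have := hs'
    simpa using this
  rcases smul_eq_zero.1 hz0 with h0 | h0
  · exact hz h0
  · exact h.deriv_ne s (perp_eq_zero h0)

end IsSimpleLoop

lemma IsPreconnected.subset_or_disjoint_of_frontier {X : Type*} [TopologicalSpace X] {t s : Set X}
    (ht : IsPreconnected t) (hd : Disjoint t (frontier s)) : t ⊆ s ∨ Disjoint t s := by
  have hu : t ⊆ interior s ∪ (closure s)ᶜ := by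
    intro x hx
    by_cases hc : x ∈ closure s
    · left
      by_contra hi
      exact Set.disjoint_left.1 hd hx ⟨hc, hi⟩
    · exact Or.inr hc
  have huv : Disjoint (interior s) (closure s)ᶜ :=
    disjoint_compl_right_iff_subset.2 (interior_subset.trans subset_closure)
  rcases ht.subset_or_subset isOpen_interior isClosed_closure.isOpen_compl huv hu with h | h
  · exact Or.inl (h.trans interior_subset)
  · exact Or.inr (Set.disjoint_left.2 fun x hx hs => h hx (subset_closure hs))

/-- The side `c` (`c = 1` left, `c = -1` right) of the loop at parameter `s` lies in `Ω`. -/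
def SideIn (Ω : Set R2) (γ : ℝ → R2) (c s : ℝ) : Prop :=
  ∀ᶠ z in 𝓝[>] (0 : ℝ), γ s + (c * z) • perp (deriv γ s) ∈ Ω

namespace IsSimpleLoop

variable {γ : ℝ → R2} {Ω : Set R2}

lemma sideIn_dichotomy (h : IsSimpleLoop γ) (hf : frontier Ω = range γ) {c : ℝ} (hc : |c| = 1)
    (s₀ : ℝ) : ∃ r > 0, (∀ s ∈ Ioo (s₀ - r) (s₀ + r), SideIn Ω γ c s) ∨
      (∀ s ∈ Ioo (s₀ - r) (s₀ + r), ¬ SideIn Ω γ c s) := by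
  obtain ⟨r, hr, hrr⟩ := h.exists_normal_notMem s₀
  refine ⟨r, hr, ?_⟩
  have hcont : Continuous fun q : ℝ × ℝ => γ q.1 + (c * q.2) • perp (deriv γ q.1) :=
    (h.contDiff.continuous.comp continuous_fst).add ((continuous_const.mul continuous_snd).smul
      (continuous_perp.comp (h.continuous_deriv.comp continuous_fst)))
  have hpre : IsPreconnected ((fun q : ℝ × ℝ => γ q.1 + (c * q.2) • perp (deriv γ q.1)) ''
      (Ioo (s₀ - r) (s₀ + r) ×ˢ Ioo 0 r)) :=
    (isPreconnected_Ioo.prod isPreconnected_Ioo).image _ hcont.continuousOn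
  have hdis : Disjoint ((fun q : ℝ × ℝ => γ q.1 + (c * q.2) • perp (deriv γ q.1)) ''
      (Ioo (s₀ - r) (s₀ + r) ×ˢ Ioo 0 r)) (frontier Ω) := by
    rw [hf, Set.disjoint_left]
    rintro _ ⟨q, ⟨hq1, hq2⟩, rfl⟩
    refine hrr q.1 hq1 _ ?_ ?_
    · have : c ≠ 0 := by rintro rfl; simp at hc
      exact mul_ne_zero this hq2.1.ne'
    · rw [abs_mul, hc, one_mul, abs_of_pos hq2.1]
      exact hq2.2
  have hev : ∀ᶠ z in 𝓝[>] (0 : ℝ), z ∈ Ioo 0 r := Ioo_mem_nhdsGT hr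
  rcases hpre.subset_or_disjoint_of_frontier hdis with h1 | h1
  · left
    intro s hs
    filter_upwards [hev] with z hz
    exact h1 ⟨(s, z), ⟨hs, hz⟩, rfl⟩
  · right
    intro s hs hside
    obtain ⟨z, hz, hz'⟩ := (hev.and hside).exists
    exact Set.disjoint_left.1 h1 ⟨(s, z), ⟨hs, hz⟩, rfl⟩ hz'

lemma sideIn_iff (h : IsSimpleLoop γ) (hf : frontier Ω = range γ) {c : ℝ} (hc : |c| = 1)
    (s s' : ℝ) : SideIn Ω γ c s ↔ SideIn Ω γ c s' := by
  have hl : IsLocallyConstant fun s => SideIn Ω γ c s := by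
    rw [IsLocallyConstant.iff_eventually_eq]
    intro s₀
    obtain ⟨r, hr, hrr⟩ := h.sideIn_dichotomy hf hc s₀
    have hs₀ : s₀ ∈ Ioo (s₀ - r) (s₀ + r) := ⟨by linarith, by linarith⟩
    filter_upwards [isOpen_Ioo.mem_nhds hs₀] with s hs
    rcases hrr with h1 | h1
    · exact propext ⟨fun _ => h1 _ hs₀, fun _ => h1 _ hs⟩
    · exact propext ⟨fun h2 => absurd h2 (h1 _ hs), fun h2 => absurd h2 (h1 _ hs₀)⟩
  exact iff_of_eq (hl.apply_eq_of_isPreconnected isPreconnected_univ (mem_univ _) (mem_univ _))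

end IsSimpleLoop

/-- The open coordinate box in the plane. -/
def coordBox (a b c d : ℝ) : Set R2 := {q | q 0 ∈ Ioo a b ∧ q 1 ∈ Ioo c d}

lemma isOpen_coordBox (a b c d : ℝ) : IsOpen (coordBox a b c d) := by
  have h1 : IsOpen ((fun q : R2 => q 0) ⁻¹' Ioo a b) := isOpen_Ioo.preimage (by fun_prop)
  have h2 : IsOpen ((fun q : R2 => q 1) ⁻¹' Ioo c d) := isOpen_Ioo.preimage (by fun_prop)
  exact h1.inter h2

lemma isPreconnected_coordBox (a b c d : ℝ) : IsPreconnected (coordBox a b c d) := by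
  have h1 : Convex ℝ ((EuclideanSpace.proj (0 : Fin 2) : R2 →L[ℝ] ℝ) ⁻¹' Ioo a b) :=
    (convex_Ioo a b).linear_preimage (EuclideanSpace.proj (0 : Fin 2) : R2 →L[ℝ] ℝ).toLinearMap
  have h2 : Convex ℝ ((EuclideanSpace.proj (1 : Fin 2) : R2 →L[ℝ] ℝ) ⁻¹' Ioo c d) :=
    (convex_Ioo c d).linear_preimage (EuclideanSpace.proj (1 : Fin 2) : R2 →L[ℝ] ℝ).toLinearMap
  exact (h1.inter h2).isPreconnected

namespace IsSimpleLoop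

variable {γ : ℝ → R2} {Ω : Set R2}

lemma continuous_stripChart (h : IsSimpleLoop γ) (e : R2) : Continuous (stripChart γ e) := by
  have h0 : Continuous fun q : R2 => q 0 := by fun_prop
  have h1 : Continuous fun q : R2 => q 1 := by fun_prop
  exact (h.contDiff.continuous.comp h0).add (h1.smul continuous_const)

/-- A chart straightening the loop near `s₀`. -/
lemma exists_chart (h : IsSimpleLoop γ) (s₀ : ℝ) :
    ∃ δ > 0, δ < π ∧ ∃ η > 0,
      (∀ s ∈ Icc (s₀ - δ) (s₀ + δ), ∀ s' ∈ Icc (s₀ - δ) (s₀ + δ), ∀ z z' : ℝ,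
        γ s + z • perp (deriv γ s₀) = γ s' + z' • perp (deriv γ s₀) → s = s' ∧ z = z') ∧
      (∀ s ∈ Icc (s₀ - δ) (s₀ + δ), 0 < cross (deriv γ s) (perp (deriv γ s₀))) ∧
      (∀ s, ∀ q ∈ coordBox (s₀ - δ) (s₀ + δ) (-η) η,
        γ s = stripChart γ (perp (deriv γ s₀)) q → q 1 = 0 ∧ ∃ n : ℤ, s + n * (2 * π) = q 0) := by
  obtain ⟨δ₀, hδ₀, hδπ, hpos⟩ := h.exists_inner_pos s₀
  obtain ⟨d, hd, hdd⟩ := h.exists_ball_param s₀ hδ₀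
  have hs₀ : s₀ ∈ Icc (s₀ - δ₀) (s₀ + δ₀) := ⟨by linarith, by linarith⟩
  set e := perp (deriv γ s₀) with he
  have hinj : ∀ s ∈ Icc (s₀ - δ₀) (s₀ + δ₀), ∀ s' ∈ Icc (s₀ - δ₀) (s₀ + δ₀), ∀ z z' : ℝ,
        γ s + z • e = γ s' + z' • e → s = s' ∧ z = z' := by
    intro s hs s' hs' z z' heq
    have h1 : s = s' := by
      refine h.eq_of_inner_eq (u := deriv γ s₀) (fun x hx => hpos x hx s₀ hs₀) hs hs' ?_
      have h2 := congrArg (fun v => ⟪v, deriv γ s₀⟫) heq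
      simpa [inner_add_left, inner_smul_left, he, inner_perp_self] using h2
    refine ⟨h1, ?_⟩
    rw [h1] at heq
    have h2 : (z - z') • e = 0 := by
      rw [sub_smul, sub_eq_zero]
      exact add_left_cancel heq
    rcases smul_eq_zero.1 h2 with h3 | h3
    · linarith
    · exact absurd (perp_eq_zero h3) (h.deriv_ne s₀)
  have hmem : stripChart γ e ⁻¹' Metric.ball (γ s₀) d ∈ 𝓝 (!₂[s₀, 0] : R2) := by
    refine (Metric.isOpen_ball.preimage (h.continuous_stripChart e)).mem_nhds ?_
    simpa [stripChart] using hd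
  obtain ⟨r, hr, hrr⟩ := Metric.mem_nhds_iff.1 hmem
  have hm : min δ₀ (r / 2) ≤ δ₀ := min_le_left _ _
  have hm' : min δ₀ (r / 2) ≤ r / 2 := min_le_right _ _
  have hmp : 0 < min δ₀ (r / 2) := lt_min hδ₀ (by positivity)
  have hsub : Icc (s₀ - min δ₀ (r / 2)) (s₀ + min δ₀ (r / 2)) ⊆ Icc (s₀ - δ₀) (s₀ + δ₀) :=
    Icc_subset_Icc (by linarith) (by linarith)
  refine ⟨min δ₀ (r / 2), hmp, by linarith, r / 2, by positivity,
    fun s hs s' hs' => hinj s (hsub hs) s' (hsub hs'), ?_, ?_⟩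
  · intro s hs
    rw [he, cross_perp]
    exact hpos s (hsub hs) s₀ hs₀
  · intro s q hq hsq
    obtain ⟨hq0, hq1⟩ := hq
    have hqr : q ∈ Metric.ball (!₂[s₀, 0] : R2) r := by
      rw [Metric.mem_ball, EuclideanSpace.dist_eq, Fin.sum_univ_two]
      have a0 : dist (q 0) s₀ < r / 2 := by
        rw [Real.dist_eq, abs_lt]
        constructor <;> linarith [hq0.1, hq0.2]
      have a1 : dist (q 1) 0 < r / 2 := by
        rw [Real.dist_eq, abs_lt]
        constructor <;> linarith [hq1.1, hq1.2]
      have n0 := dist_nonneg (x := q 0) (y := s₀)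
      have n1 := dist_nonneg (x := q 1) (y := (0 : ℝ))
      rw [Real.sqrt_lt' hr]
      simp only [Matrix.cons_val_zero, Matrix.cons_val_one]
      nlinarith
    have hb : stripChart γ e q ∈ Metric.ball (γ s₀) d := hrr hqr
    rw [← hsq] at hb
    obtain ⟨n, hn⟩ := hdd s hb
    have hper : γ (s + n * (2 * π)) = γ s := by
      simpa using h.periodic.int_mul n s
    rw [abs_lt] at hn
    have := hinj (s + n * (2 * π)) ⟨by linarith, by linarith⟩ (q 0)
      (hsub (Ioo_subset_Icc_self hq0)) 0 (q 1) (by rw [hper, hsq]; simp [stripChart])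
    exact ⟨this.2.symm, n, this.1⟩

end IsSimpleLoop

open Classical in
/-- Indicator of whether the side `c` of the loop lies in `Ω`. -/
def sideCoef (Ω : Set R2) (γ : ℝ → R2) (c : ℝ) : ℝ := if SideIn Ω γ c 0 then 1 else 0

/-- The orientation of the loop relative to `Ω`: `1` if `Ω` lies to its left. -/
def orient (Ω : Set R2) (γ : ℝ → R2) : ℝ := sideCoef Ω γ 1 - sideCoef Ω γ (-1)

lemma Function.Periodic.intervalIntegral_eq_of_forall_eq_zero {E : Type*} [NormedAddCommGroup E]
    [NormedSpace ℝ E] {F : ℝ → E} (hF : Periodic F (2 * π)) (hFc : Continuous F) {s₀ δ : ℝ}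
    (hδ : 0 < δ) (hδπ : δ < π)
    (h0 : ∀ s, δ ≤ |s - s₀| → |s - s₀| ≤ π → F s = 0) :
    ∫ s in (s₀ - δ)..(s₀ + δ), F s = ∫ s in (0 : ℝ)..(2 * π), F s := by
  have h1 : ∫ s in (s₀ - π)..(s₀ - π + 2 * π), F s = ∫ s in (0 : ℝ)..(0 + 2 * π), F s :=
    hF.intervalIntegral_add_eq _ _
  rw [zero_add, show s₀ - π + 2 * π = s₀ + π by ring] at h1
  rw [← h1, ← intervalIntegral.integral_add_adjacent_intervals (a := s₀ - π) (b := s₀ - δ)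
    (c := s₀ + π) (hFc.intervalIntegrable _ _) (hFc.intervalIntegrable _ _),
    ← intervalIntegral.integral_add_adjacent_intervals (a := s₀ - δ) (b := s₀ + δ)
    (c := s₀ + π) (hFc.intervalIntegrable _ _) (hFc.intervalIntegrable _ _)]
  have e1 : ∫ s in (s₀ - π)..(s₀ - δ), F s = 0 := by
    rw [intervalIntegral.integral_congr (g := fun _ => (0 : E)), intervalIntegral.integral_zero]
    intro s hs
    rw [uIcc_of_le (by linarith)] at hs
    have : |s - s₀| = s₀ - s := by rw [abs_of_nonpos (by linarith [hs.2])]; ring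
    exact h0 s (by rw [this]; linarith [hs.2]) (by rw [this]; linarith [hs.1])
  have e2 : ∫ s in (s₀ + δ)..(s₀ + π), F s = 0 := by
    rw [intervalIntegral.integral_congr (g := fun _ => (0 : E)), intervalIntegral.integral_zero]
    intro s hs
    rw [uIcc_of_le (by linarith)] at hs
    have : |s - s₀| = s - s₀ := abs_of_nonneg (by linarith [hs.1])
    exact h0 s (by rw [this]; linarith [hs.1]) (by rw [this]; linarith [hs.2])
  rw [e1, e2]; simp

namespace IsSimpleLoop

variable {γ : ℝ → R2} {Ω : Set R2} {E : Type*} [NormedAddCommGroup E] [NormedSpace ℝ E]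

lemma setIntegral_inter_side (h : IsSimpleLoop γ) (hf : frontier Ω = range γ) {c : ℝ}
    (hc : |c| = 1) (s₀ : ℝ) {S : Set R2} (hS : IsPreconnected S) (hd : Disjoint S (range γ))
    (hm : ∀ᶠ z in 𝓝[>] (0 : ℝ), γ s₀ + (c * z) • perp (deriv γ s₀) ∈ S) (G : R2 → E) :
    ∫ y in Ω ∩ S, G y = sideCoef Ω γ c • ∫ y in S, G y := by
  have hiff := h.sideIn_iff hf hc 0 s₀
  rw [← hf] at hd
  by_cases hs : SideIn Ω γ c 0
  · have : S ⊆ Ω := by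
      rcases hS.subset_or_disjoint_of_frontier hd with h1 | h1
      · exact h1
      · obtain ⟨z, hz, hz'⟩ := (hm.and (hiff.1 hs)).exists
        exact absurd hz' (Set.disjoint_left.1 h1 hz)
    rw [inter_eq_right.2 this, sideCoef, if_pos hs, one_smul]
  · have : Disjoint S Ω := by
      rcases hS.subset_or_disjoint_of_frontier hd with h1 | h1
      · refine absurd (hiff.2 ?_) hs
        exact hm.mono fun z hz => h1 hz
      · exact h1
    rw [Set.disjoint_iff_inter_eq_empty.1 this.symm, sideCoef, if_neg hs]
    simp

lemma green_local [CompleteSpace E] (h : IsSimpleLoop γ) (hf : frontier Ω = range γ)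
    (hΩ : IsOpen Ω) (hb : IsBounded Ω) (s₀ : ℝ) :
    ∃ V : Set R2, IsOpen V ∧ γ s₀ ∈ V ∧ ∀ f : R2 → E, ContDiff ℝ 1 f → tsupport f ⊆ V → ∀ v,
      ∫ y in Ω, fderiv ℝ f y v =
        orient Ω γ • ∫ s in (0 : ℝ)..(2 * π), cross v (deriv γ s) • f (γ s) := by
  obtain ⟨δ, hδ, hδπ, η, hη, hinj, hdet, hchart⟩ := h.exists_chart s₀
  set e := perp (deriv γ s₀) with he
  have hopen : ∀ s : Set R2, IsOpen s → s ⊆ coordBox (s₀ - δ) (s₀ + δ) (-η) η →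
      IsOpen (stripChart γ e '' s) := by
    intro s hs hsub
    rw [isOpen_iff_mem_nhds]
    rintro _ ⟨q, hq, rfl⟩
    have hst := hasStrictFDerivAt_stripChart h.contDiff e q
    have hc := hdet (q 0) (Ioo_subset_Icc_self (hsub hq).1)
    have hr : (stripDeriv (deriv γ (q 0)) e).range = ⊤ := by
      rw [LinearMap.range_eq_top]
      intro w
      refine ⟨(cross (deriv γ (q 0)) e)⁻¹ • !₂[cross w e, cross (deriv γ (q 0)) w], ?_⟩
      have := cross_smul_eq (deriv γ (q 0)) e w
      have h2 : stripDeriv (deriv γ (q 0)) e !₂[cross w e, cross (deriv γ (q 0)) w] =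
          cross (deriv γ (q 0)) e • w := by
        rw [this]; simp [stripDeriv]
      rw [map_smul]
      erw [h2]
      rw [smul_smul, inv_mul_cancel₀ hc.ne', one_smul]
    rw [← hst.map_nhds_eq_of_surj hr]
    exact image_mem_map (hs.mem_nhds hq)
  have hsubp : coordBox (s₀ - δ) (s₀ + δ) 0 η ⊆ coordBox (s₀ - δ) (s₀ + δ) (-η) η :=
    fun q hq => ⟨hq.1, by linarith [hq.2.1], hq.2.2⟩
  have hsubm : coordBox (s₀ - δ) (s₀ + δ) (-η) 0 ⊆ coordBox (s₀ - δ) (s₀ + δ) (-η) η :=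
    fun q hq => ⟨hq.1, hq.2.1, by linarith [hq.2.2]⟩
  have hop := hopen _ (isOpen_coordBox (s₀ - δ) (s₀ + δ) 0 η) hsubp
  have hom := hopen _ (isOpen_coordBox (s₀ - δ) (s₀ + δ) (-η) 0) hsubm
  refine ⟨stripChart γ e '' coordBox (s₀ - δ) (s₀ + δ) (-η) η,
    hopen _ (isOpen_coordBox _ _ _ _) Subset.rfl,
    ⟨!₂[s₀, 0], ⟨⟨by simp [hδ], by simp [hδ]⟩, by simp [hη], by simp [hη]⟩,
      by simp [stripChart]⟩, ?_⟩
  intro f hfd hfs v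
  have hz : ∀ y, y ∉ stripChart γ e '' coordBox (s₀ - δ) (s₀ + δ) (-η) η → f y = 0 :=
    fun y hy => image_eq_zero_of_notMem_tsupport fun h1 => hy (hfs h1)
  have hz' : ∀ y, y ∉ stripChart γ e '' coordBox (s₀ - δ) (s₀ + δ) (-η) η → fderiv ℝ f y v = 0 := by
    intro y hy
    rw [fderiv_of_notMem_tsupport ℝ fun h1 => hy (hfs h1)]; rfl
  have hGc : Continuous fun y => fderiv ℝ f y v :=
    (hfd.continuous_fderiv one_ne_zero).clm_apply continuous_const
  have hdisj : ∀ s : Set R2, s ⊆ coordBox (s₀ - δ) (s₀ + δ) (-η) η → (∀ q ∈ s, q 1 ≠ 0) →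
      Disjoint (stripChart γ e '' s) (range γ) := by
    intro s hs hne
    rw [Set.disjoint_left]
    rintro _ ⟨q, hq, rfl⟩ ⟨x, hx⟩
    exact hne q hq (hchart x q (hs hq) hx).1
  have hdp := hdisj _ hsubp fun q hq => hq.2.1.ne'
  have hdm := hdisj _ hsubm fun q hq => hq.2.2.ne
  have hcut : ∫ y in Ω, fderiv ℝ f y v =
      ∫ y in (Ω ∩ stripChart γ e '' coordBox (s₀ - δ) (s₀ + δ) 0 η) ∪
        (Ω ∩ stripChart γ e '' coordBox (s₀ - δ) (s₀ + δ) (-η) 0), fderiv ℝ f y v := by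
    refine setIntegral_eq_of_subset_of_forall_sdiff_eq_zero hΩ.measurableSet ?_ ?_
    · exact union_subset inter_subset_left inter_subset_left
    · rintro y ⟨hyΩ, hyn⟩
      by_cases hy : y ∈ stripChart γ e '' coordBox (s₀ - δ) (s₀ + δ) (-η) η
      · obtain ⟨q, hq, rfl⟩ := hy
        rcases lt_trichotomy (q 1) 0 with h1 | h1 | h1
        · exact absurd (Or.inr ⟨hyΩ, q, ⟨hq.1, hq.2.1, h1⟩, rfl⟩) hyn
        · have : stripChart γ e q ∈ frontier Ω := by
            rw [hf]
            exact ⟨q 0, by simp [stripChart, h1]⟩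
          rw [hΩ.frontier_eq] at this
          exact absurd hyΩ this.2
        · exact absurd (Or.inl ⟨hyΩ, q, ⟨hq.1, h1, hq.2.2⟩, rfl⟩) hyn
      · exact hz' y hy
  have hint : ∀ S, IntegrableOn (fun y => fderiv ℝ f y v) (Ω ∩ S) := by
    intro S
    have : IntegrableOn (fun y => fderiv ℝ f y v) (closure Ω) :=
      hGc.continuousOn.integrableOn_compact hb.isCompact_closure
    exact this.mono_set (inter_subset_left.trans subset_closure)
  have hdd : Disjoint (Ω ∩ stripChart γ e '' coordBox (s₀ - δ) (s₀ + δ) 0 η)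
        (Ω ∩ stripChart γ e '' coordBox (s₀ - δ) (s₀ + δ) (-η) 0) := by
    rw [Set.disjoint_left]
    rintro _ ⟨_, q, hq, rfl⟩ ⟨_, q', hq', he'⟩
    have := (hinj (q' 0) (Ioo_subset_Icc_self hq'.1) (q 0) (Ioo_subset_Icc_self hq.1)
      (q' 1) (q 1) he').2
    have h1 := hq.2.1
    have h2 := hq'.2.2
    linarith
  rw [hcut, setIntegral_union hdd (hΩ.inter hom).measurableSet (hint _) (hint _),
    h.setIntegral_inter_side hf (c := 1) (by simp) s₀
      ((isPreconnected_coordBox _ _ _ _).image _ (h.continuous_stripChart e).continuousOn) hdp ?_,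
    h.setIntegral_inter_side hf (c := -1) (by simp) s₀
      ((isPreconnected_coordBox _ _ _ _).image _ (h.continuous_stripChart e).continuousOn) hdm ?_]
  rotate_left
  · filter_upwards [Ioo_mem_nhdsGT hη] with z hz1
    refine ⟨!₂[s₀, -z], ⟨⟨by simp [hδ], by simp [hδ]⟩, by simpa using hz1.2, by simpa using hz1.1⟩,
      by simp [stripChart, he]⟩
  · filter_upwards [Ioo_mem_nhdsGT hη] with z hz1
    refine ⟨!₂[s₀, z], ⟨⟨by simp [hδ], by simp [hδ]⟩, by simpa using hz1.1, by simpa using hz1.2⟩,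
      by simp [stripChart, he]⟩
  have hnot : ∀ s ∈ Icc (s₀ - δ) (s₀ + δ), ∀ z, (s ∉ Ioo (s₀ - δ) (s₀ + δ) ∨ z ∉ Ioo (-η) η) →
      f (γ s + z • e) = 0 := by
    intro s hs z hor
    refine hz _ ?_
    rintro ⟨q, hq, hqe⟩
    have := hinj (q 0) (Ioo_subset_Icc_self hq.1) s hs (q 1) z hqe
    rw [← this.1, ← this.2] at hor
    exact hor.elim (fun h1 => h1 hq.1) (fun h1 => h1 hq.2)
  have hl : s₀ - δ ∈ Icc (s₀ - δ) (s₀ + δ) := ⟨by linarith, by linarith⟩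
  have hr : s₀ + δ ∈ Icc (s₀ - δ) (s₀ + δ) := ⟨by linarith, by linarith⟩
  have hA := green_box h.contDiff (e := e) (a := s₀ - δ) (b := s₀ + δ) (c := 0) (d := η)
    (by linarith) hη.le hinj hdet hfd v
    (fun z _ => hnot _ hl z (Or.inl fun h1 => lt_irrefl _ h1.1))
    (fun z _ => hnot _ hr z (Or.inl fun h1 => lt_irrefl _ h1.2))
  have hB := green_box h.contDiff (e := e) (a := s₀ - δ) (b := s₀ + δ) (c := -η) (d := 0)
    (by linarith) (by linarith) hinj hdet hfd v
    (fun z _ => hnot _ hl z (Or.inl fun h1 => lt_irrefl _ h1.1))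
    (fun z _ => hnot _ hr z (Or.inl fun h1 => lt_irrefl _ h1.2))
  have hF : ∫ s in (s₀ - δ)..(s₀ + δ), cross v (deriv γ s) • f (γ s) =
      ∫ s in (0 : ℝ)..(2 * π), cross v (deriv γ s) • f (γ s) := by
    refine Function.Periodic.intervalIntegral_eq_of_forall_eq_zero
      (F := fun s => cross v (deriv γ s) • f (γ s)) ?_ ?_ hδ hδπ ?_
    · intro s
      simp only [h.periodic s, h.periodic_deriv s]
    · exact (continuous_const.cross h.continuous_deriv).smul
        (hfd.continuous.comp h.contDiff.continuous)
    · intro s hs1 hs2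
      have : f (γ s) = 0 := by
        refine hz _ ?_
        rintro ⟨q, hq, hqe⟩
        obtain ⟨h1, n, hn⟩ := hchart s q hq hqe.symm
        have h3 : γ (q 0) = γ s := by rw [← hqe]; simp [stripChart, h1]
        have h4 : |q 0 - s₀| < δ := by
          rw [abs_lt]; constructor <;> linarith [hq.1.1, hq.1.2]
        have h5 : q 0 = s := by
          refine h.eq_of_abs_lt h3 ?_
          calc |q 0 - s| = |(q 0 - s₀) - (s - s₀)| := by congr 1; ring
            _ ≤ |q 0 - s₀| + |s - s₀| := abs_sub _ _
            _ < 2 * π := by linarith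
        rw [h5] at h4
        linarith
      simp only [this, smul_zero]
  have hA' : ∫ s in (s₀ - δ)..(s₀ + δ), cross (deriv γ s) v • (f (γ s + η • e) - f (γ s + (0 : ℝ) • e))
      = ∫ s in (0 : ℝ)..(2 * π), cross v (deriv γ s) • f (γ s) := by
    rw [← hF]
    refine intervalIntegral.integral_congr fun s hs => ?_
    rw [uIcc_of_le (by linarith)] at hs
    rw [hnot s hs η (Or.inr fun h1 => lt_irrefl _ h1.2), zero_smul, add_zero, zero_sub, smul_neg,
      ← neg_smul]
    congr 1
    simp only [cross]; ring
  have hB' : ∫ s in (s₀ - δ)..(s₀ + δ), cross (deriv γ s) v • (f (γ s + (0 : ℝ) • e) - f (γ s + (-η) • e))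
      = -∫ s in (0 : ℝ)..(2 * π), cross v (deriv γ s) • f (γ s) := by
    rw [← hF, ← intervalIntegral.integral_neg]
    refine intervalIntegral.integral_congr fun s hs => ?_
    rw [uIcc_of_le (by linarith)] at hs
    rw [hnot s hs (-η) (Or.inr fun h1 => lt_irrefl _ h1.1), zero_smul, add_zero, sub_zero,
      ← neg_smul]
    congr 1
    simp only [cross]; ring
  rw [show stripChart γ e '' coordBox (s₀ - δ) (s₀ + δ) 0 η = stripChart γ e ''
    {q | q 0 ∈ Ioo (s₀ - δ) (s₀ + δ) ∧ q 1 ∈ Ioo 0 η} from rfl, hA, hA',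
    show stripChart γ e '' coordBox (s₀ - δ) (s₀ + δ) (-η) 0 = stripChart γ e ''
    {q | q 0 ∈ Ioo (s₀ - δ) (s₀ + δ) ∧ q 1 ∈ Ioo (-η) 0} from rfl, hB, hB', orient, sub_smul,
    smul_neg, sub_eq_add_neg]

end IsSimpleLoop

open scoped Manifold ContDiff in
/-- A finite smooth partition of unity subordinate to a local family of open sets. -/
lemma exists_finite_partition {K : Set R2} (hK : IsCompact K) {P : Set R2 → Prop}
    (hP : ∀ x ∈ K, ∃ V, IsOpen V ∧ x ∈ V ∧ P V) :
    ∃ (n : ℕ) (ρ : Fin n → R2 → ℝ), (∀ i, ContDiff ℝ 1 (ρ i)) ∧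
      (∀ i, ∃ V, P V ∧ tsupport (ρ i) ⊆ V) ∧ ∀ x ∈ K, ∑ i, ρ i x = 1 := by
  choose! V hVo hVx hVP using hP
  obtain ⟨t, htK, ht⟩ := hK.elim_nhds_subcover V fun x hx => (hVo x hx).mem_nhds (hVx x hx)
  let e := t.equivFin
  have hcov : K ⊆ ⋃ i : Fin t.card, V (e.symm i : R2) := by
    intro x hx
    obtain ⟨y, hy, hxy⟩ := mem_iUnion₂.1 (ht hx)
    exact mem_iUnion.2 ⟨e ⟨y, hy⟩, by simpa using hxy⟩
  obtain ⟨f, hf⟩ := SmoothPartitionOfUnity.exists_isSubordinate 𝓘(ℝ, R2) hK.isClosed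
    (fun i : Fin t.card => V (e.symm i : R2)) (fun i => hVo _ (htK _ (e.symm i).2)) hcov
  refine ⟨t.card, fun i => f i, fun i => ?_, fun i => ⟨_, hVP _ (htK _ (e.symm i).2), hf i⟩, ?_⟩
  · exact ((f i).contMDiff.contDiff).of_le (by exact_mod_cast le_top)
  · intro x hx
    rw [← finsum_eq_sum_of_fintype]
    exact f.sum_eq_one hx

/-- The signed area of the loop. -/
def signedArea (γ : ℝ → R2) : ℝ := ∫ s in (0 : ℝ)..(2 * π), γ s 0 * deriv γ s 1

namespace IsSimpleLoop

variable {γ : ℝ → R2} {Ω : Set R2} {E : Type*} [NormedAddCommGroup E] [NormedSpace ℝ E]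

lemma green_interior (hf : frontier Ω = range γ)
    (hΩ : IsOpen Ω) (hb : IsBounded Ω) {f : R2 → E} (hfd : ContDiff ℝ 1 f) (hfs : tsupport f ⊆ Ω)
    (v : R2) :
    ∫ y in Ω, fderiv ℝ f y v =
        orient Ω γ • ∫ s in (0 : ℝ)..(2 * π), cross v (deriv γ s) • f (γ s) := by
  have hz : ∀ s, f (γ s) = 0 := by
    intro s
    refine image_eq_zero_of_notMem_tsupport fun h1 => ?_
    have h2 : γ s ∈ frontier Ω := hf ▸ mem_range_self s
    rw [hΩ.frontier_eq] at h2
    exact h2.2 (hfs h1)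
  simp only [hz, smul_zero, intervalIntegral.integral_zero]
  have hc : HasCompactSupport f :=
    hb.isCompact_closure.of_isClosed_subset (isClosed_tsupport f) (hfs.trans subset_closure)
  rw [setIntegral_eq_integral_of_forall_compl_eq_zero]
  · have hc' : HasCompactSupport fun y => fderiv ℝ f y v := hc.fderiv_apply (𝕜 := ℝ) v
    have hGc : Continuous fun y => fderiv ℝ f y v :=
      (hfd.continuous_fderiv one_ne_zero).clm_apply continuous_const
    have := integral_smul_fderiv_eq_neg_fderiv_smul_of_integrable (𝕜 := ℝ) (μ := volume)
      (f := fun _ : R2 => (1 : ℝ)) (g := f) (v := v) (by simp)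
      (by simpa using hGc.integrable_of_hasCompactSupport hc')
      (by simpa using hfd.continuous.integrable_of_hasCompactSupport hc)
      (fun x _ => differentiableAt_const _)
      (fun x _ => hfd.differentiable one_ne_zero x)
    simpa using this
  · intro y hy
    rw [fderiv_of_notMem_tsupport ℝ fun h1 => hy (hfs h1)]; rfl

/-- Green's formula for a domain bounded by a regular simple loop. -/
lemma green [CompleteSpace E] (h : IsSimpleLoop γ) (hf : frontier Ω = range γ)
    (hΩ : IsOpen Ω) (hb : IsBounded Ω) {f : R2 → E} (hfd : ContDiff ℝ 1 f) (v : R2) :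
    ∫ y in Ω, fderiv ℝ f y v =
        orient Ω γ • ∫ s in (0 : ℝ)..(2 * π), cross v (deriv γ s) • f (γ s) := by
  obtain ⟨n, ρ, hρ, hρV, hsum⟩ := exists_finite_partition hb.isCompact_closure
    (P := fun V => ∀ f : R2 → E, ContDiff ℝ 1 f → tsupport f ⊆ V → ∀ v,
      ∫ y in Ω, fderiv ℝ f y v =
        orient Ω γ • ∫ s in (0 : ℝ)..(2 * π), cross v (deriv γ s) • f (γ s)) (by
      intro x hx
      by_cases hxΩ : x ∈ Ω
      · exact ⟨Ω, hΩ, hxΩ, fun f hfd hfs v => green_interior hf hΩ hb hfd hfs v⟩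
      · have : x ∈ frontier Ω := by rw [hΩ.frontier_eq]; exact ⟨hx, hxΩ⟩
        rw [hf] at this
        obtain ⟨s₀, rfl⟩ := this
        exact h.green_local hf hΩ hb s₀)
  have hd : ∀ i, ContDiff ℝ 1 (fun y => ρ i y • f y) := fun i => (hρ i).smul hfd
  have hi : ∀ i, ∫ y in Ω, fderiv ℝ (fun y => ρ i y • f y) y v =
      orient Ω γ • ∫ s in (0 : ℝ)..(2 * π), cross v (deriv γ s) • (ρ i (γ s) • f (γ s)) := by
    intro i
    obtain ⟨V, hV, hs⟩ := hρV i
    exact hV _ (hd i) ((tsupport_smul_subset_left (ρ i) f).trans hs) v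
  have hl : ∫ y in Ω, fderiv ℝ f y v =
      ∑ i, ∫ y in Ω, fderiv ℝ (fun y => ρ i y • f y) y v := by
    rw [← integral_finsetSum]
    · refine setIntegral_congr_fun hΩ.measurableSet fun y hy => ?_
      have h1 : f =ᶠ[𝓝 y] fun y => ∑ i, ρ i y • f y := by
        filter_upwards [hΩ.mem_nhds hy] with z hz
        rw [← Finset.sum_smul, hsum z (subset_closure hz), one_smul]
      rw [h1.fderiv_eq, fderiv_fun_sum fun i _ => (hd i).differentiable one_ne_zero y]
      simp
    · intro i _
      have hGc : Continuous fun y => fderiv ℝ (fun y => ρ i y • f y) y v :=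
        ((hd i).continuous_fderiv one_ne_zero).clm_apply continuous_const
      have : IntegrableOn (fun y => fderiv ℝ (fun y => ρ i y • f y) y v) (closure Ω) :=
        hGc.continuousOn.integrableOn_compact hb.isCompact_closure
      exact this.mono_set subset_closure
  rw [hl, Finset.sum_congr rfl fun i _ => hi i, ← Finset.smul_sum,
    ← intervalIntegral.integral_finsetSum]
  · congr 1
    refine intervalIntegral.integral_congr fun s _ => ?_
    have : γ s ∈ closure Ω := frontier_subset_closure (hf ▸ mem_range_self s)
    rw [← Finset.smul_sum, ← Finset.sum_smul, hsum _ this, one_smul]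
  · intro i _
    exact ((continuous_const.cross h.continuous_deriv).smul
        ((hd i).continuous.comp h.contDiff.continuous)).intervalIntegrable _ _

lemma orient_mul_signedArea (h : IsSimpleLoop γ) (hf : frontier Ω = range γ)
    (hΩ : IsOpen Ω) (hb : IsBounded Ω) : orient Ω γ * signedArea γ = volume.real Ω := by
  have := h.green hf hΩ hb (f := fun y : R2 => y 0)
    (EuclideanSpace.proj (0 : Fin 2) : R2 →L[ℝ] ℝ).contDiff !₂[1, 0]
  have h1 : ∀ y, fderiv ℝ (fun y : R2 => y 0) y = (EuclideanSpace.proj (0 : Fin 2) : R2 →L[ℝ] ℝ) :=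
    fun y => (EuclideanSpace.proj (0 : Fin 2) : R2 →L[ℝ] ℝ).fderiv
  simp only [h1] at this
  simp [cross] at this
  rw [this, signedArea]
  congr 1
  refine intervalIntegral.integral_congr fun s _ => ?_
  simp only [mul_comm]

lemma orient_mul_signedArea_pos (h : IsSimpleLoop γ) (hf : frontier Ω = range γ)
    (hΩ : IsOpen Ω) (hb : IsBounded Ω) (hne : Ω.Nonempty) : 0 < orient Ω γ * signedArea γ := by
  rw [h.orient_mul_signedArea hf hΩ hb]
  exact ENNReal.toReal_pos (hΩ.measure_pos volume hne).ne' hb.measure_lt_top.ne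

lemma orient_eq_one_or (h : IsSimpleLoop γ) (hf : frontier Ω = range γ)
    (hΩ : IsOpen Ω) (hb : IsBounded Ω) (hne : Ω.Nonempty) :
    (orient Ω γ = 1 ∧ 0 < signedArea γ) ∨ (orient Ω γ = -1 ∧ signedArea γ < 0) := by
  have h0 := h.orient_mul_signedArea_pos hf hΩ hb hne
  rcases (by unfold orient sideCoef; split_ifs <;> norm_num :
    orient Ω γ = 1 ∨ orient Ω γ = -1 ∨ orient Ω γ = 0) with h1 | h1 | h1
  · left; rw [h1] at h0; exact ⟨h1, by linarith⟩
  · right; rw [h1] at h0; exact ⟨h1, by linarith⟩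
  · rw [h1] at h0; simp at h0

end IsSimpleLoop

/-- `perp` as a continuous linear map. -/
def perpL : R2 →L[ℝ] R2 :=
  stripDeriv (!₂[0, 1]) (!₂[-1, 0])

lemma perpL_apply (v : R2) : perpL v = perp v := by
  ext i
  fin_cases i <;> simp [perpL, stripDeriv]

lemma norm_perp (v : R2) : ‖perp v‖ = ‖v‖ := by
  rw [EuclideanSpace.norm_eq, EuclideanSpace.norm_eq]
  simp [Fin.sum_univ_two, add_comm]

lemma abs_cross_le (a b : R2) : |cross a b| ≤ ‖a‖ * ‖b‖ := by
  have h : cross a b = ⟪perp a, b⟫ := by simp [cross, inner_R2]; ring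
  rw [h, ← norm_perp a]
  exact abs_real_inner_le_norm _ _

lemma abs_cross_le_sub (a b : R2) : |cross a b| ≤ ‖a‖ * ‖b - a‖ := by
  have h : cross a b = cross a (b - a) := by simp [cross]; ring
  rw [h]
  exact abs_cross_le _ _

/-- The regularized scalar kernel `(‖z‖² + ε²)^{-(1+α)}`. -/
def scalarKer (α ε : ℝ) (z : R2) : ℝ := (‖z‖ ^ 2 + ε ^ 2) ^ (-(1 + α))

/-- The regularized α-SQG kernel. -/
def sqgKer (α ε : ℝ) (z : R2) : R2 := scalarKer α ε z • perp z

lemma scalarKer_nonneg (α ε : ℝ) (z : R2) : 0 ≤ scalarKer α ε z :=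
  rpow_nonneg (by positivity) _

lemma scalarKer_neg (α ε : ℝ) (z : R2) : scalarKer α ε (-z) = scalarKer α ε z := by
  simp [scalarKer]

lemma contDiff_scalarKer (α : ℝ) {ε : ℝ} (hε : 0 < ε) : ContDiff ℝ 1 (scalarKer α ε) := by
  unfold scalarKer
  refine ContDiff.rpow_const_of_ne ((contDiff_norm_sq ℝ).add contDiff_const) fun z => ?_
  positivity

lemma contDiff_sqgKer (α : ℝ) {ε : ℝ} (hε : 0 < ε) : ContDiff ℝ 1 (sqgKer α ε) := by
  have : ContDiff ℝ 1 perp := by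
    rw [← funext perpL_apply]
    exact perpL.contDiff
  exact (contDiff_scalarKer α hε).smul this

lemma measurable_scalarKer (α ε : ℝ) : Measurable (scalarKer α ε) := by
  unfold scalarKer
  fun_prop

lemma measurable_sqgKer (α ε : ℝ) : Measurable (sqgKer α ε) :=
  (measurable_scalarKer α ε).smul continuous_perp.measurable

lemma scalarKer_le {α : ℝ} (hα : 0 < α) (ε : ℝ) {z : R2} {l : ℝ} (hl : 0 < l) (hz : l ≤ ‖z‖) :
    scalarKer α ε z ≤ l ^ (-(2 + 2 * α)) := by
  have h1 : l ^ 2 ≤ ‖z‖ ^ 2 + ε ^ 2 := by nlinarith [sq_nonneg ε]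
  have h2 : l ^ (-(2 + 2 * α)) = (l ^ 2) ^ (-(1 + α)) := by
    rw [← rpow_natCast, ← rpow_mul hl.le]
    congr 1; push_cast; ring
  rw [h2]
  exact rpow_le_rpow_of_nonpos (by positivity) h1 (by linarith)

lemma norm_sqgKer_le_norm {α : ℝ} (hα : 0 < α) (ε : ℝ) (z : R2) :
    ‖sqgKer α ε z‖ ≤ ‖z‖ ^ (-(1 + 2 * α)) := by
  rcases eq_or_ne z 0 with rfl | hz
  · have : sqgKer α ε 0 = 0 := by
      rw [sqgKer, ← perpL_apply, map_zero, smul_zero]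
    rw [this, norm_zero]
    exact rpow_nonneg le_rfl _
  · have hz' : 0 < ‖z‖ := norm_pos_iff.2 hz
    rw [sqgKer, norm_smul, norm_perp, Real.norm_of_nonneg (scalarKer_nonneg _ _ _)]
    calc scalarKer α ε z * ‖z‖ ≤ ‖z‖ ^ (-(2 + 2 * α)) * ‖z‖ := by
          gcongr; exact scalarKer_le hα ε hz' le_rfl
      _ = ‖z‖ ^ (-(1 + 2 * α)) := by
          rw [← rpow_add_one hz'.ne']; congr 1; ring

lemma norm_sqgKer_le {α : ℝ} (hα : 0 < α) (ε : ℝ) {z : R2} {l : ℝ} (hl : 0 < l) (hz : l ≤ ‖z‖) :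
    ‖sqgKer α ε z‖ ≤ l ^ (-(1 + 2 * α)) :=
  (norm_sqgKer_le_norm hα ε z).trans (rpow_le_rpow_of_nonpos hl hz (by linarith))

lemma tendsto_scalarKer (α : ℝ) {z : R2} (hz : z ≠ 0) :
    Tendsto (fun ε => scalarKer α ε z) (𝓝[>] 0) (𝓝 (scalarKer α 0 z)) := by
  have hc : ContinuousAt (fun ε : ℝ => scalarKer α ε z) 0 := by
    unfold scalarKer
    refine ContinuousAt.rpow_const (by fun_prop) (Or.inl ?_)
    have : 0 < ‖z‖ := norm_pos_iff.2 hz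
    positivity
  exact hc.tendsto.mono_left nhdsWithin_le_nhds

lemma tendsto_sqgKer (α : ℝ) (z : R2) :
    Tendsto (fun ε => sqgKer α ε z) (𝓝[>] 0) (𝓝 (sqgKer α 0 z)) := by
  rcases eq_or_ne z 0 with rfl | hz
  · have : ∀ ε, sqgKer α ε 0 = 0 := fun ε => by
      rw [sqgKer, ← perpL_apply, map_zero, smul_zero]
    simp only [this]
    exact tendsto_const_nhds
  · exact (tendsto_scalarKer α hz).smul_const _

lemma continuousAt_sqgKer (α ε : ℝ) {z : R2} (hz : z ≠ 0) : ContinuousAt (sqgKer α ε) z := by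
  have : 0 < ‖z‖ := norm_pos_iff.2 hz
  have h : ContinuousAt (scalarKer α ε) z := by
    unfold scalarKer
    refine ContinuousAt.rpow_const (by fun_prop) (Or.inl ?_)
    positivity
  exact h.smul continuous_perp.continuousAt

lemma sqgVelocity_eq (α : ℝ) (U : Set R2) (x : R2) :
    sqgVelocity α U x = ∫ y in U, sqgKer α 0 (x - y) := by
  unfold sqgVelocity sqgKer scalarKer
  congr 1
  ext1 y
  congr 1
  rw [← rpow_neg (norm_nonneg _)]
  simp only [ne_eq, OfNat.ofNat_ne_zero, not_false_eq_true, zero_pow, add_zero]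
  rw [← rpow_natCast, ← rpow_mul (norm_nonneg _)]
  congr 1; push_cast; ring

lemma integrableOn_norm_sub_rpow {α : ℝ} (hα : α < 1 / 2) {U : Set R2}
    (hb : IsBounded U) (x : R2) :
    IntegrableOn (fun y => ‖x - y‖ ^ (-(1 + 2 * α))) U := by
  obtain ⟨r, hr⟩ := hb.subset_ball x
  have h := integrableOn_ball_of_norm_le_rpow (E := R2) (F := ℝ) (μ := volume) (by simp)
    (f := fun y => ‖y‖ ^ (-(1 + 2 * α))) (C := 1) (α := 1 + 2 * α) (r := r)
    (by simp; linarith) (ae_of_all _ fun y => by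
      rw [one_mul, Real.norm_of_nonneg (rpow_nonneg (norm_nonneg _) _)])
    (measurable_norm.pow_const _).aestronglyMeasurable
  have hmp := measurePreserving_sub_right (volume : Measure R2) x
  have h2 := (hmp.integrableOn_comp_preimage
    (MeasurableEquiv.subRight x).measurableEmbedding).2 h
  refine (h2.mono_set ?_).congr_fun_ae ?_
  · intro y hy
    have := hr hy
    rw [Metric.mem_ball, dist_eq_norm] at this
    simpa using this
  · exact ae_of_all _ fun y => by simp [norm_sub_rev]

lemma tendsto_setIntegral_sqgKer {α : ℝ} (hα0 : 0 < α) (hα : α < 1 / 2) {U : Set R2}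
    (hb : IsBounded U) (x : R2) :
    Tendsto (fun ε => ∫ y in U, sqgKer α ε (x - y)) (𝓝[>] 0) (𝓝 (sqgVelocity α U x)) := by
  rw [sqgVelocity_eq]
  refine tendsto_integral_filter_of_dominated_convergence
    (fun y => ‖x - y‖ ^ (-(1 + 2 * α))) ?_ ?_ (integrableOn_norm_sub_rpow hα hb x) ?_
  · exact Eventually.of_forall fun ε =>
      ((measurable_sqgKer α ε).comp (measurable_const.sub measurable_id)).aestronglyMeasurable
  · exact Eventually.of_forall fun ε => ae_of_all _ fun y => norm_sqgKer_le_norm hα0 ε _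
  · exact ae_of_all _ fun y => tendsto_sqgKer α _

lemma intervalIntegrable_abs_rpow {r : ℝ} (hr : -1 < r) (a : ℝ) :
    IntervalIntegrable (fun w : ℝ => |w| ^ r) volume (-a) a := by
  have h := integrableOn_ball_of_norm_le_rpow (E := ℝ) (F := ℝ) (μ := volume) (by simp)
    (f := fun y : ℝ => |y| ^ r) (C := 1) (α := -r) (r := |a| + 1)
    (by simp; linarith) (ae_of_all _ fun y => by
      rw [one_mul, Real.norm_of_nonneg (rpow_nonneg (abs_nonneg _) _), neg_neg, Real.norm_eq_abs])
    (measurable_norm.pow_const _).aestronglyMeasurable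
  rw [intervalIntegrable_iff]
  refine h.mono_set fun y hy => ?_
  rw [mem_ball_zero_iff, Real.norm_eq_abs]
  rw [mem_uIoc] at hy
  have := le_abs_self a
  have := neg_abs_le a
  rcases hy with h1 | h1 <;> rw [abs_lt] <;> constructor <;> linarith

/-- Quantitative regularity of a `2π`-periodic curve `γ` with derivative `p`. -/
structure CurveBd (M c β : ℝ) (γ p : ℝ → R2) : Prop where
  hasDerivAt : ∀ x, HasDerivAt γ (p x) x
  periodic : Periodic γ (2 * π)
  periodic_deriv : Periodic p (2 * π)
  continuous_deriv : Continuous p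
  norm_le : ∀ x, ‖p x‖ ≤ M
  holder : ∀ x y, ‖p x - p y‖ ≤ M * |x - y| ^ β
  le_norm : ∀ x, c ≤ ‖p x‖
  arcChord : ∀ x w, |w| ≤ π → c * |w| ≤ ‖γ x - γ (x + w)‖

/-- The boundary-integral expression for the derivative along the curve of the velocity. -/
def bdryW (α ε : ℝ) (γ p : ℝ → R2) (x : ℝ) : R2 :=
  ∫ w in (-π)..π, cross (p x) (p (x + w)) • sqgKer α ε (γ x - γ (x + w))

lemma Function.Periodic.integral_comp_add {E : Type*} [NormedAddCommGroup E]
    [NormedSpace ℝ E] {F : ℝ → E} (hF : Periodic F (2 * π)) (x : ℝ) :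
    ∫ w in (-π)..π, F (x + w) = ∫ s in (0 : ℝ)..(2 * π), F s := by
  rw [intervalIntegral.integral_comp_add_left, show x + π = (x + -π) + 2 * π by ring,
    hF.intervalIntegral_add_eq (x + -π) 0, zero_add]

namespace CurveBd

variable {M c β α : ℝ} {γ p : ℝ → R2}

lemma continuous (h : CurveBd M c β γ p) : Continuous γ :=
  continuous_iff_continuousAt.2 fun x => (h.hasDerivAt x).continuousAt

lemma norm_cross_smul_le (h : CurveBd M c β γ p) (hα : 0 < α) (hc : 0 < c) (ε x : ℝ) {w : ℝ}
    (hw : |w| ≤ π) (hw0 : w ≠ 0) :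
    ‖cross (p x) (p (x + w)) • sqgKer α ε (γ x - γ (x + w))‖ ≤
      M * M * c ^ (-(1 + 2 * α)) * |w| ^ (β - 1 - 2 * α) := by
  have hwp : 0 < |w| := abs_pos.2 hw0
  have hM : 0 ≤ M := (norm_nonneg _).trans (h.norm_le x)
  rw [norm_smul, Real.norm_eq_abs]
  have h1 : |cross (p x) (p (x + w))| ≤ M * (M * |w| ^ β) := by
    refine (abs_cross_le_sub _ _).trans ?_
    have := h.holder (x + w) x
    rw [add_sub_cancel_left] at this
    exact mul_le_mul (h.norm_le x) this (norm_nonneg _) hM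
  have h2 := norm_sqgKer_le hα ε (mul_pos hc hwp) (h.arcChord x w hw)
  calc _ ≤ (M * (M * |w| ^ β)) * (c * |w|) ^ (-(1 + 2 * α)) := by gcongr
    _ = _ := by
      rw [mul_rpow hc.le hwp.le, show β - 1 - 2 * α = β + (-(1 + 2 * α)) by ring, rpow_add hwp]
      ring

lemma measurable_integrand (h : CurveBd M c β γ p) (ε x : ℝ) :
    Measurable fun w => cross (p x) (p (x + w)) • sqgKer α ε (γ x - γ (x + w)) := by
  have h1 : Continuous fun w => cross (p x) (p (x + w)) :=
    continuous_const.cross (h.continuous_deriv.comp (continuous_const.add continuous_id))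
  have h2 : Continuous fun w => γ x - γ (x + w) :=
    continuous_const.sub (h.continuous.comp (continuous_const.add continuous_id))
  exact h1.measurable.smul ((measurable_sqgKer α ε).comp h2.measurable)

lemma ae_norm_le (h : CurveBd M c β γ p) (hα : 0 < α) (hc : 0 < c) (ε x : ℝ) :
    ∀ᵐ w : ℝ, w ∈ uIoc (-π) π →
      ‖cross (p x) (p (x + w)) • sqgKer α ε (γ x - γ (x + w))‖ ≤
      M * M * c ^ (-(1 + 2 * α)) * |w| ^ (β - 1 - 2 * α) := by
  have h0 : ∀ᵐ w : ℝ, w ≠ 0 := by simp [ae_iff, measure_singleton]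
  filter_upwards [h0] with w hw0 hw
  rw [uIoc_of_le (by linarith [pi_pos])] at hw
  exact h.norm_cross_smul_le hα hc ε x (abs_le.2 ⟨hw.1.le, hw.2⟩) hw0

lemma intervalIntegrable_bound (hβ : 2 * α < β) (C : ℝ) :
    IntervalIntegrable (fun w : ℝ => C * |w| ^ (β - 1 - 2 * α)) volume (-π) π :=
  (intervalIntegrable_abs_rpow (by linarith) π).const_mul _

lemma norm_bdryW_le (h : CurveBd M c β γ p) (hα : 0 < α) (hβ : 2 * α < β) (hc : 0 < c) (ε x : ℝ) :
    ‖bdryW α ε γ p x‖ ≤ ∫ w in (-π)..π, M * M * c ^ (-(1 + 2 * α)) * |w| ^ (β - 1 - 2 * α) :=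
  intervalIntegral.norm_integral_le_of_norm_le (by linarith [pi_pos])
    (by simpa [uIoc_of_le (show -π ≤ π by linarith [pi_pos])] using h.ae_norm_le hα hc ε x)
    (intervalIntegrable_bound hβ _)

lemma tendsto_bdryW (h : CurveBd M c β γ p) (hα : 0 < α) (hβ : 2 * α < β) (hc : 0 < c) (x : ℝ) :
    Tendsto (fun ε => bdryW α ε γ p x) (𝓝[>] 0) (𝓝 (bdryW α 0 γ p x)) :=
  intervalIntegral.tendsto_integral_filter_of_dominated_convergence _
    (Eventually.of_forall fun ε => (h.measurable_integrand ε x).aestronglyMeasurable)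
    (Eventually.of_forall fun ε => h.ae_norm_le hα hc ε x) (intervalIntegrable_bound hβ _)
    (ae_of_all _ fun _ _ => (tendsto_sqgKer α _).const_smul _)

lemma continuous_bdryW {X : Type*} [TopologicalSpace X] [FirstCountableTopology X]
    {γ p : X → ℝ → R2} {y : X → ℝ} (hγ : Continuous (uncurry γ)) (hp : Continuous (uncurry p))
    (hy : Continuous y)
    (h : ∀ t, CurveBd M c β (γ t) (p t)) (hα : 0 < α) (hβ : 2 * α < β) (hc : 0 < c) :
    Continuous fun t => bdryW α 0 (γ t) (p t) (y t) := by
  refine intervalIntegral.continuous_of_dominated_interval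
    (bound := fun w => M * M * c ^ (-(1 + 2 * α)) * |w| ^ (β - 1 - 2 * α))
    (fun t => ((h t).measurable_integrand 0 (y t)).aestronglyMeasurable)
    (fun t => (h t).ae_norm_le hα hc 0 (y t)) (intervalIntegrable_bound hβ _) ?_
  have h0 : ∀ᵐ w : ℝ, w ≠ 0 := by simp [ae_iff, measure_singleton]
  filter_upwards [h0] with w hw0 hw
  rw [uIoc_of_le (by linarith [pi_pos])] at hw
  have e1 : Continuous fun t => p t (y t) := hp.comp (continuous_id.prodMk hy)
  have e2 : Continuous fun t => p t (y t + w) :=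
    hp.comp (continuous_id.prodMk (hy.add continuous_const))
  have e3 : Continuous fun t => γ t (y t) - γ t (y t + w) :=
    (hγ.comp (continuous_id.prodMk hy)).sub
      (hγ.comp (continuous_id.prodMk (hy.add continuous_const)))
  refine (e1.cross e2).smul (continuous_iff_continuousAt.2 fun t => ?_)
  have hne : γ t (y t) - γ t (y t + w) ≠ 0 := by
    have h1 := (h t).arcChord (y t) w (abs_le.2 ⟨hw.1.le, hw.2⟩)
    have h2 := mul_pos hc (abs_pos.2 hw0)
    exact norm_pos_iff.1 (by linarith)
  exact ContinuousAt.comp (f := fun t => γ t (y t) - γ t (y t + w)) (continuousAt_sqgKer α 0 hne)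
    e3.continuousAt

lemma continuous_bdryW_reg (h : CurveBd M c β γ p) {ε : ℝ} (hε : 0 < ε) :
    Continuous fun x => bdryW α ε γ p x := by
  refine intervalIntegral.continuous_parametric_intervalIntegral_of_continuous' ?_ _ _
  have e1 : Continuous fun q : ℝ × ℝ => p q.1 := h.continuous_deriv.comp continuous_fst
  have e2 : Continuous fun q : ℝ × ℝ => p (q.1 + q.2) :=
    h.continuous_deriv.comp (continuous_fst.add continuous_snd)
  have e3 : Continuous fun q : ℝ × ℝ => γ q.1 - γ (q.1 + q.2) :=
    (h.continuous.comp continuous_fst).sub (h.continuous.comp (continuous_fst.add continuous_snd))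
  exact (e1.cross e2).smul ((contDiff_sqgKer α hε).continuous.comp e3)

end CurveBd

namespace IsSimpleLoop

variable {γ : ℝ → R2} {Ω : Set R2} {α ε M c β : ℝ}

lemma hasDerivAt_regVelocity (h : IsSimpleLoop γ) (hf : frontier Ω = range γ)
    (hΩ : IsOpen Ω) (hb : IsBounded Ω) (hε : 0 < ε) (x : ℝ) :
    HasDerivAt (fun x => ∫ y in Ω, sqgKer α ε (γ x - y))
      (-orient Ω γ • bdryW α ε γ (deriv γ) x) x := by
  have hK := contDiff_sqgKer α hε
  have hK' : Continuous (fderiv ℝ (sqgKer α ε)) := hK.continuous_fderiv one_ne_zero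
  have hF' : Continuous fun q : ℝ × R2 => fderiv ℝ (sqgKer α ε) (γ q.1 - q.2) (deriv γ q.1) :=
    (hK'.comp ((h.contDiff.continuous.comp continuous_fst).sub continuous_snd)).clm_apply
      (h.continuous_deriv.comp continuous_fst)
  have hcomp : IsCompact (Metric.closedBall x 1 ×ˢ closure Ω) :=
    (isCompact_closedBall x 1).prod hb.isCompact_closure
  obtain ⟨B, hB⟩ := hcomp.exists_bound_of_continuousOn hF'.continuousOn
  have hfin : IsFiniteMeasure (volume.restrict Ω) := ⟨by
    rw [Measure.restrict_apply_univ]; exact hb.measure_lt_top⟩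
  have hFc : ∀ x, Continuous fun y => sqgKer α ε (γ x - y) := fun x =>
    hK.continuous.comp (continuous_const.sub continuous_id)
  have key := (hasDerivAt_integral_of_dominated_loc_of_deriv_le (μ := volume.restrict Ω)
    (F := fun x y => sqgKer α ε (γ x - y))
    (F' := fun x y => fderiv ℝ (sqgKer α ε) (γ x - y) (deriv γ x)) (x₀ := x)
    (bound := fun _ => B)
    (Metric.closedBall_mem_nhds x one_pos)
    (Eventually.of_forall fun x => (hFc x).aestronglyMeasurable)
    (((hFc x).continuousOn.integrableOn_compact hb.isCompact_closure).mono_set subset_closure)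
    (hF'.comp (continuous_const.prodMk continuous_id)).aestronglyMeasurable
    ((ae_restrict_iff' hΩ.measurableSet).2 (ae_of_all _ fun y hy x' hx' =>
      hB (x', y) ⟨hx', subset_closure hy⟩))
    (integrable_const _)
    (ae_of_all _ fun y x' _ => by
      have h1 : HasDerivAt (fun x => γ x - y) (deriv γ x') x' := (h.hasDerivAt x').sub_const y
      exact ((hK.differentiable one_ne_zero _).hasFDerivAt.comp_hasDerivAt x' h1))).2
  refine key.congr_deriv ?_
  have hf1 : ContDiff ℝ 1 (fun y => -sqgKer α ε (γ x - y)) :=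
    (hK.comp (contDiff_const.sub contDiff_id)).neg
  have hfd : ∀ y v, fderiv ℝ (fun y => -sqgKer α ε (γ x - y)) y v =
      fderiv ℝ (sqgKer α ε) (γ x - y) v := by
    intro y v
    have h1 : HasFDerivAt (fun y : R2 => γ x - y) (-ContinuousLinearMap.id ℝ R2) y :=
      (hasFDerivAt_id y).const_sub (γ x)
    have h2 := ((hK.differentiable one_ne_zero (γ x - y)).hasFDerivAt.comp y h1).neg
    have h3 : fderiv ℝ (fun y => -sqgKer α ε (γ x - y)) y = _ := h2.fderiv
    rw [h3]
    simp
  have hg := h.green hf hΩ hb hf1 (deriv γ x)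
  simp only [hfd] at hg
  rw [hg, neg_smul, ← smul_neg]
  congr 1
  rw [bdryW, Function.Periodic.integral_comp_add
    (F := fun s => cross (deriv γ x) (deriv γ s) • sqgKer α ε (γ x - γ s))
    (fun s => by simp only [h.periodic s, h.periodic_deriv s]), ← intervalIntegral.integral_neg]
  simp only [smul_neg]

lemma velocity_sub (h : IsSimpleLoop γ) (hf : frontier Ω = range γ)
    (hΩ : IsOpen Ω) (hb : IsBounded Ω) (hα0 : 0 < α) (hα : α < 1 / 2) (hβ : 2 * α < β)
    (hc : 0 < c) (hC : CurveBd M c β γ (deriv γ)) (a b : ℝ) :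
    sqgVelocity α Ω (γ b) - sqgVelocity α Ω (γ a) =
      ∫ x in a..b, -orient Ω γ • bdryW α 0 γ (deriv γ) x := by
  have h0 : ∀ ε > 0, Continuous fun x => -orient Ω γ • bdryW α ε γ (deriv γ) x := fun ε hε =>
    (continuous_const (y := -orient Ω γ)).smul (hC.continuous_bdryW_reg hε)
  have h1 : ∀ ε > 0, ∫ x in a..b, -orient Ω γ • bdryW α ε γ (deriv γ) x =
      (∫ y in Ω, sqgKer α ε (γ b - y)) - ∫ y in Ω, sqgKer α ε (γ a - y) := fun ε hε =>
    intervalIntegral.integral_eq_sub_of_hasDerivAt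
      (fun x _ => h.hasDerivAt_regVelocity hf hΩ hb hε x)
      ((h0 ε hε).intervalIntegrable _ _)
  have h2 := (tendsto_setIntegral_sqgKer hα0 hα hb (γ b)).sub
    (tendsto_setIntegral_sqgKer hα0 hα hb (γ a))
  have h3 : Tendsto (fun ε => ∫ x in a..b, -orient Ω γ • bdryW α ε γ (deriv γ) x) (𝓝[>] 0)
      (𝓝 (∫ x in a..b, -orient Ω γ • bdryW α 0 γ (deriv γ) x)) := by
    refine intervalIntegral.tendsto_integral_filter_of_dominated_convergence
      (fun _ => |orient Ω γ| *
        ∫ w in (-π)..π, M * M * c ^ (-(1 + 2 * α)) * |w| ^ (β - 1 - 2 * α)) ?_ ?_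
      intervalIntegrable_const ?_
    · filter_upwards [self_mem_nhdsWithin] with ε hε
      exact (h0 ε hε).aestronglyMeasurable
    · refine Eventually.of_forall fun ε => ae_of_all _ fun x _ => ?_
      rw [norm_smul, norm_neg, Real.norm_eq_abs]
      exact mul_le_mul_of_nonneg_left (hC.norm_bdryW_le hα0 hβ hc ε x) (abs_nonneg _)
    · exact ae_of_all _ fun x _ => (hC.tendsto_bdryW hα0 hβ hc x).const_smul _
  refine tendsto_nhds_unique h2 (h3.congr' ?_)
  filter_upwards [self_mem_nhdsWithin] with ε hε
  exact h1 ε hε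

end IsSimpleLoop

lemma proj_eq_of_unit {S U : R2} (hS : ‖S‖ = 1) (hU : ‖U‖ = 1) :
    U - ⟪U, S⟫ • S = (U - S) + (‖U - S‖ ^ 2 / 2) • S := by
  have h : ‖U - S‖ ^ 2 = 2 - 2 * ⟪U, S⟫ := by
    rw [norm_sub_sq_real, hS, hU]; ring
  rw [h, show (2 - 2 * ⟪U, S⟫) / 2 = 1 - ⟪U, S⟫ by ring, sub_smul, one_smul]
  abel

lemma weight_diff_le {Δ₁ Δ₂ S₁ S₂ : R2} {q₁ q₂ g₁ g₂ k M N : ℝ}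
    (hS₁ : ‖S₁‖ = 1) (hS₂ : ‖S₂‖ = 1) (hq₁ : 0 ≤ q₁) (hq₂ : 0 ≤ q₂)
    (hg₁ : 0 ≤ g₁) (hgM₁ : g₁ ≤ M) (h2 : q₂ * ‖Δ₂‖ ≤ k)
    (h3 : q₁ * ‖Δ₁ - Δ₂‖ ≤ k * N) (h4 : q₁ * ‖Δ₂‖ ≤ k) (h5 : |q₁ - q₂| * ‖Δ₂‖ ≤ k * N) :
    |q₁ * ⟪Δ₁, S₁⟫ * g₁ - q₂ * ⟪Δ₂, S₂⟫ * g₂| ≤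
      k * (2 * M * N + M * ‖S₁ - S₂‖ + |g₁ - g₂|) := by
  have e : q₁ * ⟪Δ₁, S₁⟫ * g₁ - q₂ * ⟪Δ₂, S₂⟫ * g₂ =
      g₁ * (q₁ * ⟪Δ₁ - Δ₂, S₁⟫) + g₁ * (q₁ * ⟪Δ₂, S₁ - S₂⟫) + g₁ * ((q₁ - q₂) * ⟪Δ₂, S₂⟫) +
        (g₁ - g₂) * (q₂ * ⟪Δ₂, S₂⟫) := by
    rw [inner_sub_left, inner_sub_right]; ring
  have a1 : |q₁ * ⟪Δ₁ - Δ₂, S₁⟫| ≤ k * N := by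
    rw [abs_mul, abs_of_nonneg hq₁]
    refine le_trans ?_ h3
    have := abs_real_inner_le_norm (Δ₁ - Δ₂) S₁
    rw [hS₁, mul_one] at this
    gcongr
  have a2 : |q₁ * ⟪Δ₂, S₁ - S₂⟫| ≤ k * ‖S₁ - S₂‖ := by
    rw [abs_mul, abs_of_nonneg hq₁]
    have := abs_real_inner_le_norm Δ₂ (S₁ - S₂)
    calc q₁ * |⟪Δ₂, S₁ - S₂⟫| ≤ q₁ * (‖Δ₂‖ * ‖S₁ - S₂‖) := by gcongr
      _ = (q₁ * ‖Δ₂‖) * ‖S₁ - S₂‖ := by ring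
      _ ≤ _ := by gcongr
  have a3 : |(q₁ - q₂) * ⟪Δ₂, S₂⟫| ≤ k * N := by
    rw [abs_mul]
    refine le_trans ?_ h5
    have := abs_real_inner_le_norm Δ₂ S₂
    rw [hS₂, mul_one] at this
    gcongr
  have a4 : |q₂ * ⟪Δ₂, S₂⟫| ≤ k := by
    rw [abs_mul, abs_of_nonneg hq₂]
    refine le_trans ?_ h2
    have := abs_real_inner_le_norm Δ₂ S₂
    rw [hS₂, mul_one] at this
    gcongr
  have hM : 0 ≤ M := hg₁.trans hgM₁
  rw [e]
  calc _ ≤ |g₁ * (q₁ * ⟪Δ₁ - Δ₂, S₁⟫)| + |g₁ * (q₁ * ⟪Δ₂, S₁ - S₂⟫)| +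
          |g₁ * ((q₁ - q₂) * ⟪Δ₂, S₂⟫)| + |(g₁ - g₂) * (q₂ * ⟪Δ₂, S₂⟫)| := by
        refine (abs_add_le _ _).trans ?_
        gcongr
        exact abs_add_three _ _ _
    _ ≤ M * (k * N) + M * (k * ‖S₁ - S₂‖) + M * (k * N) + |g₁ - g₂| * k := by
        simp only [abs_mul g₁, abs_mul (g₁ - g₂), abs_of_nonneg hg₁]
        gcongr
    _ = _ := by ring

lemma remainder_le {Δ₁ Δ₂ S₁ S₂ U₁ U₂ : R2} {q₁ q₂ g₁ g₂ k s M N : ℝ}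
    (hS₁ : ‖S₁‖ = 1) (hS₂ : ‖S₂‖ = 1) (hU₁ : ‖U₁‖ = 1) (hU₂ : ‖U₂‖ = 1)
    (hq₁ : 0 ≤ q₁) (hq₂ : 0 ≤ q₂)
    (hg₁ : 0 ≤ g₁) (hgM₁ : g₁ ≤ M) (hg₂ : 0 ≤ g₂) (hgM₂ : g₂ ≤ M)
    (h1 : q₁ * ‖Δ₁‖ ≤ k) (h2 : q₂ * ‖Δ₂‖ ≤ k)
    (h3 : q₁ * ‖Δ₁ - Δ₂‖ ≤ k * N) (h4 : q₁ * ‖Δ₂‖ ≤ k) (h5 : |q₁ - q₂| * ‖Δ₂‖ ≤ k * N)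
    (d1 : ‖U₁ - S₁‖ ≤ s) (d2 : ‖U₂ - S₂‖ ≤ s) :
    |⟪S₁ - S₂, (q₁ * ⟪Δ₁, S₁⟫ * g₁) • (U₁ - ⟪U₁, S₁⟫ • S₁) -
        (q₂ * ⟪Δ₂, S₂⟫ * g₂) • (U₂ - ⟪U₂, S₂⟫ • S₂)⟫ -
        (q₁ * ⟪Δ₁, U₁⟫ * g₁) * ⟪S₁ - S₂, U₁ - U₂⟫ + (q₁ * ⟪Δ₁, U₁⟫ * g₁) * ‖S₁ - S₂‖ ^ 2| ≤
      k * s * (‖S₁ - S₂‖ *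
        (5 * M * ‖S₁ - S₂‖ + 2 * M * ‖U₁ - U₂‖ + 4 * M * N + 2 * |g₁ - g₂|)) := by
  have hw := weight_diff_le (g₂ := g₂) hS₁ hS₂ hq₁ hq₂ hg₁ hgM₁ h2 h3 h4 h5
  have hk : 0 ≤ k := (mul_nonneg hq₁ (norm_nonneg _)).trans h1
  have hM : 0 ≤ M := hg₁.trans hgM₁
  have hs : 0 ≤ s := (norm_nonneg _).trans d1
  rw [proj_eq_of_unit hS₁ hU₁, proj_eq_of_unit hS₂ hU₂]
  set w₁ := q₁ * ⟪Δ₁, S₁⟫ * g₁ with hw₁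
  set w₂ := q₂ * ⟪Δ₂, S₂⟫ * g₂ with hw₂
  set m := q₁ * ⟪Δ₁, U₁⟫ * g₁ with hm
  set a := ‖S₁ - S₂‖ with ha
  set b := ‖U₁ - U₂‖ with hb
  have ha0 : 0 ≤ a := norm_nonneg _
  have hb0 : 0 ≤ b := norm_nonneg _
  set Λ := 2 * M * N + M * a + |g₁ - g₂| with hΛ
  have e : ⟪S₁ - S₂, w₁ • (U₁ - S₁ + (‖U₁ - S₁‖ ^ 2 / 2) • S₁) -
        w₂ • (U₂ - S₂ + (‖U₂ - S₂‖ ^ 2 / 2) • S₂)⟫ -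
        m * ⟪S₁ - S₂, U₁ - U₂⟫ + m * a ^ 2 =
      ⟪S₁ - S₂, (w₁ - m) • ((U₁ - U₂) - (S₁ - S₂)) + (w₁ - w₂) • (U₂ - S₂) +
        (1 / 2 : ℝ) • (((w₁ - w₂) * ‖U₁ - S₁‖ ^ 2) • S₁ +
          (w₂ * (‖U₁ - S₁‖ ^ 2 - ‖U₂ - S₂‖ ^ 2)) • S₁ +
          (w₂ * ‖U₂ - S₂‖ ^ 2) • (S₁ - S₂))⟫ := by
    rw [ha, ← real_inner_self_eq_norm_sq (S₁ - S₂), ← inner_smul_right, ← inner_smul_right,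
      ← inner_sub_right, ← inner_add_right]
    congr 1
    module
  have b1 : |w₁ - m| ≤ k * M * s := by
    have : w₁ - m = (q₁ * ⟪Δ₁, S₁ - U₁⟫) * g₁ := by
      rw [hw₁, hm, inner_sub_right]; ring
    rw [this, abs_mul, abs_mul, abs_of_nonneg hq₁, abs_of_nonneg hg₁]
    have h6 := abs_real_inner_le_norm Δ₁ (S₁ - U₁)
    rw [norm_sub_rev S₁] at h6
    calc q₁ * |⟪Δ₁, S₁ - U₁⟫| * g₁ ≤ q₁ * (‖Δ₁‖ * ‖U₁ - S₁‖) * g₁ := by gcongr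
      _ = (q₁ * ‖Δ₁‖) * ‖U₁ - S₁‖ * g₁ := by ring
      _ ≤ k * s * M := by gcongr
      _ = _ := by ring
  have b2 : |w₂| ≤ k * M := by
    rw [hw₂, abs_mul, abs_mul, abs_of_nonneg hq₂, abs_of_nonneg hg₂]
    have h6 := abs_real_inner_le_norm Δ₂ S₂
    rw [hS₂, mul_one] at h6
    calc q₂ * |⟪Δ₂, S₂⟫| * g₂ ≤ (q₂ * ‖Δ₂‖) * g₂ := by gcongr
      _ ≤ _ := by gcongr
  have t1 : ‖U₁ - S₁‖ ≤ 2 := (norm_sub_le _ _).trans (by rw [hU₁, hS₁]; norm_num)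
  have t2 : ‖U₂ - S₂‖ ≤ 2 := (norm_sub_le _ _).trans (by rw [hU₂, hS₂]; norm_num)
  have n1 := norm_nonneg (U₁ - S₁)
  have n2 := norm_nonneg (U₂ - S₂)
  have s1 : ‖U₁ - S₁‖ ^ 2 ≤ 2 * s := by nlinarith
  have s2 : ‖U₂ - S₂‖ ^ 2 ≤ 2 * s := by nlinarith
  have s3 : |‖U₁ - S₁‖ ^ 2 - ‖U₂ - S₂‖ ^ 2| ≤ 2 * s * (a + b) := by
    have h6 := abs_norm_sub_norm_le (U₁ - S₁) (U₂ - S₂)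
    have h7 : ‖(U₁ - S₁) - (U₂ - S₂)‖ ≤ a + b := by
      rw [show (U₁ - S₁) - (U₂ - S₂) = (U₁ - U₂) - (S₁ - S₂) by abel]
      exact (norm_sub_le _ _).trans (by rw [← ha, ← hb, add_comm])
    rw [show ‖U₁ - S₁‖ ^ 2 - ‖U₂ - S₂‖ ^ 2 =
      (‖U₁ - S₁‖ + ‖U₂ - S₂‖) * (‖U₁ - S₁‖ - ‖U₂ - S₂‖) by ring, abs_mul,
      abs_of_nonneg (by positivity)]
    calc _ ≤ (s + s) * (a + b) := by gcongr; exact h6.trans h7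
      _ = _ := by ring
  have c1 : ‖(w₁ - m) • ((U₁ - U₂) - (S₁ - S₂))‖ ≤ k * M * s * (a + b) := by
    rw [norm_smul, Real.norm_eq_abs]
    gcongr
    exact (norm_sub_le _ _).trans (by rw [← ha, ← hb, add_comm])
  have c2 : ‖(w₁ - w₂) • (U₂ - S₂)‖ ≤ k * Λ * s := by
    rw [norm_smul, Real.norm_eq_abs]
    exact mul_le_mul hw d2 n2 ((abs_nonneg _).trans hw)
  have c3 : ‖((w₁ - w₂) * ‖U₁ - S₁‖ ^ 2) • S₁‖ ≤ k * Λ * (2 * s) := by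
    rw [norm_smul, hS₁, mul_one, Real.norm_eq_abs, abs_mul, abs_of_nonneg (sq_nonneg ‖U₁ - S₁‖)]
    exact mul_le_mul hw s1 (sq_nonneg _) ((abs_nonneg _).trans hw)
  have c4 : ‖(w₂ * (‖U₁ - S₁‖ ^ 2 - ‖U₂ - S₂‖ ^ 2)) • S₁‖ ≤ k * M * (2 * s * (a + b)) := by
    rw [norm_smul, hS₁, mul_one, Real.norm_eq_abs, abs_mul]
    gcongr
  have c5 : ‖(w₂ * ‖U₂ - S₂‖ ^ 2) • (S₁ - S₂)‖ ≤ k * M * (2 * s) * a := by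
    rw [norm_smul, Real.norm_eq_abs, abs_mul, abs_of_nonneg (sq_nonneg ‖U₂ - S₂‖)]
    gcongr
  rw [e]
  refine (abs_real_inner_le_norm _ _).trans ?_
  rw [← ha]
  calc _ ≤ a * (k * M * s * (a + b) + k * Λ * s + 1 / 2 * (k * Λ * (2 * s) +
          k * M * (2 * s * (a + b)) + k * M * (2 * s) * a)) := by
        gcongr
        refine (norm_add_le _ _).trans ?_
        gcongr
        · refine (norm_add_le _ _).trans ?_
          gcongr
        · rw [norm_smul]
          have : ‖(1 / 2 : ℝ)‖ = 1 / 2 := by norm_num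
          rw [this]
          gcongr
          refine (norm_add_le _ _).trans ?_
          gcongr
          refine (norm_add_le _ _).trans ?_
          gcongr
    _ = _ := by rw [hΛ]; ring

/-- The unit vector in the direction of `p x`. -/
def unitT (p : ℝ → R2) (x : ℝ) : R2 := ‖p x‖⁻¹ • p x

lemma norm_normalize_sub_le {a b : R2} {c : ℝ} (hc : 0 < c) (ha : c ≤ ‖a‖) (hb : c ≤ ‖b‖) :
    ‖‖a‖⁻¹ • a - ‖b‖⁻¹ • b‖ ≤ 2 / c * ‖a - b‖ := by
  have ha' : 0 < ‖a‖ := hc.trans_le ha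
  have hb' : 0 < ‖b‖ := hc.trans_le hb
  have e : ‖a‖⁻¹ • a - ‖b‖⁻¹ • b = ‖a‖⁻¹ • ((a - b) + ((‖b‖ - ‖a‖) * ‖b‖⁻¹) • b) := by
    rw [smul_add, smul_sub, smul_smul]
    have : ‖a‖⁻¹ * ((‖b‖ - ‖a‖) * ‖b‖⁻¹) = ‖a‖⁻¹ - ‖b‖⁻¹ := by field_simp
    rw [this, sub_smul]
    abel
  have h2 : ‖((‖b‖ - ‖a‖) * ‖b‖⁻¹) • b‖ ≤ ‖a - b‖ := by
    rw [norm_smul, norm_mul, norm_inv, norm_norm, mul_assoc, inv_mul_cancel₀ hb'.ne', mul_one,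
      norm_sub_rev a b]
    exact abs_norm_sub_norm_le b a
  rw [e, norm_smul, norm_inv, norm_norm]
  calc ‖a‖⁻¹ * ‖a - b + ((‖b‖ - ‖a‖) * ‖b‖⁻¹) • b‖ ≤ c⁻¹ * (‖a - b‖ + ‖a - b‖) := by
        gcongr
        exact (norm_add_le _ _).trans (by gcongr)
    _ = _ := by ring

lemma abs_scalarKer_sub_le {α : ℝ} (hα0 : 0 < α) (hα : α < 1 / 2) {ε : ℝ} (hε : 0 < ε)
    {z₁ z₂ : R2} {l : ℝ} (hl : 0 < l) (h1 : l ≤ ‖z₁‖) (h2 : l ≤ ‖z₂‖) :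
    |scalarKer α ε z₁ - scalarKer α ε z₂| ≤ 3 * l ^ (-(3 + 2 * α)) * ‖z₁ - z₂‖ := by
  have hd : ∀ r ∈ Ici l, HasDerivWithinAt (fun r : ℝ => (r ^ 2 + ε ^ 2) ^ (-(1 + α)))
      ((2 * r) * (-(1 + α)) * (r ^ 2 + ε ^ 2) ^ (-(1 + α) - 1)) (Ici l) r := by
    intro r _
    have h3 : HasDerivAt (fun r : ℝ => r ^ 2 + ε ^ 2) (2 * r) r := by
      simpa using (hasDerivAt_pow 2 r).add_const (ε ^ 2)
    exact (h3.rpow_const (Or.inl (by positivity))).hasDerivWithinAt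
  have hb : ∀ r ∈ Ici l, ‖(2 * r) * (-(1 + α)) * (r ^ 2 + ε ^ 2) ^ (-(1 + α) - 1)‖ ≤
      3 * l ^ (-(3 + 2 * α)) := by
    intro r hr
    have hr0 : 0 < r := hl.trans_le hr
    rw [norm_mul, norm_mul, Real.norm_of_nonneg (by positivity : 0 ≤ 2 * r), norm_neg,
      Real.norm_of_nonneg (by positivity : 0 ≤ 1 + α),
      Real.norm_of_nonneg (rpow_nonneg (by positivity) _)]
    have h4 : (r ^ 2 + ε ^ 2) ^ (-(1 + α) - 1) ≤ r ^ (-(4 + 2 * α)) := by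
      have h2 : r ^ (-(4 + 2 * α)) = (r ^ 2) ^ (-(1 + α) - 1) := by
        rw [← rpow_natCast, ← rpow_mul hr0.le]
        congr 1; push_cast; ring
      rw [h2]
      exact rpow_le_rpow_of_nonpos (by positivity) (by nlinarith) (by linarith)
    calc 2 * r * (1 + α) * (r ^ 2 + ε ^ 2) ^ (-(1 + α) - 1) ≤
          2 * r * (1 + 1 / 2) * r ^ (-(4 + 2 * α)) := by gcongr
      _ = 3 * (r ^ (-(4 + 2 * α)) * r) := by ring
      _ = 3 * r ^ (-(3 + 2 * α)) := by
          rw [← rpow_add_one hr0.ne']; congr 2; ring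
      _ ≤ 3 * l ^ (-(3 + 2 * α)) := by
          gcongr 3 * ?_
          exact rpow_le_rpow_of_nonpos hl hr (by linarith)
  have h := (convex_Ici l).norm_image_sub_le_of_norm_hasDerivWithin_le hd hb h2 h1
  refine h.trans ?_
  gcongr
  exact abs_norm_sub_norm_le z₁ z₂

lemma abs_double_integral_le {Q : ℝ → ℝ → ℝ} (hQ : Continuous (uncurry Q)) {e : ℝ → ℝ}
    (he : Continuous e) (hper : Periodic e (2 * π)) {r C : ℝ} (hr : -1 < r)
    (hb : ∀ x w, |w| ≤ π → w ≠ 0 →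
      |Q x w| ≤ C * |w| ^ r * (e x + e (x + w) + ∫ θ in (0 : ℝ)..1, e (x + θ * w))) :
    |∫ x in (0 : ℝ)..(2 * π), ∫ w in (-π)..π, Q x w| ≤
      3 * C * (∫ w in (-π)..π, |w| ^ r) * ∫ x in (0 : ℝ)..(2 * π), e x := by
  have hpi := pi_pos
  have hshift : ∀ a, ∫ x in (0 : ℝ)..(2 * π), e (x + a) = ∫ x in (0 : ℝ)..(2 * π), e x := by
    intro a
    rw [intervalIntegral.integral_comp_add_right, show (2 * π) + a = (0 + a) + 2 * π by ring,
      hper.intervalIntegral_add_eq (0 + a) 0, zero_add]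
  have hswap := intervalIntegral_intervalIntegral_swap (a := 0) (b := 2 * π) (c := -π) (d := π)
    (F := Q) ?_
  rotate_left
  · exact (hQ.continuousOn.integrableOn_compact (isCompact_uIcc.prod isCompact_uIcc)).mono_set
      (prod_mono uIoc_subset_uIcc uIoc_subset_uIcc)
  rw [hswap]
  have h0 : ∀ᵐ w : ℝ, w ≠ 0 := by simp [ae_iff, measure_singleton]
  have hint : IntervalIntegrable (fun w : ℝ => 3 * C * |w| ^ r * ∫ x in (0 : ℝ)..(2 * π), e x)
      volume (-π) π := ((intervalIntegrable_abs_rpow hr π).const_mul (3 * C)).mul_const _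
  have key : ∀ᵐ w : ℝ, w ∈ Ioc (-π) π → ‖∫ x in (0 : ℝ)..(2 * π), Q x w‖ ≤
      3 * C * |w| ^ r * ∫ x in (0 : ℝ)..(2 * π), e x := by
    filter_upwards [h0] with w hw0 hw
    have c1 : Continuous fun x => e (x + w) := he.comp (continuous_id.add continuous_const)
    have c12 : Continuous fun x => e x + e (x + w) := he.add c1
    have c2 : Continuous fun q : ℝ × ℝ => e (q.1 + q.2 * w) := he.comp (by fun_prop)
    have c3 : Continuous fun x => ∫ θ in (0 : ℝ)..1, e (x + θ * w) :=
      intervalIntegral.continuous_parametric_intervalIntegral_of_continuous' c2 _ _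
    have e3 : ∫ x in (0 : ℝ)..(2 * π), ∫ θ in (0 : ℝ)..1, e (x + θ * w) =
        ∫ x in (0 : ℝ)..(2 * π), e x := by
      rw [intervalIntegral_intervalIntegral_swap]
      · simp only [hshift]; simp
      · exact (c2.continuousOn.integrableOn_compact (isCompact_uIcc.prod isCompact_uIcc)).mono_set
          (prod_mono uIoc_subset_uIcc uIoc_subset_uIcc)
    calc ‖∫ x in (0 : ℝ)..(2 * π), Q x w‖ ≤ ∫ x in (0 : ℝ)..(2 * π),
          C * |w| ^ r * (e x + e (x + w) + ∫ θ in (0 : ℝ)..1, e (x + θ * w)) := by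
          refine intervalIntegral.norm_integral_le_of_norm_le (by positivity) ?_
            ((continuous_const.mul (c12.add c3)).intervalIntegrable _ _)
          exact ae_of_all _ fun x _ => hb x w (abs_le.2 ⟨hw.1.le, hw.2⟩) hw0
      _ = C * |w| ^ r * (3 * ∫ x in (0 : ℝ)..(2 * π), e x) := by
          rw [intervalIntegral.integral_const_mul, intervalIntegral.integral_add
            (c12.intervalIntegrable _ _) (c3.intervalIntegrable _ _),
            intervalIntegral.integral_add (he.intervalIntegrable _ _) (c1.intervalIntegrable _ _),
            hshift, e3]
          ring
      _ = _ := by ring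
  refine (intervalIntegral.norm_integral_le_of_norm_le (by linarith) key hint).trans (le_of_eq ?_)
  rw [intervalIntegral.integral_mul_const, intervalIntegral.integral_const_mul]

lemma sub_eq_neg_smul_integral {γ p : ℝ → R2} (hd : ∀ x, HasDerivAt γ (p x) x)
    (hp : Continuous p) (x w : ℝ) :
    γ x - γ (x + w) = -(w • ∫ θ in (0 : ℝ)..1, p (x + θ * w)) := by
  have h1 : ∫ θ in (0 : ℝ)..1, w • p (x + θ * w) = γ (x + 1 * w) - γ (x + 0 * w) := by
    refine intervalIntegral.integral_eq_sub_of_hasDerivAt (f := fun θ => γ (x + θ * w))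
      (fun θ _ => ?_) ?_
    · have h2 : HasDerivAt (fun θ => x + θ * w) w θ := by
        simpa using ((hasDerivAt_id θ).mul_const w).const_add x
      exact (hd (x + θ * w)).scomp θ h2
    · have h3 : Continuous fun θ => p (x + θ * w) := hp.comp (by fun_prop)
      exact (h3.const_smul w).intervalIntegrable _ _
  rw [intervalIntegral.integral_smul] at h1
  rw [h1]; simp

namespace CurveBd

variable {M c β α : ℝ} {γ p : ℝ → R2}

lemma norm_pos (h : CurveBd M c β γ p) (hc : 0 < c) (x : ℝ) : 0 < ‖p x‖ := hc.trans_le (h.le_norm x)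

lemma norm_unitT (h : CurveBd M c β γ p) (hc : 0 < c) (x : ℝ) : ‖unitT p x‖ = 1 := by
  rw [unitT, norm_smul, norm_inv, norm_norm, inv_mul_cancel₀ (h.norm_pos hc x).ne']

lemma norm_smul_unitT (h : CurveBd M c β γ p) (hc : 0 < c) (x : ℝ) : ‖p x‖ • unitT p x = p x := by
  rw [unitT, smul_smul, mul_inv_cancel₀ (h.norm_pos hc x).ne', one_smul]

lemma continuous_unitT (h : CurveBd M c β γ p) (hc : 0 < c) : Continuous (unitT p) :=
  (h.continuous_deriv.norm.inv₀ fun x => (h.norm_pos hc x).ne').smul h.continuous_deriv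

lemma periodic_unitT (h : CurveBd M c β γ p) : Periodic (unitT p) (2 * π) := fun x => by
  rw [unitT, unitT, h.periodic_deriv]

lemma norm_unitT_sub_le (h : CurveBd M c β γ p) (hc : 0 < c) (x w : ℝ) :
    ‖unitT p (x + w) - unitT p x‖ ≤ 2 / c * M * |w| ^ β := by
  refine (norm_normalize_sub_le hc (h.le_norm _) (h.le_norm _)).trans ?_
  have := h.holder (x + w) x
  rw [add_sub_cancel_left] at this
  rw [mul_assoc]
  gcongr

lemma sub_eq_integral (h : CurveBd M c β γ p) (x w : ℝ) :
    γ x - γ (x + w) = -(w • ∫ θ in (0 : ℝ)..1, p (x + θ * w)) :=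
  sub_eq_neg_smul_integral h.hasDerivAt h.continuous_deriv x w

lemma norm_sub_le (h : CurveBd M c β γ p) (x w : ℝ) : ‖γ x - γ (x + w)‖ ≤ M * |w| := by
  rw [h.sub_eq_integral, norm_neg, norm_smul, mul_comm, Real.norm_eq_abs]
  gcongr
  have := intervalIntegral.norm_integral_le_of_norm_le_const (a := (0 : ℝ)) (b := 1) (C := M)
    (f := fun θ => p (x + θ * w)) (fun θ _ => h.norm_le _)
  simpa using this

lemma norm_sub_sub_le {γ₁ p₁ γ₂ p₂ : ℝ → R2} (h₁ : CurveBd M c β γ₁ p₁) (h₂ : CurveBd M c β γ₂ p₂)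
    (x w : ℝ) : ‖(γ₁ x - γ₁ (x + w)) - (γ₂ x - γ₂ (x + w))‖ ≤
      |w| * ∫ θ in (0 : ℝ)..1, ‖p₁ (x + θ * w) - p₂ (x + θ * w)‖ := by
  have c1 : Continuous fun θ => p₁ (x + θ * w) := h₁.continuous_deriv.comp (by fun_prop)
  have c2 : Continuous fun θ => p₂ (x + θ * w) := h₂.continuous_deriv.comp (by fun_prop)
  rw [h₁.sub_eq_integral, h₂.sub_eq_integral, neg_sub_neg, ← smul_sub,
    ← intervalIntegral.integral_sub (c2.intervalIntegrable _ _) (c1.intervalIntegrable _ _),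
    norm_smul, Real.norm_eq_abs]
  gcongr
  refine (intervalIntegral.norm_integral_le_integral_norm zero_le_one).trans (le_of_eq ?_)
  simp only [norm_sub_rev]

end CurveBd

/-- The velocity at which the unit tangent rotates when the curve moves with derivative `bdryW`. -/
def tangentRate (α ε : ℝ) (γ p : ℝ → R2) (x : ℝ) : R2 :=
  ‖p x‖⁻¹ • (bdryW α ε γ p x - ⟪bdryW α ε γ p x, unitT p x⟫ • unitT p x)

lemma cross_smul_proj_perp {S : R2} (hS : ‖S‖ = 1) (U Δ : R2) :
    cross S U • (perp Δ - ⟪perp Δ, S⟫ • S) = ⟪Δ, S⟫ • (U - ⟪U, S⟫ • S) := by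
  have h : S 0 * S 0 + S 1 * S 1 = 1 := by
    rw [← inner_R2, real_inner_self_eq_norm_sq, hS, one_pow]
  ext i
  fin_cases i
  · simp [inner_R2, cross, perp_zero_coord, perp_one_coord]
    linear_combination
      ((S 0 * U 1 - S 1 * U 0) * Δ 1 + (Δ 0 * S 0 + Δ 1 * S 1) * U 0) * h
  · simp [inner_R2, cross, perp_zero_coord, perp_one_coord]
    linear_combination
      (-(S 0 * U 1 - S 1 * U 0) * Δ 0 + (Δ 0 * S 0 + Δ 1 * S 1) * U 1) * h

lemma integral_comp_add_symm {K : ℝ → ℝ → ℝ} (hK : Continuous (uncurry K))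
    (h1 : ∀ y, Periodic (fun x => K x y) (2 * π)) (h2 : ∀ x, Periodic (K x) (2 * π)) :
    2 * ∫ x in (0 : ℝ)..(2 * π), ∫ w in (-π)..π, K x (x + w) =
      ∫ x in (0 : ℝ)..(2 * π), ∫ w in (-π)..π, (K x (x + w) + K (x + w) x) := by
  have hK' : Continuous (uncurry fun x y => K y x) := hK.comp continuous_swap
  have e1 : ∀ x, ∫ w in (-π)..π, K x (x + w) = ∫ y in (0 : ℝ)..(2 * π), K x y := fun x =>
    (h2 x).integral_comp_add x
  have e2 : ∀ x, ∫ w in (-π)..π, K (x + w) x = ∫ y in (0 : ℝ)..(2 * π), K y x := fun x =>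
    (h1 x).integral_comp_add x
  have c1 : Continuous fun x => ∫ y in (0 : ℝ)..(2 * π), K x y :=
    intervalIntegral.continuous_parametric_intervalIntegral_of_continuous' hK _ _
  have c2 : Continuous fun x => ∫ y in (0 : ℝ)..(2 * π), K y x :=
    intervalIntegral.continuous_parametric_intervalIntegral_of_continuous' hK' _ _
  have e3 : ∀ x, ∫ w in (-π)..π, (K x (x + w) + K (x + w) x) =
      (∫ y in (0 : ℝ)..(2 * π), K x y) + ∫ y in (0 : ℝ)..(2 * π), K y x := fun x => by
    have i1 : Continuous fun w => K x (x + w) :=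
      hK.comp (continuous_const.prodMk (continuous_const.add continuous_id))
    have i2 : Continuous fun w => K (x + w) x :=
      hK.comp ((continuous_const.add continuous_id).prodMk continuous_const)
    rw [intervalIntegral.integral_add (i1.intervalIntegrable _ _) (i2.intervalIntegrable _ _),
      e1, e2]
  have e4 : ∫ x in (0 : ℝ)..(2 * π), ∫ y in (0 : ℝ)..(2 * π), K y x =
      ∫ x in (0 : ℝ)..(2 * π), ∫ y in (0 : ℝ)..(2 * π), K x y := by
    rw [intervalIntegral_intervalIntegral_swap]
    exact (hK'.continuousOn.integrableOn_compact (isCompact_uIcc.prod isCompact_uIcc)).mono_set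
      (prod_mono uIoc_subset_uIcc uIoc_subset_uIcc)
  simp only [e1, e3]
  rw [intervalIntegral.integral_add (c1.intervalIntegrable _ _) (c2.intervalIntegrable _ _), e4,
    two_mul]

namespace CurveBd

variable {M c β α : ℝ} {γ p : ℝ → R2}

lemma tangentRate_eq_integral (h : CurveBd M c β γ p) (hc : 0 < c) {ε : ℝ} (hε : 0 < ε) (x : ℝ) :
    tangentRate α ε γ p x = ∫ w in (-π)..π,
      (scalarKer α ε (γ x - γ (x + w)) * ⟪γ x - γ (x + w), unitT p x⟫ * ‖p (x + w)‖) •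
        (unitT p (x + w) - ⟪unitT p (x + w), unitT p x⟫ • unitT p x) := by
  have hγ := h.continuous
  have hp := h.continuous_deriv
  set S := unitT p x with hS
  let L : R2 →L[ℝ] R2 := ‖p x‖⁻¹ • (ContinuousLinearMap.id ℝ R2 - (innerSL ℝ S).smulRight S)
  have hL : ∀ v, L v = ‖p x‖⁻¹ • (v - ⟪v, S⟫ • S) := fun v => by
    simp [L, real_inner_comm]
  have hcont : Continuous fun w => cross (p x) (p (x + w)) • sqgKer α ε (γ x - γ (x + w)) :=
    (Continuous.cross continuous_const (hp.comp (by fun_prop))).smul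
      ((contDiff_sqgKer α hε).continuous.comp (by fun_prop))
  rw [tangentRate, ← hS, ← hL, bdryW, ← L.intervalIntegral_comp_comm (hcont.intervalIntegrable _ _)]
  congr 1
  funext w
  rw [hL, mul_assoc, mul_comm ⟪γ x - γ (x + w), S⟫, ← mul_assoc, mul_smul _ ⟪γ x - γ (x + w), S⟫,
    ← cross_smul_proj_perp (h.norm_unitT hc x)]
  have hx := (h.norm_pos hc x).ne'
  have hcr : cross (p x) (p (x + w)) = ‖p x‖ * ‖p (x + w)‖ * cross S (unitT p (x + w)) := by
    rw [← h.norm_smul_unitT hc x, ← h.norm_smul_unitT hc (x + w), ← hS]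
    simp only [norm_smul, norm_norm, h.norm_unitT hc, cross, PiLp.smul_apply, smul_eq_mul]
    rw [hS, h.norm_unitT hc]
    ring
  rw [hcr, sqgKer]
  simp only [inner_smul_left, smul_sub, smul_smul, conj_trivial]
  congr 1
  · congr 1
    field_simp
    rw [hS]
    ring
  · congr 1
    field_simp
    rw [hS]
    ring

end CurveBd

namespace CurveBd

variable {M c β α : ℝ} {γ p : ℝ → R2}

lemma nonneg (h : CurveBd M c β γ p) : 0 ≤ M := (norm_nonneg _).trans (h.norm_le 0)

lemma pos_le_norm_sub (h : CurveBd M c β γ p) (hc : 0 < c) (x : ℝ) {w : ℝ} (hw : |w| ≤ π)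
    (hw0 : w ≠ 0) : 0 < c * |w| ∧ c * |w| ≤ ‖γ x - γ (x + w)‖ :=
  ⟨mul_pos hc (abs_pos.2 hw0), h.arcChord x w hw⟩

lemma integral_weight_eq_zero (h : CurveBd M c β γ p) (hα0 : 0 < α) {ε : ℝ} (hε : 0 < ε) (x : ℝ) :
    ∫ w in (-π)..π, scalarKer α ε (γ x - γ (x + w)) * ⟪γ x - γ (x + w), p (x + w)⟫ = 0 := by
  have hγ := h.continuous
  have hp := h.continuous_deriv
  have hd : ∀ w ∈ uIcc (-π) π, HasDerivAt
      (fun w => (‖γ x - γ (x + w)‖ ^ 2 + ε ^ 2) ^ (-α) / (2 * α))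
      (scalarKer α ε (γ x - γ (x + w)) * ⟪γ x - γ (x + w), p (x + w)⟫) w := by
    intro w _
    have h1 : HasDerivAt (fun w => γ x - γ (x + w)) (-p (x + w)) w :=
      ((h.hasDerivAt (x + w)).comp_const_add x w).const_sub (γ x)
    have h2 := ((h1.norm_sq.add_const (ε ^ 2)).rpow_const (p := -α)
      (Or.inl (by positivity))).div_const (2 * α)
    refine h2.congr_deriv ?_
    rw [inner_neg_right, scalarKer, show -α - 1 = -(1 + α) by ring]
    field_simp
  have hcont : Continuous fun w =>
      scalarKer α ε (γ x - γ (x + w)) * ⟪γ x - γ (x + w), p (x + w)⟫ :=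
    ((contDiff_scalarKer α hε).continuous.comp (by fun_prop)).mul
      (Continuous.inner (by fun_prop) (hp.comp (by fun_prop)))
  rw [intervalIntegral.integral_eq_sub_of_hasDerivAt hd (hcont.intervalIntegrable _ _)]
  have : γ (x + π) = γ (x + -π) := by
    rw [← h.periodic (x + -π)]; congr 1; ring
  rw [this, sub_self]

/-- The constant in the kernel bounds for a pair of curves. -/
def kerConst (α M c : ℝ) : ℝ := (1 + M) * c ^ (-(2 + 2 * α)) + 3 * M * c ^ (-(3 + 2 * α))

lemma kerConst_nonneg (hM : 0 ≤ M) (hc : 0 < c) : 0 ≤ kerConst α M c := by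
  unfold kerConst; positivity

lemma scalarKer_mul_le {γ₁ p₁ : ℝ → R2} (h₁ : CurveBd M c β γ₁ p₁)
    (hα0 : 0 < α) (hc : 0 < c) (ε x : ℝ) {w : ℝ}
    (hw : |w| ≤ π) (hw0 : w ≠ 0) {z : R2} {A : ℝ} (hA : 0 ≤ A) (hz : ‖z‖ ≤ (1 + M) * (|w| * A)) :
    scalarKer α ε (γ₁ x - γ₁ (x + w)) * ‖z‖ ≤ kerConst α M c * |w| ^ (-(1 + 2 * α)) * A := by
  obtain ⟨hl, hle⟩ := h₁.pos_le_norm_sub hc x hw hw0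
  have hM := h₁.nonneg
  have hw' := abs_pos.2 hw0
  have hq := scalarKer_le hα0 ε hl hle
  have hq0 := scalarKer_nonneg α ε (γ₁ x - γ₁ (x + w))
  have e : (c * |w|) ^ (-(2 + 2 * α)) * |w| = c ^ (-(2 + 2 * α)) * |w| ^ (-(1 + 2 * α)) := by
    rw [mul_rpow hc.le hw'.le, mul_assoc, ← rpow_add_one hw'.ne']; congr 2; ring
  calc _ ≤ (c * |w|) ^ (-(2 + 2 * α)) * ((1 + M) * (|w| * A)) := by gcongr
    _ = (1 + M) * ((c * |w|) ^ (-(2 + 2 * α)) * |w|) * A := by ring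
    _ = ((1 + M) * c ^ (-(2 + 2 * α))) * |w| ^ (-(1 + 2 * α)) * A := by rw [e]; ring
    _ ≤ _ := by
      unfold kerConst
      gcongr
      have : 0 ≤ 3 * M * c ^ (-(3 + 2 * α)) := by positivity
      linarith

lemma scalarKer_sub_mul_le {γ₁ p₁ γ₂ p₂ : ℝ → R2} (h₁ : CurveBd M c β γ₁ p₁)
    (h₂ : CurveBd M c β γ₂ p₂) (hα0 : 0 < α) (hα : α < 1 / 2) (hc : 0 < c) {ε : ℝ} (hε : 0 < ε)
    (x : ℝ) {w : ℝ} (hw : |w| ≤ π) (hw0 : w ≠ 0) {A : ℝ} (hA : 0 ≤ A)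
    (hz : ‖(γ₁ x - γ₁ (x + w)) - (γ₂ x - γ₂ (x + w))‖ ≤ |w| * A) :
    |scalarKer α ε (γ₁ x - γ₁ (x + w)) - scalarKer α ε (γ₂ x - γ₂ (x + w))| *
      ‖γ₂ x - γ₂ (x + w)‖ ≤ kerConst α M c * |w| ^ (-(1 + 2 * α)) * A := by
  obtain ⟨hl, hle₁⟩ := h₁.pos_le_norm_sub hc x hw hw0
  obtain ⟨_, hle₂⟩ := h₂.pos_le_norm_sub hc x hw hw0
  have hM := h₁.nonneg
  have hw' := abs_pos.2 hw0
  have e : (c * |w|) ^ (-(3 + 2 * α)) * |w| * |w| =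
      c ^ (-(3 + 2 * α)) * |w| ^ (-(1 + 2 * α)) := by
    rw [mul_rpow hc.le hw'.le, mul_assoc, mul_assoc, ← mul_assoc (|w| ^ _),
      ← rpow_add_one hw'.ne', ← rpow_add_one hw'.ne']
    congr 2; ring
  calc _ ≤ (3 * (c * |w|) ^ (-(3 + 2 * α)) * (|w| * A)) * (M * |w|) := by
        gcongr
        · exact (abs_scalarKer_sub_le hα0 hα hε hl hle₁ hle₂).trans (by gcongr)
        · exact h₂.norm_sub_le x w
    _ = 3 * M * ((c * |w|) ^ (-(3 + 2 * α)) * |w| * |w|) * A := by ring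
    _ = (3 * M * c ^ (-(3 + 2 * α))) * |w| ^ (-(1 + 2 * α)) * A := by rw [e]; ring
    _ ≤ _ := by
      unfold kerConst
      gcongr
      have : 0 ≤ (1 + M) * c ^ (-(2 + 2 * α)) := by positivity
      linarith

lemma norm_sub_sq_le {γ₁ p₁ γ₂ p₂ : ℝ → R2} (h₁ : CurveBd M c β γ₁ p₁)
    (h₂ : CurveBd M c β γ₂ p₂) (hc : 0 < c) (x : ℝ) :
    ‖p₁ x - p₂ x‖ ^ 2 ≤ 2 * (1 + M ^ 2) *
      (‖unitT p₁ x - unitT p₂ x‖ ^ 2 + (‖p₁ x‖ - ‖p₂ x‖) ^ 2) := by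
  have e : p₁ x - p₂ x = ‖p₁ x‖ • (unitT p₁ x - unitT p₂ x) + (‖p₁ x‖ - ‖p₂ x‖) • unitT p₂ x := by
    rw [smul_sub, sub_smul, h₁.norm_smul_unitT hc, h₂.norm_smul_unitT hc]; abel
  have h3 : ‖p₁ x - p₂ x‖ ≤ M * ‖unitT p₁ x - unitT p₂ x‖ + |‖p₁ x‖ - ‖p₂ x‖| := by
    rw [e]
    refine (norm_add_le _ _).trans ?_
    rw [norm_smul, norm_smul, h₂.norm_unitT hc, mul_one, norm_norm, Real.norm_eq_abs]
    gcongr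
    exact h₁.norm_le x
  have hs := sq_abs (‖p₁ x‖ - ‖p₂ x‖)
  set a := ‖unitT p₁ x - unitT p₂ x‖
  set d := |‖p₁ x‖ - ‖p₂ x‖|
  rw [← hs]
  have hM := h₁.nonneg
  calc _ ≤ (M * a + d) ^ 2 := by gcongr
    _ ≤ _ := by nlinarith [sq_nonneg (M * a - d), sq_nonneg (M * d), sq_nonneg a, sq_nonneg d]

end CurveBd

lemma remainder_factor_le {M a b d N X Y I : ℝ} (hM : 0 ≤ M) (hI : 0 ≤ I) (hX : a ^ 2 ≤ X)
    (hY : b ^ 2 + d ^ 2 ≤ Y) (hN : a * N ≤ a ^ 2 / 2 + (1 + M ^ 2) * I) :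
    a * (5 * M * a + 2 * M * b + 4 * M * N + 2 * d) ≤
      (1 + 8 * M + 4 * M * (1 + M ^ 2)) * (X + Y + I) := by
  have i4 : 2 * (a * b) ≤ X + Y := by linarith [sq_nonneg (a - b), sub_sq a b, sq_nonneg d]
  have i5 : 2 * (a * d) ≤ X + Y := by linarith [sq_nonneg (a - d), sub_sq a d, sq_nonneg b]
  have X0 : 0 ≤ X := (sq_nonneg a).trans hX
  have Y0 : 0 ≤ Y := by linarith [sq_nonneg b, sq_nonneg d]
  have i6 : M * (2 * (a * b)) ≤ M * (X + Y) := by gcongr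
  have i7 : M * (a * N) ≤ M * (X / 2 + (1 + M ^ 2) * I) :=
    mul_le_mul_of_nonneg_left (by linarith) hM
  have i8 : M * a ^ 2 ≤ M * X := by gcongr
  have j1 : 0 ≤ M * Y := by positivity
  have j2 : 0 ≤ M * I := by positivity
  have j3 : 0 ≤ M * (1 + M ^ 2) * (X + Y) := by positivity
  calc _ = 5 * (M * a ^ 2) + M * (2 * (a * b)) + 4 * (M * (a * N)) + 2 * (a * d) := by ring
    _ ≤ 5 * (M * X) + M * (X + Y) + 4 * (M * (X / 2 + (1 + M ^ 2) * I)) + (X + Y) := by gcongr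
    _ ≤ _ := by linarith

namespace CurveBd

variable {M c β α : ℝ} {γ₁ p₁ γ₂ p₂ : ℝ → R2}

/-- The pointwise squared distance between the tangents and metrics of two curves. -/
def tangentDist (p₁ p₂ : ℝ → R2) (x : ℝ) : ℝ :=
  ‖unitT p₁ x - unitT p₂ x‖ ^ 2 + (‖p₁ x‖ - ‖p₂ x‖) ^ 2

lemma tangentDist_nonneg (p₁ p₂ : ℝ → R2) (x : ℝ) : 0 ≤ tangentDist p₁ p₂ x := by
  unfold tangentDist; positivity

lemma continuous_tangentDist (h₁ : CurveBd M c β γ₁ p₁) (h₂ : CurveBd M c β γ₂ p₂) (hc : 0 < c) :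
    Continuous (tangentDist p₁ p₂) :=
  (((h₁.continuous_unitT hc).sub (h₂.continuous_unitT hc)).norm.pow 2).add
    ((h₁.continuous_deriv.norm.sub h₂.continuous_deriv.norm).pow 2)

lemma periodic_tangentDist (h₁ : CurveBd M c β γ₁ p₁) (h₂ : CurveBd M c β γ₂ p₂) :
    Periodic (tangentDist p₁ p₂) (2 * π) := fun x => by
  rw [tangentDist, tangentDist, h₁.periodic_unitT, h₂.periodic_unitT, h₁.periodic_deriv,
    h₂.periodic_deriv]

lemma norm_mul_integral_le (h₁ : CurveBd M c β γ₁ p₁) (h₂ : CurveBd M c β γ₂ p₂) (hc : 0 < c)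
    (x w a : ℝ) : a * ∫ θ in (0 : ℝ)..1, ‖p₁ (x + θ * w) - p₂ (x + θ * w)‖ ≤
      a ^ 2 / 2 + (1 + M ^ 2) * ∫ θ in (0 : ℝ)..1, tangentDist p₁ p₂ (x + θ * w) := by
  have c1 : Continuous fun θ => ‖p₁ (x + θ * w) - p₂ (x + θ * w)‖ :=
    ((h₁.continuous_deriv.comp (by fun_prop)).sub (h₂.continuous_deriv.comp (by fun_prop))).norm
  have c2 : Continuous fun θ => tangentDist p₁ p₂ (x + θ * w) :=
    (continuous_tangentDist h₁ h₂ hc).comp (by fun_prop)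
  have e : a ^ 2 / 2 + (1 + M ^ 2) * ∫ θ in (0 : ℝ)..1, tangentDist p₁ p₂ (x + θ * w) =
      ∫ θ in (0 : ℝ)..1, (a ^ 2 / 2 + (1 + M ^ 2) * tangentDist p₁ p₂ (x + θ * w)) := by
    have c3 : Continuous fun θ => (1 + M ^ 2) * tangentDist p₁ p₂ (x + θ * w) :=
      continuous_const.mul c2
    rw [intervalIntegral.integral_add intervalIntegrable_const (c3.intervalIntegrable _ _),
      intervalIntegral.integral_const_mul]
    simp
  rw [e, ← intervalIntegral.integral_const_mul]
  refine intervalIntegral.integral_mono_on zero_le_one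
    ((continuous_const.mul c1).intervalIntegrable _ _)
    ((continuous_const.add (continuous_const.mul c2)).intervalIntegrable _ _) fun θ _ => ?_
  have := norm_sub_sq_le h₁ h₂ hc (x + θ * w)
  unfold tangentDist
  nlinarith [sq_nonneg (a - ‖p₁ (x + θ * w) - p₂ (x + θ * w)‖)]

/-- The integrand, in the relative variable, of the change of the tangent of one curve. -/
def rateIntegrand (α ε : ℝ) (γ p : ℝ → R2) (x w : ℝ) : R2 :=
  (scalarKer α ε (γ x - γ (x + w)) * ⟪γ x - γ (x + w), unitT p x⟫ * ‖p (x + w)‖) •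
    (unitT p (x + w) - ⟪unitT p (x + w), unitT p x⟫ • unitT p x)

/-- The weight multiplying the tangent difference in the leading part of the evolution. -/
def weight (α ε : ℝ) (γ p : ℝ → R2) (x y : ℝ) : ℝ := scalarKer α ε (γ x - γ y) * ⟪γ x - γ y, p y⟫

lemma continuous_rateIntegrand (h : CurveBd M c β γ₁ p₁) (hc : 0 < c) {ε : ℝ} (hε : 0 < ε) :
    Continuous (uncurry (rateIntegrand α ε γ₁ p₁)) := by
  have hγ := h.continuous
  have hp := h.continuous_deriv
  have hT := h.continuous_unitT hc
  have hk := (contDiff_scalarKer α hε).continuous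
  unfold rateIntegrand
  simp only [uncurry_def]
  fun_prop

lemma continuous_weight (h : CurveBd M c β γ₁ p₁) {ε : ℝ} (hε : 0 < ε) :
    Continuous (uncurry (weight α ε γ₁ p₁)) := by
  have hγ := h.continuous
  have hp := h.continuous_deriv
  have hk := (contDiff_scalarKer α hε).continuous
  unfold weight
  simp only [uncurry_def]
  fun_prop

lemma abs_rateIntegrand_sub_le (h₁ : CurveBd M c β γ₁ p₁) (h₂ : CurveBd M c β γ₂ p₂)
    (hα0 : 0 < α) (hα : α < 1 / 2) (hc : 0 < c) {ε : ℝ} (hε : 0 < ε)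
    (x : ℝ) {w : ℝ} (hw : |w| ≤ π) (hw0 : w ≠ 0) :
    |⟪unitT p₁ x - unitT p₂ x, rateIntegrand α ε γ₁ p₁ x w - rateIntegrand α ε γ₂ p₂ x w⟫ -
        weight α ε γ₁ p₁ x (x + w) *
          ⟪unitT p₁ x - unitT p₂ x, unitT p₁ (x + w) - unitT p₂ (x + w)⟫ +
        weight α ε γ₁ p₁ x (x + w) * ‖unitT p₁ x - unitT p₂ x‖ ^ 2| ≤
      (kerConst α M c * (2 / c * M) * (1 + 8 * M + 4 * M * (1 + M ^ 2))) * |w| ^ (β - 1 - 2 * α) *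
        (tangentDist p₁ p₂ x + tangentDist p₁ p₂ (x + w) +
          ∫ θ in (0 : ℝ)..1, tangentDist p₁ p₂ (x + θ * w)) := by
  have hM := h₁.nonneg
  have hw' := abs_pos.2 hw0
  have hK := kerConst_nonneg (α := α) hM hc
  set N := ∫ θ in (0 : ℝ)..1, ‖p₁ (x + θ * w) - p₂ (x + θ * w)‖ with hN
  set I := ∫ θ in (0 : ℝ)..1, tangentDist p₁ p₂ (x + θ * w) with hI
  have hN0 : 0 ≤ N := intervalIntegral.integral_nonneg zero_le_one fun _ _ => norm_nonneg _
  have hI0 : 0 ≤ I := intervalIntegral.integral_nonneg zero_le_one fun _ _ =>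
    tangentDist_nonneg _ _ _
  have hd := norm_sub_sub_le h₁ h₂ x w
  rw [← hN] at hd
  have b : ∀ {γ p : ℝ → R2}, CurveBd M c β γ p →
      ‖γ x - γ (x + w)‖ ≤ (1 + M) * (|w| * 1) := fun h => by
    have := h.norm_sub_le x w
    nlinarith
  have b' : ‖(γ₁ x - γ₁ (x + w)) - (γ₂ x - γ₂ (x + w))‖ ≤ (1 + M) * (|w| * N) := by
    have : 0 ≤ M * (|w| * N) := by positivity
    linarith
  have r1 := scalarKer_mul_le h₁ hα0 hc ε x hw hw0 zero_le_one (b h₁)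
  have r2 := scalarKer_mul_le h₂ hα0 hc ε x hw hw0 zero_le_one (b h₂)
  have r4 := scalarKer_mul_le h₁ hα0 hc ε x hw hw0 zero_le_one (b h₂)
  have r3 := scalarKer_mul_le h₁ hα0 hc ε x hw hw0 hN0 b'
  have r5 := scalarKer_sub_mul_le h₁ h₂ hα0 hα hc hε x hw hw0 hN0 hd
  rw [mul_one] at r1 r2 r4
  have hR := remainder_le (h₁.norm_unitT hc x) (h₂.norm_unitT hc x) (h₁.norm_unitT hc (x + w))
    (h₂.norm_unitT hc (x + w)) (scalarKer_nonneg α ε _) (scalarKer_nonneg α ε _)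
    (norm_nonneg (p₁ (x + w))) (h₁.norm_le _) (norm_nonneg (p₂ (x + w))) (h₂.norm_le _)
    r1 r2 r3 r4 r5 (h₁.norm_unitT_sub_le hc x w) (h₂.norm_unitT_sub_le hc x w)
  have hwt : scalarKer α ε (γ₁ x - γ₁ (x + w)) * ⟪γ₁ x - γ₁ (x + w), unitT p₁ (x + w)⟫ *
      ‖p₁ (x + w)‖ = weight α ε γ₁ p₁ x (x + w) := by
    rw [weight]
    conv_rhs => rw [← h₁.norm_smul_unitT hc (x + w)]
    rw [inner_smul_right]; ring
  rw [hwt] at hR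
  refine hR.trans ?_
  have hpow : |w| ^ (-(1 + 2 * α)) * |w| ^ β = |w| ^ (β - 1 - 2 * α) := by
    rw [← rpow_add hw']; congr 1; ring
  have e : kerConst α M c * |w| ^ (-(1 + 2 * α)) * (2 / c * M * |w| ^ β) =
      kerConst α M c * (2 / c * M) * |w| ^ (β - 1 - 2 * α) := by
    rw [← hpow]; ring
  rw [e]
  have hF := norm_mul_integral_le h₁ h₂ hc x w ‖unitT p₁ x - unitT p₂ x‖
  rw [← hN, ← hI] at hF
  have hsx : tangentDist p₁ p₂ x = ‖unitT p₁ x - unitT p₂ x‖ ^ 2 + (‖p₁ x‖ - ‖p₂ x‖) ^ 2 := rfl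
  have hsy : tangentDist p₁ p₂ (x + w) = ‖unitT p₁ (x + w) - unitT p₂ (x + w)‖ ^ 2 +
    |‖p₁ (x + w)‖ - ‖p₂ (x + w)‖| ^ 2 := by rw [sq_abs]; rfl
  have hx0 := sq_nonneg (‖p₁ x‖ - ‖p₂ x‖)
  set a := ‖unitT p₁ x - unitT p₂ x‖
  set b := ‖unitT p₁ (x + w) - unitT p₂ (x + w)‖
  set d := |‖p₁ (x + w)‖ - ‖p₂ (x + w)‖|
  set X := tangentDist p₁ p₂ x
  set Y := tangentDist p₁ p₂ (x + w)
  have key : a * (5 * M * a + 2 * M * b + 4 * M * N + 2 * d) ≤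
      (1 + 8 * M + 4 * M * (1 + M ^ 2)) * (X + Y + I) :=
    remainder_factor_le hM hI0 (by linarith) hsy.ge hF
  calc _ ≤ kerConst α M c * (2 / c * M) * |w| ^ (β - 1 - 2 * α) *
        ((1 + 8 * M + 4 * M * (1 + M ^ 2)) * (X + Y + I)) := by gcongr
    _ = _ := by ring

lemma abs_weight_symm_le (h₁ : CurveBd M c β γ₁ p₁)
    (hα0 : 0 < α) (hc : 0 < c) (ε : ℝ) (x : ℝ) {w : ℝ} (hw : |w| ≤ π) (hw0 : w ≠ 0) :
    |weight α ε γ₁ p₁ x (x + w) *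
          ⟪unitT p₁ x - unitT p₂ x, unitT p₁ (x + w) - unitT p₂ (x + w)⟫ +
        weight α ε γ₁ p₁ (x + w) x *
          ⟪unitT p₁ (x + w) - unitT p₂ (x + w), unitT p₁ x - unitT p₂ x⟫| ≤
      (kerConst α M c * M) * |w| ^ (β - 1 - 2 * α) *
        (tangentDist p₁ p₂ x + tangentDist p₁ p₂ (x + w) +
          ∫ θ in (0 : ℝ)..1, tangentDist p₁ p₂ (x + θ * w)) := by
  have hM := h₁.nonneg
  have hw' := abs_pos.2 hw0
  have hK := kerConst_nonneg (α := α) hM hc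
  have hI0 : 0 ≤ ∫ θ in (0 : ℝ)..1, tangentDist p₁ p₂ (x + θ * w) :=
    intervalIntegral.integral_nonneg zero_le_one fun _ _ => tangentDist_nonneg _ _ _
  have e : weight α ε γ₁ p₁ x (x + w) *
          ⟪unitT p₁ x - unitT p₂ x, unitT p₁ (x + w) - unitT p₂ (x + w)⟫ +
        weight α ε γ₁ p₁ (x + w) x *
          ⟪unitT p₁ (x + w) - unitT p₂ (x + w), unitT p₁ x - unitT p₂ x⟫ =
      scalarKer α ε (γ₁ x - γ₁ (x + w)) * ⟪γ₁ x - γ₁ (x + w), p₁ (x + w) - p₁ x⟫ *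
        ⟪unitT p₁ x - unitT p₂ x, unitT p₁ (x + w) - unitT p₂ (x + w)⟫ := by
    rw [real_inner_comm (unitT p₁ x - unitT p₂ x), weight, weight,
      ← neg_sub (γ₁ x) (γ₁ (x + w)), scalarKer_neg, inner_neg_left, inner_sub_right _ (p₁ (x + w))]
    ring
  have b : ‖γ₁ x - γ₁ (x + w)‖ ≤ (1 + M) * (|w| * 1) := by
    have := h₁.norm_sub_le x w
    nlinarith
  have r1 := scalarKer_mul_le h₁ hα0 hc ε x hw hw0 zero_le_one b
  rw [mul_one] at r1
  have hq0 := scalarKer_nonneg α ε (γ₁ x - γ₁ (x + w))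
  have hh := h₁.holder (x + w) x
  rw [add_sub_cancel_left] at hh
  have hpow : |w| ^ (-(1 + 2 * α)) * |w| ^ β = |w| ^ (β - 1 - 2 * α) := by
    rw [← rpow_add hw']; congr 1; ring
  have h3 : |⟪unitT p₁ x - unitT p₂ x, unitT p₁ (x + w) - unitT p₂ (x + w)⟫| ≤
      tangentDist p₁ p₂ x + tangentDist p₁ p₂ (x + w) +
          ∫ θ in (0 : ℝ)..1, tangentDist p₁ p₂ (x + θ * w) := by
    refine (abs_real_inner_le_norm _ _).trans ?_
    rw [tangentDist, tangentDist]
    nlinarith [sq_nonneg (‖unitT p₁ x - unitT p₂ x‖ - ‖unitT p₁ (x + w) - unitT p₂ (x + w)‖),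
      sq_nonneg (‖p₁ x‖ - ‖p₂ x‖), sq_nonneg (‖p₁ (x + w)‖ - ‖p₂ (x + w)‖),
      sq_nonneg ‖unitT p₁ x - unitT p₂ x‖, sq_nonneg ‖unitT p₁ (x + w) - unitT p₂ (x + w)‖]
  have h4 : |⟪γ₁ x - γ₁ (x + w), p₁ (x + w) - p₁ x⟫| ≤ ‖γ₁ x - γ₁ (x + w)‖ * (M * |w| ^ β) :=
    (abs_real_inner_le_norm _ _).trans (by gcongr)
  rw [e, abs_mul, abs_mul, abs_of_nonneg hq0]
  refine mul_le_mul ?_ h3 (abs_nonneg _) (by positivity)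
  calc _ ≤ scalarKer α ε (γ₁ x - γ₁ (x + w)) * (‖γ₁ x - γ₁ (x + w)‖ * (M * |w| ^ β)) := by gcongr
    _ = (scalarKer α ε (γ₁ x - γ₁ (x + w)) * ‖γ₁ x - γ₁ (x + w)‖) * (M * |w| ^ β) := by ring
    _ ≤ (kerConst α M c * |w| ^ (-(1 + 2 * α))) * (M * |w| ^ β) := by gcongr
    _ = _ := by rw [← hpow]; ring

end CurveBd

namespace CurveBd

variable {M c β α : ℝ} {γ p γ₁ p₁ γ₂ p₂ : ℝ → R2}

attribute [local irreducible] rateIntegrand weight tangentRate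

/-- The constant in the stability estimate for a pair of curves. -/
def stabilityConst (α β M c : ℝ) : ℝ :=
  3 * (kerConst α M c * (2 / c * M) * (1 + 8 * M + 4 * M * (1 + M ^ 2))) *
      (∫ w in (-π)..π, |w| ^ (β - 1 - 2 * α)) +
    3 * (kerConst α M c * M) * (∫ w in (-π)..π, |w| ^ (β - 1 - 2 * α))

lemma stabilityConst_nonneg (hM : 0 ≤ M) (hc : 0 < c) : 0 ≤ stabilityConst α β M c := by
  have hK := kerConst_nonneg (α := α) hM hc
  have hI : 0 ≤ ∫ w in (-π)..π, |w| ^ (β - 1 - 2 * α) :=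
    intervalIntegral.integral_nonneg (by linarith [pi_pos]) fun _ _ => rpow_nonneg (abs_nonneg _) _
  unfold stabilityConst
  positivity

lemma inner_tangentRate_sub_eq (h₁ : CurveBd M c β γ₁ p₁) (h₂ : CurveBd M c β γ₂ p₂)
    (hc : 0 < c) {ε : ℝ} (hε : 0 < ε) (x : ℝ) (v : R2) :
    ⟪v, tangentRate α ε γ₁ p₁ x - tangentRate α ε γ₂ p₂ x⟫ =
      ∫ w in (-π)..π, ⟪v, rateIntegrand α ε γ₁ p₁ x w - rateIntegrand α ε γ₂ p₂ x w⟫ := by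
  have i1 : Continuous fun w => rateIntegrand α ε γ₁ p₁ x w :=
    (continuous_rateIntegrand h₁ hc hε).comp (continuous_const.prodMk continuous_id)
  have i2 : Continuous fun w => rateIntegrand α ε γ₂ p₂ x w :=
    (continuous_rateIntegrand h₂ hc hε).comp (continuous_const.prodMk continuous_id)
  have r1 : tangentRate α ε γ₁ p₁ x = ∫ w in (-π)..π, rateIntegrand α ε γ₁ p₁ x w := by
    simp only [rateIntegrand]
    exact h₁.tangentRate_eq_integral hc hε x
  have r2 : tangentRate α ε γ₂ p₂ x = ∫ w in (-π)..π, rateIntegrand α ε γ₂ p₂ x w := by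
    simp only [rateIntegrand]
    exact h₂.tangentRate_eq_integral hc hε x
  have := (innerSL ℝ v).intervalIntegral_comp_comm
    ((i1.sub i2).intervalIntegrable (μ := volume) (-π) π)
  rw [r1, r2, ← intervalIntegral.integral_sub (i1.intervalIntegrable _ _)
    (i2.intervalIntegrable _ _)]
  exact this.symm

lemma integral_eq_add_of_weight (h : CurveBd M c β γ p) (hα0 : 0 < α) {ε : ℝ} (hε : 0 < ε)
    (x a : ℝ) {J K : ℝ → ℝ} (hJ : Continuous J) (hK : Continuous K) :
    ∫ w in (-π)..π, J w =
      (∫ w in (-π)..π, (J w - K w + weight α ε γ p x (x + w) * a)) + ∫ w in (-π)..π, K w := by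
  have hw : Continuous fun w => weight α ε γ p x (x + w) :=
    (continuous_weight h hε).comp (continuous_const.prodMk (continuous_const.add continuous_id))
  have hwa : Continuous fun w => weight α ε γ p x (x + w) * a := hw.mul continuous_const
  have z : ∫ w in (-π)..π, weight α ε γ p x (x + w) * a = 0 := by
    rw [intervalIntegral.integral_mul_const]
    have := h.integral_weight_eq_zero hα0 hε x
    unfold weight
    rw [this, zero_mul]
  have hJK : Continuous fun w => J w - K w := hJ.sub hK
  rw [intervalIntegral.integral_add (hJK.intervalIntegrable _ _) (hwa.intervalIntegrable _ _), z,
    intervalIntegral.integral_sub (hJ.intervalIntegrable _ _) (hK.intervalIntegrable _ _)]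
  ring

lemma abs_integral_add_symm_le {Q K : ℝ → ℝ → ℝ} (hQ : Continuous (uncurry Q))
    (hK : Continuous (uncurry K)) (hK1 : ∀ y, Periodic (fun x => K x y) (2 * π))
    (hK2 : ∀ x, Periodic (K x) (2 * π)) {e : ℝ → ℝ} (he : Continuous e)
    (hper : Periodic e (2 * π)) {r C₁ C₂ : ℝ} (hr : -1 < r)
    (hb₁ : ∀ x w, |w| ≤ π → w ≠ 0 →
      |Q x w| ≤ C₁ * |w| ^ r * (e x + e (x + w) + ∫ θ in (0 : ℝ)..1, e (x + θ * w)))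
    (hb₂ : ∀ x w, |w| ≤ π → w ≠ 0 → |K x (x + w) + K (x + w) x| ≤
      C₂ * |w| ^ r * (e x + e (x + w) + ∫ θ in (0 : ℝ)..1, e (x + θ * w))) :
    |∫ x in (0 : ℝ)..(2 * π), ((∫ w in (-π)..π, Q x w) + ∫ w in (-π)..π, K x (x + w))| ≤
      (3 * C₁ * (∫ w in (-π)..π, |w| ^ r) + 3 * C₂ * (∫ w in (-π)..π, |w| ^ r)) *
        ∫ x in (0 : ℝ)..(2 * π), e x := by
  have cadd : Continuous fun q : ℝ × ℝ => (q.1, q.1 + q.2) := by fun_prop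
  have cIQ : Continuous fun x => ∫ w in (-π)..π, Q x w :=
    intervalIntegral.continuous_parametric_intervalIntegral_of_continuous' hQ _ _
  have cIK : Continuous fun x => ∫ w in (-π)..π, K x (x + w) :=
    intervalIntegral.continuous_parametric_intervalIntegral_of_continuous'
      (f := fun x w => K x (x + w)) (hK.comp cadd) _ _
  rw [intervalIntegral.integral_add (cIQ.intervalIntegrable _ _) (cIK.intervalIntegrable _ _)]
  have b1 := abs_double_integral_le hQ he hper hr hb₁
  have cS : Continuous (uncurry fun x w => K x (x + w) + K (x + w) x) :=
    (hK.comp cadd).add (hK.comp (continuous_swap.comp cadd))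
  have b2 := abs_double_integral_le cS he hper hr hb₂
  rw [← integral_comp_add_symm hK hK1 hK2, abs_mul, abs_two] at b2
  refine (abs_add_le _ _).trans ?_
  rw [add_mul]
  have := abs_nonneg (∫ x in (0 : ℝ)..(2 * π), ∫ w in (-π)..π, K x (x + w))
  linarith

lemma abs_integral_tangentRate_reg_le (h₁ : CurveBd M c β γ₁ p₁) (h₂ : CurveBd M c β γ₂ p₂)
    (hα0 : 0 < α) (hα : α < 1 / 2) (hβ : 2 * α < β) (hc : 0 < c) {ε : ℝ} (hε : 0 < ε) :
    |∫ x in (0 : ℝ)..(2 * π), ⟪unitT p₁ x - unitT p₂ x,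
        tangentRate α ε γ₁ p₁ x - tangentRate α ε γ₂ p₂ x⟫| ≤
      stabilityConst α β M c * ∫ x in (0 : ℝ)..(2 * π), tangentDist p₁ p₂ x := by
  have cD : Continuous fun x => unitT p₁ x - unitT p₂ x :=
    (h₁.continuous_unitT hc).sub (h₂.continuous_unitT hc)
  have cω₁ := continuous_rateIntegrand (α := α) h₁ hc hε
  have cω₂ := continuous_rateIntegrand (α := α) h₂ hc hε
  have cm := continuous_weight (α := α) h₁ hε
  have cadd : Continuous fun q : ℝ × ℝ => (q.1, q.1 + q.2) := by fun_prop
  have cK : Continuous (uncurry fun x y => weight α ε γ₁ p₁ x y *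
      ⟪unitT p₁ x - unitT p₂ x, unitT p₁ y - unitT p₂ y⟫) :=
    cm.mul (Continuous.inner (cD.comp continuous_fst) (cD.comp continuous_snd))
  have cK' : Continuous fun q : ℝ × ℝ => weight α ε γ₁ p₁ q.1 (q.1 + q.2) *
      ⟪unitT p₁ q.1 - unitT p₂ q.1, unitT p₁ (q.1 + q.2) - unitT p₂ (q.1 + q.2)⟫ :=
    cK.comp cadd
  have cJ : Continuous fun q : ℝ × ℝ => ⟪unitT p₁ q.1 - unitT p₂ q.1,
      rateIntegrand α ε γ₁ p₁ q.1 q.2 - rateIntegrand α ε γ₂ p₂ q.1 q.2⟫ :=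
    Continuous.inner (cD.comp continuous_fst) (cω₁.sub cω₂)
  have cw : Continuous fun q : ℝ × ℝ =>
      weight α ε γ₁ p₁ q.1 (q.1 + q.2) * ‖unitT p₁ q.1 - unitT p₂ q.1‖ ^ 2 :=
    (cm.comp cadd).mul ((cD.comp continuous_fst).norm.pow 2)
  have e : ∀ x, ⟪unitT p₁ x - unitT p₂ x,
      tangentRate α ε γ₁ p₁ x - tangentRate α ε γ₂ p₂ x⟫ =
      (∫ w in (-π)..π,
        (⟪unitT p₁ x - unitT p₂ x, rateIntegrand α ε γ₁ p₁ x w - rateIntegrand α ε γ₂ p₂ x w⟫ -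
          weight α ε γ₁ p₁ x (x + w) *
            ⟪unitT p₁ x - unitT p₂ x, unitT p₁ (x + w) - unitT p₂ (x + w)⟫ +
          weight α ε γ₁ p₁ x (x + w) * ‖unitT p₁ x - unitT p₂ x‖ ^ 2)) +
      ∫ w in (-π)..π, weight α ε γ₁ p₁ x (x + w) *
        ⟪unitT p₁ x - unitT p₂ x, unitT p₁ (x + w) - unitT p₂ (x + w)⟫ := fun x => by
    have i1 : Continuous fun w => rateIntegrand α ε γ₁ p₁ x w :=
      cω₁.comp (continuous_const.prodMk continuous_id)
    have i2 : Continuous fun w => rateIntegrand α ε γ₂ p₂ x w :=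
      cω₂.comp (continuous_const.prodMk continuous_id)
    have i3 : Continuous fun w => weight α ε γ₁ p₁ x (x + w) :=
      cm.comp (continuous_const.prodMk (continuous_const.add continuous_id))
    have i4 : Continuous fun w => unitT p₁ (x + w) - unitT p₂ (x + w) :=
      cD.comp (continuous_const.add continuous_id)
    have k1 : Continuous fun w => ⟪unitT p₁ x - unitT p₂ x,
      rateIntegrand α ε γ₁ p₁ x w - rateIntegrand α ε γ₂ p₂ x w⟫ :=
      Continuous.inner continuous_const (i1.sub i2)
    have k2 : Continuous fun w => weight α ε γ₁ p₁ x (x + w) *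
      ⟪unitT p₁ x - unitT p₂ x, unitT p₁ (x + w) - unitT p₂ (x + w)⟫ :=
      i3.mul (Continuous.inner continuous_const i4)
    rw [h₁.inner_tangentRate_sub_eq h₂ hc hε x (unitT p₁ x - unitT p₂ x)]
    exact h₁.integral_eq_add_of_weight hα0 hε x (‖unitT p₁ x - unitT p₂ x‖ ^ 2) k1 k2
  have cQ : Continuous (uncurry fun x w =>
      ⟪unitT p₁ x - unitT p₂ x, rateIntegrand α ε γ₁ p₁ x w - rateIntegrand α ε γ₂ p₂ x w⟫ -
        weight α ε γ₁ p₁ x (x + w) *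
          ⟪unitT p₁ x - unitT p₂ x, unitT p₁ (x + w) - unitT p₂ (x + w)⟫ +
        weight α ε γ₁ p₁ x (x + w) * ‖unitT p₁ x - unitT p₂ x‖ ^ 2) := (cJ.sub cK').add cw
  simp only [e]
  refine abs_integral_add_symm_le cQ cK ?_ ?_
    (continuous_tangentDist h₁ h₂ hc) (periodic_tangentDist h₁ h₂) (by linarith)
    (fun x w hw hw0 => abs_rateIntegrand_sub_le h₁ h₂ hα0 hα hc hε x hw hw0)
    (fun x w hw hw0 => abs_weight_symm_le h₁ hα0 hc ε x hw hw0)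
  · intro y x
    simp only [weight, h₁.periodic x, h₁.periodic_unitT x, h₂.periodic_unitT x]
  · intro x y
    simp only [weight, h₁.periodic y, h₁.periodic_deriv y, h₁.periodic_unitT y,
      h₂.periodic_unitT y]

lemma tendsto_tangentRate (h : CurveBd M c β γ p) (hα : 0 < α) (hβ : 2 * α < β) (hc : 0 < c)
    (x : ℝ) : Tendsto (fun ε => tangentRate α ε γ p x) (𝓝[>] 0) (𝓝 (tangentRate α 0 γ p x)) := by
  have hW := h.tendsto_bdryW hα hβ hc x
  simp only [tangentRate]
  exact (hW.sub ((hW.inner tendsto_const_nhds).smul tendsto_const_nhds)).const_smul _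

lemma norm_tangentRate_le (h : CurveBd M c β γ p) (hα : 0 < α) (hβ : 2 * α < β) (hc : 0 < c)
    (ε x : ℝ) : ‖tangentRate α ε γ p x‖ ≤
      c⁻¹ * (2 * ∫ w in (-π)..π, M * M * c ^ (-(1 + 2 * α)) * |w| ^ (β - 1 - 2 * α)) := by
  have hW := h.norm_bdryW_le hα hβ hc ε x
  have hT := h.norm_unitT hc x
  have hi := abs_real_inner_le_norm (bdryW α ε γ p x) (unitT p x)
  rw [hT, mul_one] at hi
  have hW0 := norm_nonneg (bdryW α ε γ p x)
  rw [tangentRate, norm_smul, norm_inv, norm_norm]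
  gcongr
  · exact h.le_norm x
  · refine (_root_.norm_sub_le _ _).trans ?_
    rw [norm_smul, hT, mul_one, Real.norm_eq_abs]
    linarith

lemma continuous_tangentRate_reg (h : CurveBd M c β γ p) (hc : 0 < c) {ε : ℝ} (hε : 0 < ε) :
    Continuous (tangentRate α ε γ p) := by
  have hW : Continuous (bdryW α ε γ p) := h.continuous_bdryW_reg hε
  have hT := h.continuous_unitT hc
  unfold tangentRate
  have hs : Continuous fun x => ⟪bdryW α ε γ p x, unitT p x⟫ • unitT p x := (hW.inner (𝕜 := ℝ) hT).smul hT
  exact (h.continuous_deriv.norm.inv₀ fun x => (h.norm_pos hc x).ne').smul (hW.sub hs)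

lemma abs_integral_tangentRate_le (h₁ : CurveBd M c β γ₁ p₁) (h₂ : CurveBd M c β γ₂ p₂)
    (hα0 : 0 < α) (hα : α < 1 / 2) (hβ : 2 * α < β) (hc : 0 < c) :
    |∫ x in (0 : ℝ)..(2 * π), ⟪unitT p₁ x - unitT p₂ x,
        tangentRate α 0 γ₁ p₁ x - tangentRate α 0 γ₂ p₂ x⟫| ≤
      stabilityConst α β M c * ∫ x in (0 : ℝ)..(2 * π), tangentDist p₁ p₂ x := by
  have cD : Continuous fun x => unitT p₁ x - unitT p₂ x :=
    (h₁.continuous_unitT hc).sub (h₂.continuous_unitT hc)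
  set B := c⁻¹ * (2 * ∫ w in (-π)..π, M * M * c ^ (-(1 + 2 * α)) * |w| ^ (β - 1 - 2 * α))
  have hlim : Tendsto (fun ε => ∫ x in (0 : ℝ)..(2 * π), ⟪unitT p₁ x - unitT p₂ x,
      tangentRate α ε γ₁ p₁ x - tangentRate α ε γ₂ p₂ x⟫) (𝓝[>] 0)
      (𝓝 (∫ x in (0 : ℝ)..(2 * π), ⟪unitT p₁ x - unitT p₂ x,
        tangentRate α 0 γ₁ p₁ x - tangentRate α 0 γ₂ p₂ x⟫)) := by
    refine intervalIntegral.tendsto_integral_filter_of_dominated_convergence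
      (fun _ => 2 * (B + B)) ?_ ?_ (by simp) ?_
    · filter_upwards [self_mem_nhdsWithin] with ε hε
      exact (cD.inner ((h₁.continuous_tangentRate_reg hc hε).sub
        (h₂.continuous_tangentRate_reg hc hε))).aestronglyMeasurable
    · filter_upwards with ε
      refine ae_of_all _ fun x _ => ?_
      refine (norm_inner_le_norm _ _).trans ?_
      have t1 : ‖unitT p₁ x - unitT p₂ x‖ ≤ 2 := (_root_.norm_sub_le _ _).trans (by
        rw [h₁.norm_unitT hc, h₂.norm_unitT hc]; norm_num)
      gcongr
      exact (_root_.norm_sub_le _ _).trans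
        (add_le_add (h₁.norm_tangentRate_le hα0 hβ hc ε x) (h₂.norm_tangentRate_le hα0 hβ hc ε x))
    · refine ae_of_all _ fun x _ => ?_
      exact tendsto_const_nhds.inner
        ((h₁.tendsto_tangentRate hα0 hβ hc x).sub (h₂.tendsto_tangentRate hα0 hβ hc x))
  refine le_of_tendsto hlim.abs ?_
  filter_upwards [self_mem_nhdsWithin] with ε hε
  exact abs_integral_tangentRate_reg_le h₁ h₂ hα0 hα hβ hc hε

end CurveBd

/-- The projection of the line onto `[0,T]`. -/
def clampTime (T t : ℝ) : ℝ := max 0 (min t T)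

lemma clampTime_mem {T : ℝ} (hT : 0 ≤ T) (t : ℝ) : clampTime T t ∈ Icc 0 T :=
  ⟨le_max_left _ _, max_le hT (min_le_right _ _)⟩

lemma clampTime_eq {T t : ℝ} (ht : t ∈ Icc 0 T) : clampTime T t = t := by
  rw [clampTime, min_eq_left ht.2, max_eq_right ht.1]

lemma continuous_clampTime (T : ℝ) : Continuous (clampTime T) := by
  unfold clampTime; fun_prop

lemma norm_slope_sub_le {f f' : ℝ → R2} {M β : ℝ} (hβ : 0 < β) (hM : 0 ≤ M)
    (hd : ∀ x, HasDerivAt f (f' x) x)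
    (hh : ∀ x y, ‖f' x - f' y‖ ≤ M * |x - y| ^ β) (x : ℝ) {h : ℝ} (hh0 : h ≠ 0) :
    ‖h⁻¹ • (f (x + h) - f x) - f' x‖ ≤ M * |h| ^ β := by
  have hd' : ∀ y ∈ uIcc x (x + h), HasDerivWithinAt (fun y => f y - (y - x) • f' x)
      (f' y - f' x) (uIcc x (x + h)) y := fun y _ => by
    have h1 : HasDerivAt (fun y => (y - x) • f' x) (f' x) y := by
      simpa using ((hasDerivAt_id y).sub_const x).smul_const (f' x)
    exact ((hd y).sub h1).hasDerivWithinAt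
  have hb : ∀ y ∈ uIcc x (x + h), ‖f' y - f' x‖ ≤ M * |h| ^ β := fun y hy => by
    refine (hh y x).trans ?_
    have := abs_sub_left_of_mem_uIcc hy
    rw [add_sub_cancel_left] at this
    gcongr
  have h2 := (convex_uIcc x (x + h)).norm_image_sub_le_of_norm_hasDerivWithin_le hd' hb
    left_mem_uIcc right_mem_uIcc
  have e : h⁻¹ • (f (x + h) - f x) - f' x =
      h⁻¹ • (f (x + h) - (x + h - x) • f' x - (f x - (x - x) • f' x)) := by
    rw [add_sub_cancel_left, sub_self, zero_smul, sub_zero, sub_right_comm,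
      smul_sub h⁻¹ (f (x + h) - f x), smul_smul, inv_mul_cancel₀ hh0, one_smul]
  rw [add_sub_cancel_left, Real.norm_eq_abs] at h2
  rw [e, norm_smul, norm_inv, Real.norm_eq_abs, inv_mul_le_iff₀ (abs_pos.2 hh0), mul_comm |h|]
  simpa using h2

section Flow

variable {α β T : ℝ} {Ω : ℝ → Set R2} {γ : ℝ → ℝ → R2}

lemma IsFlowOf.isSimpleLoop (h : IsFlowOf α T Ω γ) {t : ℝ} (ht : t ∈ Icc 0 T) :
    IsSimpleLoop fun x => γ x t :=
  ⟨(h.1 t ht).2.1, (h.1 t ht).1, (h.1 t ht).2.2.1, (h.1 t ht).2.2.2.1⟩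

lemma IsFlowOf.hasDerivAt (h : IsFlowOf α T Ω γ) {t : ℝ} (ht : t ∈ Icc 0 T) (x : ℝ) :
    HasDerivAt (fun x => γ x t) (pderiv γ x t) x := (h.isSimpleLoop ht).hasDerivAt x

lemma IsFlowOf.continuous_time (hT : 0 ≤ T) (h : IsFlowOf α T Ω γ) (x : ℝ) :
    Continuous fun t => γ x (clampTime T t) := by
  have : ContinuousOn (fun s => γ x s) (Icc 0 T) := fun t ht => (h.2 x t ht).continuousWithinAt
  exact this.comp_continuous (continuous_clampTime T) (clampTime_mem hT)

lemma IsC1BetaFlow.continuous_uncurry (hT : 0 ≤ T) (h : IsC1BetaFlow α β T Ω γ) :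
    Continuous (uncurry fun t x => γ x (clampTime T t)) := by
  obtain ⟨hf, M, hM⟩ := h
  have hM0 : 0 ≤ M := (norm_nonneg _).trans (hM 0 ⟨le_rfl, hT⟩ 0 0).1
  have hL : ∀ t, LipschitzWith M.toNNReal fun x => γ x (clampTime T t) := fun t => by
    refine lipschitzWith_of_nnnorm_deriv_le
      (fun x => (hf.hasDerivAt (clampTime_mem hT t) x).differentiableAt) fun x => ?_
    rw [← NNReal.coe_le_coe, coe_nnnorm, Real.coe_toNNReal _ hM0]
    exact (hM _ (clampTime_mem hT t) x x).2.1
  have := continuous_prod_of_continuous_lipschitzWith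
    (fun q : ℝ × ℝ => γ q.1 (clampTime T q.2)) M.toNNReal
    (fun x => hf.continuous_time hT x) hL
  exact this.comp continuous_swap

lemma IsC1BetaFlow.continuous_uncurry_pderiv (hβ : 0 < β) (hT : 0 ≤ T)
    (h : IsC1BetaFlow α β T Ω γ) : Continuous (uncurry fun t x => pderiv γ x (clampTime T t)) := by
  have hc := h.continuous_uncurry hT
  obtain ⟨hf, M, hM⟩ := h
  have hM0 : 0 ≤ M := (norm_nonneg _).trans (hM 0 ⟨le_rfl, hT⟩ 0 0).1
  have hu : TendstoUniformly (fun (h : ℝ) (q : ℝ × ℝ) =>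
      h⁻¹ • (γ (q.2 + h) (clampTime T q.1) - γ q.2 (clampTime T q.1)))
      (uncurry fun t x => pderiv γ x (clampTime T t)) (𝓝[≠] 0) := by
    rw [Metric.tendstoUniformly_iff]
    intro ε hε
    have hlim : Tendsto (fun h : ℝ => M * |h| ^ β) (𝓝[≠] 0) (𝓝 0) := by
      have : Continuous fun h : ℝ => M * |h| ^ β :=
        continuous_const.mul (continuous_abs.rpow_const fun _ => Or.inr hβ.le)
      have h2 := this.tendsto 0
      simp only [abs_zero, zero_rpow hβ.ne', mul_zero] at h2
      exact h2.mono_left nhdsWithin_le_nhds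
    filter_upwards [hlim.eventually (gt_mem_nhds hε), self_mem_nhdsWithin] with h hlt hne q
    rw [dist_comm, dist_eq_norm]
    have ht := clampTime_mem hT q.1
    exact (norm_slope_sub_le (f := fun x => γ x (clampTime T q.1)) hβ hM0
      (fun x => hf.hasDerivAt ht x) (fun x y => (hM _ ht x y).2.2) q.2 hne).trans_lt hlt
  refine hu.continuous (Frequently.of_forall fun h => ?_)
  have h1 : Continuous fun q : ℝ × ℝ => γ (q.2 + h) (clampTime T q.1) :=
    hc.comp (continuous_fst.prodMk (continuous_snd.add continuous_const))
  have h2 : Continuous fun q : ℝ × ℝ => γ (q.2 + h) (clampTime T q.1) - γ q.2 (clampTime T q.1) :=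
    h1.sub hc
  exact h2.const_smul h⁻¹

lemma IsC1BetaFlow.exists_curveBd (hβ : 0 < β) (hT : 0 ≤ T) (h : IsC1BetaFlow α β T Ω γ) :
    ∃ M c, 0 < c ∧ ∀ t ∈ Icc 0 T, CurveBd M c β (fun x => γ x t) (fun x => pderiv γ x t) := by
  have hcp := h.continuous_uncurry_pderiv hβ hT
  obtain ⟨hf, M, hM⟩ := h
  let F : (ℝ × ℝ) × ℝ → ℝ := fun q =>
    ‖∫ θ in (0 : ℝ)..1, pderiv γ (q.1.2 + θ * q.2) (clampTime T q.1.1)‖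
  have hF : Continuous F := by
    refine (intervalIntegral.continuous_parametric_intervalIntegral_of_continuous'
      (f := fun (q : (ℝ × ℝ) × ℝ) (θ : ℝ) => pderiv γ (q.1.2 + θ * q.2) (clampTime T q.1.1))
      ?_ _ _).norm
    have : Continuous fun q : ((ℝ × ℝ) × ℝ) × ℝ => (q.1.1.1, q.1.1.2 + q.2 * q.1.2) := by fun_prop
    exact hcp.comp this
  have hpc : ∀ t ∈ Icc 0 T, Continuous fun x => pderiv γ x t := fun t ht =>
    (hf.isSimpleLoop ht).continuous_deriv
  have hpp : ∀ t ∈ Icc 0 T, Periodic (fun x => pderiv γ x t) (2 * π) := fun t ht =>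
    (hf.isSimpleLoop ht).periodic_deriv
  have hsub : ∀ t ∈ Icc 0 T, ∀ x w, ‖γ x t - γ (x + w) t‖ = |w| * F ((t, x), w) := by
    intro t ht x w
    have := sub_eq_neg_smul_integral (fun x => hf.hasDerivAt ht x) (hpc t ht) x w
    rw [this, norm_neg, norm_smul, Real.norm_eq_abs]
    simp only [F, clampTime_eq ht]
  have hpos : ∀ t ∈ Icc 0 T, ∀ x w, |w| ≤ π → 0 < F ((t, x), w) := by
    intro t ht x w hw
    rcases eq_or_ne w 0 with rfl | hw0
    · simp only [F, mul_zero, add_zero, clampTime_eq ht, intervalIntegral.integral_const, sub_zero,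
        one_smul]
      exact norm_pos_iff.2 ((hf.1 t ht).2.2.2.1 x)
    · refine lt_of_le_of_ne (norm_nonneg _) fun h0 => ?_
      have h1 := hsub t ht x w
      rw [← h0, mul_zero, norm_eq_zero, sub_eq_zero] at h1
      have h2 := (hf.isSimpleLoop ht).eq_of_abs_lt h1 (by
        rw [show x - (x + w) = -w by ring, abs_neg]; linarith [pi_pos])
      exact hw0 (by linarith)
  have hK : IsCompact ((Icc 0 T ×ˢ Icc 0 (2 * π)) ×ˢ Icc (-π) π) :=
    (isCompact_Icc.prod isCompact_Icc).prod isCompact_Icc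
  obtain ⟨⟨⟨t₀, x₀⟩, w₀⟩, hq, hmin⟩ := hK.exists_isMinOn
    ⟨((0, 0), 0), ⟨⟨le_rfl, hT⟩, ⟨le_rfl, by positivity⟩⟩, ⟨by linarith [pi_pos], pi_pos.le⟩⟩
    hF.continuousOn
  have hle : ∀ t ∈ Icc 0 T, ∀ x w, |w| ≤ π → F ((t₀, x₀), w₀) ≤ F ((t, x), w) := by
    intro t ht x w hw
    have hper : Periodic (fun x => F ((t, x), w)) (2 * π) := fun x => by
      simp only [F, clampTime_eq ht]
      congr 2
      funext θ
      rw [show x + 2 * π + θ * w = x + θ * w + 2 * π by ring]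
      exact hpp t ht _
    obtain ⟨y, hy, hxy⟩ := hper.exists_mem_Ico₀ (by positivity) x
    have e : F ((t, x), w) = F ((t, y), w) := hxy
    rw [e]
    exact hmin (show ((t, y), w) ∈ _ from ⟨⟨ht, hy.1, hy.2.le⟩, abs_le.1 hw⟩)
  refine ⟨M, F ((t₀, x₀), w₀), hpos t₀ hq.1.1 x₀ w₀ (abs_le.2 hq.2), fun t ht => ?_⟩
  exact
    { hasDerivAt := fun x => hf.hasDerivAt ht x
      periodic := (hf.1 t ht).1
      periodic_deriv := hpp t ht
      continuous_deriv := hpc t ht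
      norm_le := fun x => (hM t ht x x).2.1
      holder := fun x y => (hM t ht x y).2.2
      le_norm := fun x => by
        have := hle t ht x 0 (by rw [abs_zero]; exact pi_pos.le)
        refine this.trans (le_of_eq ?_)
        simp [F, clampTime_eq ht]
      arcChord := fun x w hw => by
        rw [hsub t ht, mul_comm]
        exact mul_le_mul_of_nonneg_left (hle t ht x w hw) (abs_nonneg w) }

end Flow

lemma CurveBd.mono {M M' c c' β : ℝ} {γ p : ℝ → R2} (h : CurveBd M c β γ p) (hM : M ≤ M')
    (hc : c' ≤ c) : CurveBd M' c' β γ p :=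
  { h with
    norm_le := fun x => (h.norm_le x).trans hM
    holder := fun x y => (h.holder x y).trans (by gcongr)
    le_norm := fun x => hc.trans (h.le_norm x)
    arcChord := fun x w hw => (by gcongr : c' * |w| ≤ c * |w|).trans (h.arcChord x w hw) }

lemma continuous_coord {X : Type*} [TopologicalSpace X] {f : X → R2} (hf : Continuous f)
    (i : Fin 2) : Continuous fun x => f x i := by fun_prop

section Flow

variable {α β T : ℝ} {Ω : ℝ → Set R2} {γ : ℝ → ℝ → R2}

lemma IsC1BetaFlow.exists_orient_eq (hβ : 0 < β) (hT : 0 ≤ T)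
    (hΩ : ∀ t ∈ Icc 0 T, IsOpen (Ω t) ∧ IsBounded (Ω t) ∧ IsConnected (Ω t))
    (h : IsC1BetaFlow α β T Ω γ) :
    ∃ σ : ℝ, (σ = 1 ∨ σ = -1) ∧ ∀ t ∈ Icc 0 T,
      orient (Ω t) (fun x => γ x t) = σ ∧ 0 < σ * signedArea fun x => γ x t := by
  have hsign : ∀ t ∈ Icc 0 T,
      (orient (Ω t) (fun x => γ x t) = 1 ∧ 0 < signedArea fun x => γ x t) ∨
      (orient (Ω t) (fun x => γ x t) = -1 ∧ (signedArea fun x => γ x t) < 0) := fun t ht =>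
    (h.1.isSimpleLoop ht).orient_eq_one_or (h.1.1 t ht).2.2.2.2.symm (hΩ t ht).1 (hΩ t ht).2.1
      (hΩ t ht).2.2.nonempty
  have hA : Continuous fun t => signedArea fun x => γ x (clampTime T t) := by
    have h0 : Continuous fun q : ℝ × ℝ => γ q.2 (clampTime T q.1) := h.continuous_uncurry hT
    have h1 : Continuous fun q : ℝ × ℝ => pderiv γ q.2 (clampTime T q.1) :=
      h.continuous_uncurry_pderiv hβ hT
    have h2 : Continuous fun q : ℝ × ℝ => γ q.2 (clampTime T q.1) 0 *
        pderiv γ q.2 (clampTime T q.1) 1 := (continuous_coord h0 0).mul (continuous_coord h1 1)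
    exact intervalIntegral.continuous_parametric_intervalIntegral_of_continuous'
      (f := fun t x => γ x (clampTime T t) 0 * pderiv γ x (clampTime T t) 1) h2 0 (2 * π)
  have hne : ∀ t, (signedArea fun x => γ x (clampTime T t)) ≠ 0 := fun t => by
    rcases hsign _ (clampTime_mem hT t) with h | h
    · exact h.2.ne'
    · exact h.2.ne
  have h0 : (0 : ℝ) ∈ Icc 0 T := ⟨le_rfl, hT⟩
  rcases hsign 0 h0 with h1 | h1
  · refine ⟨1, Or.inl rfl, fun t ht => ?_⟩
    rcases hsign t ht with h2 | h2
    · exact ⟨h2.1, by simpa using h2.2⟩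
    · obtain ⟨s, hs⟩ := mem_range_of_exists_le_of_exists_ge hA (c := 0)
        ⟨t, by rw [clampTime_eq ht]; exact h2.2.le⟩ ⟨0, by rw [clampTime_eq h0]; exact h1.2.le⟩
      exact absurd hs (hne s)
  · refine ⟨-1, Or.inr rfl, fun t ht => ?_⟩
    rcases hsign t ht with h2 | h2
    · obtain ⟨s, hs⟩ := mem_range_of_exists_le_of_exists_ge hA (c := 0)
        ⟨0, by rw [clampTime_eq h0]; exact h1.2.le⟩ ⟨t, by rw [clampTime_eq ht]; exact h2.2.le⟩
      exact absurd hs (hne s)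
    · exact ⟨h2.1, by linarith [h2.2]⟩

/-- A family of curves, continuous in time, whose derivative in space evolves by the boundary
form of the velocity gradient with orientation `σ`. -/
structure CurveFamily (α β M c σ T : ℝ) (G P : ℝ → ℝ → R2) : Prop where
  curveBd : ∀ t, CurveBd M c β (G t) (P t)
  continuous_curve : Continuous (uncurry G)
  continuous_tangent : Continuous (uncurry P)
  evolution : ∀ t ∈ Icc 0 T, ∀ x, P t x = P 0 x + ∫ s in (0 : ℝ)..t, -σ • bdryW α 0 (G s) (P s) x
  signedArea_pos : ∀ t ∈ Icc 0 T, 0 < σ * signedArea (G t)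

lemma eq_integral_of_sub_eq {f g : ℝ → R2} {V : ℝ → ℝ → R2} {f' g' : ℝ → R2} {t : ℝ}
    (hV : Continuous (uncurry V)) (hf : ∀ x, HasDerivAt f (f' x) x)
    (hg : ∀ x, HasDerivAt g (g' x) x)
    (h : ∀ x y, (f y - f x) - (g y - g x) = ∫ s in (0 : ℝ)..t, ∫ z in x..y, V s z) (x : ℝ) :
    f' x = g' x + ∫ s in (0 : ℝ)..t, V s x := by
  have hV' : Continuous fun q : ℝ × ℝ => V q.2 q.1 := hV.comp continuous_swap
  have hI : Continuous fun z => ∫ s in (0 : ℝ)..t, V s z :=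
    intervalIntegral.continuous_parametric_intervalIntegral_of_continuous'
      (f := fun z s => V s z) hV' _ _
  have h1 : ∀ y, (f y - f x) - (g y - g x) = ∫ z in x..y, ∫ s in (0 : ℝ)..t, V s z := fun y => by
    rw [h x y]
    refine intervalIntegral_intervalIntegral_swap ?_
    exact (hV.continuousOn.integrableOn_compact (isCompact_uIcc.prod isCompact_uIcc)).mono_set
      (prod_mono uIoc_subset_uIcc uIoc_subset_uIcc)
  have h2 : HasDerivAt (fun y => (f y - f x) - (g y - g x)) (f' x - g' x) x :=
    ((hf x).sub_const _).sub ((hg x).sub_const _)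
  have h3 : HasDerivAt (fun y => ∫ z in x..y, ∫ s in (0 : ℝ)..t, V s z)
      (∫ s in (0 : ℝ)..t, V s x) x :=
    intervalIntegral.integral_hasDerivAt_right (hI.intervalIntegrable _ _)
      (hI.stronglyMeasurableAtFilter _ _)
      hI.continuousAt
  rw [← funext h1] at h3
  rw [← h2.unique h3]
  abel

lemma IsC1BetaFlow.exists_curveFamily (hα0 : 0 < α) (hα : α < 1 / 2) (hβ : 2 * α < β) (hT : 0 ≤ T)
    (hΩ : ∀ t ∈ Icc 0 T, IsOpen (Ω t) ∧ IsBounded (Ω t) ∧ IsConnected (Ω t))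
    (h : IsC1BetaFlow α β T Ω γ) :
    ∃ M c σ, 0 < c ∧ (σ = 1 ∨ σ = -1) ∧ CurveFamily α β M c σ T
      (fun t x => γ x (clampTime T t)) (fun t x => pderiv γ x (clampTime T t)) := by
  have hβ0 : 0 < β := by linarith
  obtain ⟨M, c, hc, hC⟩ := h.exists_curveBd hβ0 hT
  obtain ⟨σ, hσ, hor⟩ := h.exists_orient_eq hβ0 hT hΩ
  have hG := h.continuous_uncurry hT
  have hP := h.continuous_uncurry_pderiv hβ0 hT
  have hC' : ∀ t, CurveBd M c β (fun x => γ x (clampTime T t))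
      (fun x => pderiv γ x (clampTime T t)) := fun t => hC _ (clampTime_mem hT t)
  refine ⟨M, c, σ, hc, hσ, hC', hG, hP, fun t ht => ?_, fun t ht => ?_⟩
  swap
  · simp only [clampTime_eq ht]
    exact (hor t ht).2
  have h0 : (0 : ℝ) ∈ Icc 0 T := ⟨le_rfl, hT⟩
  have hW : Continuous fun q : ℝ × ℝ => bdryW α 0 (fun x => γ x (clampTime T q.1))
      (fun x => pderiv γ x (clampTime T q.1)) q.2 := by
    refine CurveBd.continuous_bdryW (X := ℝ × ℝ) (γ := fun q x => γ x (clampTime T q.1))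
      (p := fun q x => pderiv γ x (clampTime T q.1)) ?_ ?_ continuous_snd (fun q => hC' q.1)
      hα0 hβ hc
    · have : Continuous fun q : (ℝ × ℝ) × ℝ => (q.1.1, q.2) := by fun_prop
      exact hG.comp this
    · have : Continuous fun q : (ℝ × ℝ) × ℝ => (q.1.1, q.2) := by fun_prop
      exact hP.comp this
  have hV : Continuous (uncurry fun s x => -σ • bdryW α 0 (fun x => γ x (clampTime T s))
      (fun x => pderiv γ x (clampTime T s)) x) := hW.const_smul (-σ)
  refine eq_integral_of_sub_eq hV (hC' t).hasDerivAt (hC' 0).hasDerivAt fun x y => ?_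
  simp only [clampTime_eq ht, clampTime_eq h0]
  have hvel : ∀ s ∈ Icc 0 T, sqgVelocity α (Ω s) (γ y s) - sqgVelocity α (Ω s) (γ x s) =
      ∫ z in x..y, -σ • bdryW α 0 (fun x => γ x (clampTime T s))
        (fun x => pderiv γ x (clampTime T s)) z := fun s hs => by
    have := (h.1.isSimpleLoop hs).velocity_sub (h.1.1 s hs).2.2.2.2.symm (hΩ s hs).1 (hΩ s hs).2.1
      hα0 hα hβ hc (hC s hs) x y
    rw [(hor s hs).1] at this
    simp only [clampTime_eq hs]
    exact this
  have hd : ∀ s ∈ Icc 0 T, HasDerivWithinAt (fun s => γ y s - γ x s)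
      (∫ z in x..y, -σ • bdryW α 0 (fun x => γ x (clampTime T s))
        (fun x => pderiv γ x (clampTime T s)) z) (Icc 0 T) s := fun s hs => by
    rw [← hvel s hs]
    exact (h.1.2 y s hs).sub (h.1.2 x s hs)
  have hI : Continuous fun s => ∫ z in x..y, -σ • bdryW α 0 (fun x => γ x (clampTime T s))
      (fun x => pderiv γ x (clampTime T s)) z :=
    intervalIntegral.continuous_parametric_intervalIntegral_of_continuous' hV _ _
  have hsub : Icc 0 t ⊆ Icc 0 T := Icc_subset_Icc_right ht.2
  have := intervalIntegral.integral_eq_sub_of_hasDerivAt_of_le ht.1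
    (fun s hs => ((hd s (hsub hs)).continuousWithinAt).mono hsub)
    (fun s hs => (hd s (hsub (Ioo_subset_Icc_self hs))).hasDerivAt
      (Icc_mem_nhds hs.1 (hs.2.trans_le ht.2))) (hI.intervalIntegrable _ _)
  rw [this]

end Flow

lemma hasDerivAt_normalize {f : ℝ → R2} {f' : R2} {t : ℝ} (hf : HasDerivAt f f' t)
    (h0 : f t ≠ 0) : HasDerivAt (fun s => ‖f s‖⁻¹ • f s)
      (‖f t‖⁻¹ • (f' - ⟪f', ‖f t‖⁻¹ • f t⟫ • (‖f t‖⁻¹ • f t))) t := by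
  have hn : 0 < ‖f t‖ := norm_pos_iff.2 h0
  have h1 : HasDerivAt (fun s => ‖f s‖) (⟪f t, f'⟫ / ‖f t‖) t := by
    have h2 := (hf.norm_sq).sqrt (by positivity)
    simp only [sqrt_sq (norm_nonneg _)] at h2
    convert h2 using 1
    field_simp
  refine ((h1.fun_inv hn.ne').smul hf).congr_deriv ?_
  rw [inner_smul_right, real_inner_comm, smul_sub, smul_smul, smul_smul, sub_eq_add_neg, ← neg_smul]
  congr 2
  field_simp

lemma integral_norm_sq_eq {D R : ℝ → ℝ → R2} {T : ℝ} (hD : Continuous (uncurry D))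
    (hR : Continuous (uncurry R))
    (h : ∀ t ∈ Ioo 0 T, ∀ x, HasDerivAt (fun s => D s x) (R t x) t) (a b : ℝ) {t : ℝ}
    (ht : t ∈ Icc 0 T) :
    ∫ x in a..b, ‖D t x‖ ^ 2 = (∫ x in a..b, ‖D 0 x‖ ^ 2) +
      ∫ s in (0 : ℝ)..t, ∫ x in a..b, 2 * ⟪D s x, R s x⟫ := by
  have hI : Continuous (uncurry fun s x => 2 * ⟪D s x, R s x⟫) :=
    continuous_const.mul (hD.inner (𝕜 := ℝ) hR)
  have hDx : ∀ x, Continuous fun s => D s x := fun x => hD.comp (continuous_id.prodMk continuous_const)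
  have hDt : ∀ s, Continuous fun x => ‖D s x‖ ^ 2 := fun s =>
    ((hD.comp (continuous_const.prodMk continuous_id) : Continuous fun x => D s x).norm).pow 2
  have hIx : ∀ x, Continuous fun s => 2 * ⟪D s x, R s x⟫ := fun x =>
    hI.comp (continuous_id.prodMk continuous_const)
  have h1 : ∀ x, ∫ s in (0 : ℝ)..t, 2 * ⟪D s x, R s x⟫ = ‖D t x‖ ^ 2 - ‖D 0 x‖ ^ 2 := fun x =>
    intervalIntegral.integral_eq_sub_of_hasDerivAt_of_le ht.1
      ((hDx x).norm.pow 2).continuousOn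
      (fun s hs => (h s ⟨hs.1, hs.2.trans_le ht.2⟩ x).norm_sq) ((hIx x).intervalIntegrable _ _)
  rw [intervalIntegral_intervalIntegral_swap
    ((hI.continuousOn.integrableOn_compact (isCompact_uIcc.prod isCompact_uIcc)).mono_set
      (prod_mono uIoc_subset_uIcc uIoc_subset_uIcc)), intervalIntegral.integral_congr fun x _ => h1 x,
    intervalIntegral.integral_sub ((hDt t).intervalIntegrable _ _) ((hDt 0).intervalIntegrable _ _)]
  ring

namespace CurveFamily

variable {α β M c σ T : ℝ} {G P : ℝ → ℝ → R2}

lemma mono {M' c' : ℝ} (h : CurveFamily α β M c σ T G P) (hM : M ≤ M') (hc : c' ≤ c) :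
    CurveFamily α β M' c' σ T G P :=
  { h with curveBd := fun t => (h.curveBd t).mono hM hc }

lemma continuous_bdryW (h : CurveFamily α β M c σ T G P) (hα : 0 < α) (hβ : 2 * α < β)
    (hc : 0 < c) : Continuous (uncurry fun t x => bdryW α 0 (G t) (P t) x) := by
  have e : Continuous fun q : (ℝ × ℝ) × ℝ => (q.1.1, q.2) := by fun_prop
  exact CurveBd.continuous_bdryW (X := ℝ × ℝ) (γ := fun q x => G q.1 x)
    (p := fun q x => P q.1 x) (h.continuous_curve.comp e) (h.continuous_tangent.comp e)
    continuous_snd (fun q => h.curveBd q.1) hα hβ hc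

lemma continuous_inv_norm (h : CurveFamily α β M c σ T G P) (hc : 0 < c) :
    Continuous fun q : ℝ × ℝ => ‖P q.1 q.2‖⁻¹ := by
  have h1 : Continuous fun q : ℝ × ℝ => P q.1 q.2 := h.continuous_tangent
  exact h1.norm.inv₀ fun q => ((h.curveBd q.1).norm_pos hc q.2).ne'

lemma continuous_unitT (h : CurveFamily α β M c σ T G P) (hc : 0 < c) :
    Continuous (uncurry fun t x => unitT (P t) x) :=
  (h.continuous_inv_norm hc).smul h.continuous_tangent

lemma continuous_tangentRate (h : CurveFamily α β M c σ T G P) (hα : 0 < α) (hβ : 2 * α < β)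
    (hc : 0 < c) : Continuous (uncurry fun t x => tangentRate α 0 (G t) (P t) x) := by
  have hW := h.continuous_bdryW hα hβ hc
  have hU := h.continuous_unitT hc
  have h1 : Continuous fun q : ℝ × ℝ => ⟪bdryW α 0 (G q.1) (P q.1) q.2, unitT (P q.1) q.2⟫ :=
    hW.inner (𝕜 := ℝ) hU
  exact (h.continuous_inv_norm hc).smul (hW.sub (h1.smul hU))

lemma hasDerivAt_unitT (h : CurveFamily α β M c σ T G P) (hα : 0 < α) (hβ : 2 * α < β)
    (hc : 0 < c) {t : ℝ} (ht : t ∈ Ioo 0 T) (x : ℝ) :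
    HasDerivAt (fun s => unitT (P s) x) (-σ • tangentRate α 0 (G t) (P t) x) t := by
  have hW : Continuous fun s => -σ • bdryW α 0 (G s) (P s) x :=
    ((h.continuous_bdryW hα hβ hc).comp
      (continuous_id.prodMk continuous_const : Continuous fun s : ℝ => (s, x))).const_smul (-σ)
  have h1 : HasDerivAt (fun s => P 0 x + ∫ s in (0 : ℝ)..s, -σ • bdryW α 0 (G s) (P s) x)
      (-σ • bdryW α 0 (G t) (P t) x) t :=
    (intervalIntegral.integral_hasDerivAt_right (hW.intervalIntegrable _ _)
      (hW.stronglyMeasurableAtFilter _ _) hW.continuousAt).const_add _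
  have h2 : HasDerivAt (fun s => P s x) (-σ • bdryW α 0 (G t) (P t) x) t := by
    refine h1.congr_of_eventuallyEq ?_
    filter_upwards [Icc_mem_nhds ht.1 ht.2] with s hs using h.evolution s hs x
  refine (hasDerivAt_normalize h2 (norm_pos_iff.1 ((h.curveBd t).norm_pos hc x))).congr_deriv ?_
  rw [tangentRate, unitT, inner_smul_left, smul_comm (-σ), smul_sub (-σ), smul_smul (-σ)]
  rfl

end CurveFamily

lemma signedArea_congr_of_deriv_eq {γ₁ γ₂ p : ℝ → R2} (h₁ : ∀ x, HasDerivAt γ₁ (p x) x)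
    (h₂ : ∀ x, HasDerivAt γ₂ (p x) x) (hp : Continuous p) (hper : Periodic γ₂ (2 * π)) :
    signedArea γ₁ = signedArea γ₂ := by
  have e₁ : deriv γ₁ = p := funext fun x => (h₁ x).deriv
  have e₂ : deriv γ₂ = p := funext fun x => (h₂ x).deriv
  have hp1 := continuous_coord hp 1
  have hγ0 := continuous_coord
    (continuous_iff_continuousAt.2 fun x => (h₂ x).continuousAt : Continuous γ₂) 0
  have hcst : ∀ x, γ₁ x = γ₂ x + (γ₁ 0 - γ₂ 0) := fun x => by
    have : γ₁ x - γ₂ x = γ₁ 0 - γ₂ 0 := is_const_of_deriv_eq_zero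
      (fun x => ((h₁ x).sub (h₂ x)).differentiableAt)
      (fun x => by simpa using ((h₁ x).sub (h₂ x)).deriv) x 0
    rw [← this]; abel
  have hint : ∫ s in (0 : ℝ)..(2 * π), p s 1 = 0 := by
    have : ∀ s, HasDerivAt (fun s => γ₂ s 1) (p s 1) s := fun s =>
      ((EuclideanSpace.proj 1 : R2 →L[ℝ] ℝ).hasFDerivAt.comp_hasDerivAt s (h₂ s) :)
    rw [intervalIntegral.integral_eq_sub_of_hasDerivAt (fun s _ => this s)
      (hp1.intervalIntegrable _ _), sub_eq_zero]
    simpa using congrArg (fun v : R2 => v 1) (hper 0)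
  have i₁ : Continuous fun s => γ₂ s 0 * p s 1 := hγ0.mul hp1
  have i₂ : Continuous fun s => (γ₁ 0 - γ₂ 0) 0 * p s 1 := continuous_const.mul hp1
  unfold signedArea
  rw [e₁, e₂, intervalIntegral.integral_congr (g := fun s => γ₂ s 0 * p s 1 +
    (γ₁ 0 - γ₂ 0) 0 * p s 1) (fun s _ => by
      simp only
      rw [hcst s, PiLp.add_apply, add_mul]),
    intervalIntegral.integral_add (i₁.intervalIntegrable _ _) (i₂.intervalIntegrable _ _),
    intervalIntegral.integral_const_mul, hint, mul_zero, add_zero]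

namespace CurveFamily

variable {α β M c σ σ₁ σ₂ T : ℝ} {G P G₁ P₁ G₂ P₂ : ℝ → ℝ → R2}

lemma continuous_tangentDist (h₁ : CurveFamily α β M c σ₁ T G₁ P₁)
    (h₂ : CurveFamily α β M c σ₂ T G₂ P₂) (hc : 0 < c) :
    Continuous (uncurry fun t x => CurveBd.tangentDist (P₁ t) (P₂ t) x) := by
  have u : Continuous fun q : ℝ × ℝ => unitT (P₁ q.1) q.2 - unitT (P₂ q.1) q.2 :=
    (h₁.continuous_unitT hc).sub (h₂.continuous_unitT hc)
  have p₁ : Continuous fun q : ℝ × ℝ => P₁ q.1 q.2 := h₁.continuous_tangent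
  have p₂ : Continuous fun q : ℝ × ℝ => P₂ q.1 q.2 := h₂.continuous_tangent
  exact (u.norm.pow 2).add ((p₁.norm.sub p₂.norm).pow 2)

lemma continuous_integral_tangentDist (h₁ : CurveFamily α β M c σ₁ T G₁ P₁)
    (h₂ : CurveFamily α β M c σ₂ T G₂ P₂) (hc : 0 < c) :
    Continuous fun t => ∫ x in (0 : ℝ)..(2 * π), CurveBd.tangentDist (P₁ t) (P₂ t) x :=
  intervalIntegral.continuous_parametric_intervalIntegral_of_continuous'
    (h₁.continuous_tangentDist h₂ hc) _ _

lemma integral_tangentDist_pos (h₁ : CurveFamily α β M c σ₁ T G₁ P₁)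
    (h₂ : CurveFamily α β M c (-σ₁) T G₂ P₂) (hc : 0 < c) {t : ℝ} (ht : t ∈ Icc 0 T) :
    0 < ∫ x in (0 : ℝ)..(2 * π), CurveBd.tangentDist (P₁ t) (P₂ t) x := by
  have hC₁ := h₁.curveBd t
  have hC₂ := h₂.curveBd t
  refine intervalIntegral.integral_pos (by positivity)
    (hC₁.continuous_tangentDist hC₂ hc).continuousOn
    (fun x _ => CurveBd.tangentDist_nonneg _ _ x) ?_
  by_contra! hle
  have h0 : ∀ x, CurveBd.tangentDist (P₁ t) (P₂ t) x = 0 := fun x => by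
    obtain ⟨y, hy, hxy⟩ := (hC₁.periodic_tangentDist hC₂).exists_mem_Ico₀ (by positivity) x
    rw [hxy]
    exact le_antisymm (hle y (Ico_subset_Icc_self hy)) (CurveBd.tangentDist_nonneg _ _ y)
  have hP : P₁ t = P₂ t := funext fun x => by
    have hx := h0 x
    unfold CurveBd.tangentDist at hx
    obtain ⟨e1, e2⟩ := (add_eq_zero_iff_of_nonneg (sq_nonneg _) (sq_nonneg _)).1 hx
    rw [sq_eq_zero_iff, norm_eq_zero, sub_eq_zero] at e1
    rw [sq_eq_zero_iff, sub_eq_zero] at e2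
    rw [← hC₁.norm_smul_unitT hc x, ← hC₂.norm_smul_unitT hc x, e1, e2]
  have hA := signedArea_congr_of_deriv_eq hC₁.hasDerivAt (hP ▸ hC₂.hasDerivAt)
    hC₁.continuous_deriv hC₂.periodic
  have p₁ := h₁.signedArea_pos t ht
  have p₂ := h₂.signedArea_pos t ht
  rw [← hA] at p₂
  linarith

lemma exists_integral_inner_le (h₁ : CurveFamily α β M c σ₁ T G₁ P₁)
    (h₂ : CurveFamily α β M c σ₂ T G₂ P₂) (hα0 : 0 < α) (hα : α < 1 / 2) (hβ : 2 * α < β)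
    (hc : 0 < c) (hT : 0 ≤ T) (hσ₁ : σ₁ = 1 ∨ σ₁ = -1) (hσ₂ : σ₂ = 1 ∨ σ₂ = -1) :
    ∃ K : ℝ, 0 < K ∧ ∀ t ∈ Icc 0 T, ∫ x in (0 : ℝ)..(2 * π), 2 * ⟪unitT (P₁ t) x - unitT (P₂ t) x,
        -σ₁ • tangentRate α 0 (G₁ t) (P₁ t) x - -σ₂ • tangentRate α 0 (G₂ t) (P₂ t) x⟫ ≤
      K * ∫ x in (0 : ℝ)..(2 * π), CurveBd.tangentDist (P₁ t) (P₂ t) x := by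
  have hE0 : ∀ t, 0 ≤ ∫ x in (0 : ℝ)..(2 * π), CurveBd.tangentDist (P₁ t) (P₂ t) x := fun t =>
    intervalIntegral.integral_nonneg (by positivity) fun x _ => CurveBd.tangentDist_nonneg _ _ x
  have habs : |σ₁| = 1 ∧ |σ₂| = 1 := by
    constructor
    · rcases hσ₁ with rfl | rfl <;> simp
    · rcases hσ₂ with rfl | rfl <;> simp
  have hcase : σ₂ = σ₁ ∨ σ₂ = -σ₁ := by
    rcases hσ₁ with rfl | rfl <;> rcases hσ₂ with rfl | rfl <;> simp
  rcases hcase with rfl | rfl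
  · have hs := CurveBd.stabilityConst_nonneg (α := α) (β := β) (h₁.curveBd 0).nonneg hc
    refine ⟨2 * CurveBd.stabilityConst α β M c + 1, by positivity, fun t _ => ?_⟩
    have e : ∀ x, 2 * ⟪unitT (P₁ t) x - unitT (P₂ t) x,
        -σ₂ • tangentRate α 0 (G₁ t) (P₁ t) x - -σ₂ • tangentRate α 0 (G₂ t) (P₂ t) x⟫ =
        (-2 * σ₂) * ⟪unitT (P₁ t) x - unitT (P₂ t) x,
          tangentRate α 0 (G₁ t) (P₁ t) x - tangentRate α 0 (G₂ t) (P₂ t) x⟫ := fun x => by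
      rw [← smul_sub, real_inner_smul_right]; ring
    rw [intervalIntegral.integral_congr fun x _ => e x, intervalIntegral.integral_const_mul]
    refine (le_abs_self _).trans ?_
    have hb := (h₁.curveBd t).abs_integral_tangentRate_le (h₂.curveBd t) hα0 hα hβ hc
    rw [abs_mul, abs_mul, habs.1, abs_neg, abs_two, mul_one]
    linarith [hE0 t]
  · obtain ⟨t₀, ht₀, hmin⟩ := isCompact_Icc.exists_isMinOn (nonempty_Icc.2 hT)
      (h₁.continuous_integral_tangentDist h₂ hc).continuousOn
    have hm := h₁.integral_tangentDist_pos h₂ hc ht₀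
    set m := ∫ x in (0 : ℝ)..(2 * π), CurveBd.tangentDist (P₁ t₀) (P₂ t₀) x
    set B := c⁻¹ * (2 * ∫ w in (-π)..π, M * M * c ^ (-(1 + 2 * α)) * |w| ^ (β - 1 - 2 * α))
    have hB : 0 ≤ B := (norm_nonneg _).trans ((h₁.curveBd 0).norm_tangentRate_le hα0 hβ hc 0 0)
    refine ⟨(8 * B * (2 * π) + 1) / m, by positivity, fun t ht => ?_⟩
    have hpt : ∀ x, ‖2 * ⟪unitT (P₁ t) x - unitT (P₂ t) x,
        -σ₁ • tangentRate α 0 (G₁ t) (P₁ t) x - -(-σ₁) • tangentRate α 0 (G₂ t) (P₂ t) x⟫‖ ≤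
        8 * B := fun x => by
      have b₁ := (h₁.curveBd t).norm_tangentRate_le hα0 hβ hc 0 x
      have b₂ := (h₂.curveBd t).norm_tangentRate_le hα0 hβ hc 0 x
      have u : ‖unitT (P₁ t) x - unitT (P₂ t) x‖ ≤ 2 := by
        refine (norm_sub_le _ _).trans ?_
        rw [(h₁.curveBd t).norm_unitT hc, (h₂.curveBd t).norm_unitT hc]; norm_num
      have r : ‖-σ₁ • tangentRate α 0 (G₁ t) (P₁ t) x -
          -(-σ₁) • tangentRate α 0 (G₂ t) (P₂ t) x‖ ≤ B + B := by
        refine (norm_sub_le _ _).trans ?_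
        rw [norm_smul, norm_smul, norm_neg, norm_neg, norm_neg, Real.norm_eq_abs, habs.1, one_mul,
          one_mul]
        exact add_le_add b₁ b₂
      rw [norm_mul, Real.norm_two]
      calc _ ≤ 2 * (2 * (B + B)) := by
            gcongr
            exact (norm_inner_le_norm _ _).trans (by gcongr)
        _ = _ := by ring
    have hI := intervalIntegral.norm_integral_le_of_norm_le_const (a := 0) (b := 2 * π)
      fun x _ => hpt x
    rw [sub_zero, abs_of_pos (by positivity)] at hI
    refine ((le_abs_self _).trans hI).trans ?_
    rw [div_mul_eq_mul_div, le_div_iff₀ hm]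
    have : m ≤ ∫ x in (0 : ℝ)..(2 * π), CurveBd.tangentDist (P₁ t) (P₂ t) x := hmin ht
    have h8 : 0 ≤ 8 * B * (2 * π) := by positivity
    nlinarith

lemma integral_norm_unitT_sub_sq_le (h₁ : CurveFamily α β M c σ₁ T G₁ P₁)
    (h₂ : CurveFamily α β M c σ₂ T G₂ P₂) (hα0 : 0 < α) (hα : α < 1 / 2) (hβ : 2 * α < β)
    (hc : 0 < c) (hT : 0 ≤ T) (hσ₁ : σ₁ = 1 ∨ σ₁ = -1) (hσ₂ : σ₂ = 1 ∨ σ₂ = -1) :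
    ∃ K : ℝ, 0 < K ∧ ∀ t ∈ Icc 0 T,
      ∫ x in (0 : ℝ)..(2 * π), ‖unitT (P₁ t) x - unitT (P₂ t) x‖ ^ 2 ≤
        (∫ x in (0 : ℝ)..(2 * π), ‖unitT (P₁ 0) x - unitT (P₂ 0) x‖ ^ 2) +
        K * ∫ s in (0 : ℝ)..t, ∫ x in (0 : ℝ)..(2 * π), CurveBd.tangentDist (P₁ s) (P₂ s) x := by
  obtain ⟨K, hK, hle⟩ := h₁.exists_integral_inner_le h₂ hα0 hα hβ hc hT hσ₁ hσ₂
  refine ⟨K, hK, fun t ht => ?_⟩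
  have hD : Continuous (uncurry fun t x => unitT (P₁ t) x - unitT (P₂ t) x) :=
    (h₁.continuous_unitT hc).sub (h₂.continuous_unitT hc)
  have hR : Continuous (uncurry fun t x => -σ₁ • tangentRate α 0 (G₁ t) (P₁ t) x -
      -σ₂ • tangentRate α 0 (G₂ t) (P₂ t) x) :=
    ((h₁.continuous_tangentRate hα0 hβ hc).const_smul (-σ₁)).sub
      ((h₂.continuous_tangentRate hα0 hβ hc).const_smul (-σ₂))
  rw [integral_norm_sq_eq hD hR (fun s hs x => (h₁.hasDerivAt_unitT hα0 hβ hc hs x).sub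
    (h₂.hasDerivAt_unitT hα0 hβ hc hs x)) 0 (2 * π) ht, ← intervalIntegral.integral_const_mul]
  have hI : Continuous fun s => ∫ x in (0 : ℝ)..(2 * π), 2 * ⟪unitT (P₁ s) x - unitT (P₂ s) x,
      -σ₁ • tangentRate α 0 (G₁ s) (P₁ s) x - -σ₂ • tangentRate α 0 (G₂ s) (P₂ s) x⟫ := by
    have : Continuous (uncurry fun s x => 2 * ⟪unitT (P₁ s) x - unitT (P₂ s) x,
      -σ₁ • tangentRate α 0 (G₁ s) (P₁ s) x - -σ₂ • tangentRate α 0 (G₂ s) (P₂ s) x⟫) :=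
      continuous_const.mul (hD.inner (𝕜 := ℝ) hR)
    exact intervalIntegral.continuous_parametric_intervalIntegral_of_continuous' this _ _
  gcongr
  exact intervalIntegral.integral_mono_on ht.1 (hI.intervalIntegrable _ _)
    (((h₁.continuous_integral_tangentDist h₂ hc).const_mul K).intervalIntegrable _ _)
    fun s hs => hle s ⟨hs.1, hs.2.trans ht.2⟩

end CurveFamily

/-- **Proposition 5.2 (stability of the tangent evolution)**: for `0 < α < 1/2` and
`β > 2α`, if `γ₁, γ₂` are `C^{1,β}` flows of two `C^{1,β}` patch solutions of α-SQG,
then `|T₁(t)-T₂(t)|²_{L²} ≤ |T₁(0)-T₂(0)|²_{L²} + C ∫₀ᵗ (|T₁-T₂|²_{L²} + |g₁-g₂|²_{L²}) dτ`. -/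
theorem tangent_stability (α β T : ℝ) (hα0 : 0 < α) (hα : α < 1/2)
    (hβ : 2 * α < β) (hT : 0 ≤ T)
    (Ω₁ Ω₂ : ℝ → Set R2) (γ₁ γ₂ : ℝ → ℝ → R2)
    (hΩ₁ : IsC1BetaPatchSol α T β Ω₁) (hΩ₂ : IsC1BetaPatchSol α T β Ω₂)
    (hγ₁ : IsC1BetaFlow α β T Ω₁ γ₁) (hγ₂ : IsC1BetaFlow α β T Ω₂ γ₂) :
    ∃ C > (0:ℝ), ∀ t ∈ Icc (0:ℝ) T,
      L2sq (fun x => tangentOf γ₁ x t - tangentOf γ₂ x t) ≤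
        L2sq (fun x => tangentOf γ₁ x 0 - tangentOf γ₂ x 0) +
        C * ∫ τ in (0:ℝ)..t,
          (L2sq (fun x => tangentOf γ₁ x τ - tangentOf γ₂ x τ) +
            L2sq (fun x => metricOf γ₁ x τ - metricOf γ₂ x τ)) := by
  obtain ⟨M₁, c₁, σ₁, hc₁, hσ₁, hF₁⟩ := hγ₁.exists_curveFamily hα0 hα hβ hT hΩ₁.1.1
  obtain ⟨M₂, c₂, σ₂, hc₂, hσ₂, hF₂⟩ := hγ₂.exists_curveFamily hα0 hα hβ hT hΩ₂.1.1
  have hc : 0 < min c₁ c₂ := lt_min hc₁ hc₂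
  have h₁ := hF₁.mono (le_max_left M₁ M₂) (min_le_left c₁ c₂)
  have h₂ := hF₂.mono (le_max_right M₁ M₂) (min_le_right c₁ c₂)
  obtain ⟨K, hK, hle⟩ := h₁.integral_norm_unitT_sub_sq_le h₂ hα0 hα hβ hc hT hσ₁ hσ₂
  have hL : ∀ t ∈ Icc 0 T, L2sq (fun x => tangentOf γ₁ x t - tangentOf γ₂ x t) =
      ∫ x in (0 : ℝ)..(2 * π), ‖unitT (fun x => pderiv γ₁ x (clampTime T t)) x -
        unitT (fun x => pderiv γ₂ x (clampTime T t)) x‖ ^ 2 := fun t ht => by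
    rw [clampTime_eq ht, intervalIntegral.integral_of_le (by positivity)]
    rfl
  have hS : ∀ t ∈ Icc 0 T, L2sq (fun x => tangentOf γ₁ x t - tangentOf γ₂ x t) +
      L2sq (fun x => metricOf γ₁ x t - metricOf γ₂ x t) =
      ∫ x in (0 : ℝ)..(2 * π), CurveBd.tangentDist (fun x => pderiv γ₁ x (clampTime T t))
        (fun x => pderiv γ₂ x (clampTime T t)) x := fun t ht => by
    have u : Continuous fun x => ‖unitT (fun x => pderiv γ₁ x (clampTime T t)) x -
        unitT (fun x => pderiv γ₂ x (clampTime T t)) x‖ ^ 2 :=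
      (((h₁.curveBd t).continuous_unitT hc).sub ((h₂.curveBd t).continuous_unitT hc)).norm.pow 2
    have g : Continuous fun x => (‖pderiv γ₁ x (clampTime T t)‖ -
        ‖pderiv γ₂ x (clampTime T t)‖) ^ 2 :=
      ((h₁.curveBd t).continuous_deriv.norm.sub (h₂.curveBd t).continuous_deriv.norm).pow 2
    have e : L2sq (fun x => metricOf γ₁ x t - metricOf γ₂ x t) =
        ∫ x in (0 : ℝ)..(2 * π), (‖pderiv γ₁ x (clampTime T t)‖ -
          ‖pderiv γ₂ x (clampTime T t)‖) ^ 2 := by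
      rw [clampTime_eq ht, intervalIntegral.integral_of_le (by positivity)]
      simp only [L2sq, metricOf, Real.norm_eq_abs, sq_abs]
    rw [hL t ht, e, ← intervalIntegral.integral_add (u.intervalIntegrable _ _)
      (g.intervalIntegrable _ _)]
    rfl
  refine ⟨K, hK, fun t ht => ?_⟩
  have h := hle t ht
  rwa [← hL t ht, ← hL 0 ⟨le_rfl, hT⟩, intervalIntegral.integral_congr (g := fun τ =>
    L2sq (fun x => tangentOf γ₁ x τ - tangentOf γ₂ x τ) +
      L2sq (fun x => metricOf γ₁ x τ - metricOf γ₂ x τ)) fun τ hτ => by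
        rw [uIcc_of_le ht.1] at hτ
        exact (hS τ ⟨hτ.1, hτ.2.trans ht.2⟩).symm] at h
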